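/- arXiv:1912.03759 — 8 statements merged into one kernel-verified Lean document; each statement's English description precedes it below -/
import Mathlib

section
/- Bergman's Centralizer Theorem: let k be a field, s ≥ 1, and let a be an element of the free associative algebra k⟨x_1,…,x_s⟩ that is not a scalar. Then the centralizer C(a) = {b ∈ k⟨x_1,…,x_s⟩ : ab = ba} is isomorphic as a k-algebra to the polynomial ring k[t] in one variable. -/
namespace Bergman
open MonoidAlgebra

section Words
variable {A X : Type*}

/-- Maximal length of a word in the support. -/
noncomputable def wdeg [Semiring A] (f : MonoidAlgebra A (FreeMonoid X)) : ℕ :=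
  f.coeff.support.sup FreeMonoid.length

/-- All words in the support are shorter than `n`. -/
def SLt [Semiring A] (n : ℕ) (f : MonoidAlgebra A (FreeMonoid X)) : Prop :=
  ∀ w : FreeMonoid X, n ≤ w.length → f.coeff w = 0

lemma fm_append_inj {u v u' v' : FreeMonoid X} (h : u * v = u' * v')
    (hl : u.length = u'.length) : u = u' ∧ v = v' :=
  List.append_inj (s₁ := u.toList) (s₂ := u'.toList) h hl

lemma fm_prefix {u v u' v' : FreeMonoid X} (h : u * v = u' * v')
    (hl : u.length ≤ u'.length) : ∃ z, u' = u * z ∧ v = z * v' := by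
  have h' : u.toList ++ v.toList = u'.toList ++ v'.toList := h
  rcases List.append_eq_append_iff.1 h' with ⟨z, h1, h2⟩ | ⟨z, h1, h2⟩
  · exact ⟨FreeMonoid.ofList z, h1, h2⟩
  · have : z = [] := by
      have hh : u.length = u'.length + z.length := by
        have := congrArg List.length h1
        rw [List.length_append] at this
        exact this
      exact List.length_eq_zero_iff.1 (by omega)
    subst this
    refine ⟨1, ?_, ?_⟩
    · simp only [List.append_nil] at h1
      rw [mul_one]; exact h1.symm
    · simp only [List.nil_append] at h2
      rw [one_mul]; exact h2.symm

lemma le_wdeg [Semiring A] {f : MonoidAlgebra A (FreeMonoid X)} {w : FreeMonoid X}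
    (h : f.coeff w ≠ 0) : w.length ≤ wdeg f :=
  Finset.le_sup (f := FreeMonoid.length) (Finsupp.mem_support_iff.2 h)

lemma exists_wdeg [Semiring A] {f : MonoidAlgebra A (FreeMonoid X)} (h : f ≠ 0) :
    ∃ w, f.coeff w ≠ 0 ∧ w.length = wdeg f := by
  have : f.coeff.support.Nonempty := by
    rw [Finsupp.support_nonempty_iff]
    simpa using h
  obtain ⟨w, hw, e⟩ := Finset.exists_mem_eq_sup _ this FreeMonoid.length
  exact ⟨w, Finsupp.mem_support_iff.1 hw, e.symm⟩

lemma SLt_iff [Semiring A] {n : ℕ} {f : MonoidAlgebra A (FreeMonoid X)} (hf : f ≠ 0) :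
    SLt n f ↔ wdeg f < n := by
  constructor
  · intro h
    obtain ⟨w, h1, h2⟩ := exists_wdeg hf
    by_contra h3
    exact h1 (h w (by omega))
  · intro h w hw
    by_contra h1
    have := le_wdeg h1
    omega

lemma SLt.mono [Semiring A] {n m : ℕ} {f : MonoidAlgebra A (FreeMonoid X)} (h : SLt n f)
    (hm : n ≤ m) : SLt m f := fun w hw => h w (hm.trans hw)

lemma SLt.add [Semiring A] {n : ℕ} {f g : MonoidAlgebra A (FreeMonoid X)} (h : SLt n f)
    (hg : SLt n g) : SLt n (f + g) := fun w hw => by simp [h w hw, hg w hw]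

lemma SLt.sub [Ring A] {n : ℕ} {f g : MonoidAlgebra A (FreeMonoid X)} (h : SLt n f)
    (hg : SLt n g) : SLt n (f - g) := fun w hw => by simp [h w hw, hg w hw]

lemma coeff_mul_top [Semiring A] {f g : MonoidAlgebra A (FreeMonoid X)} {u v : FreeMonoid X}
    (hu : u.length = wdeg f) (hv : v.length = wdeg g) :
    (f * g).coeff (u * v) = f.coeff u * g.coeff v := by
  apply coeff_mul_mul_of_uniqueMul
  intro u' v' hu' hv' h
  have h1 := le_wdeg (Finsupp.mem_support_iff.1 hu')
  have h2 := le_wdeg (Finsupp.mem_support_iff.1 hv')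
  have h3 := congrArg FreeMonoid.length h
  simp only [FreeMonoid.length_mul] at h3
  exact fm_append_inj h (by omega)

lemma wdeg_mul_le [Semiring A] (f g : MonoidAlgebra A (FreeMonoid X)) :
    wdeg (f * g) ≤ wdeg f + wdeg g := by
  classical
  apply Finset.sup_le
  intro w hw
  obtain ⟨u, hu, v, hv, rfl⟩ := Finset.mem_mul.1 (support_coeff_mul_subset f g hw)
  rw [FreeMonoid.length_mul]
  exact add_le_add (le_wdeg (Finsupp.mem_support_iff.1 hu)) (le_wdeg (Finsupp.mem_support_iff.1 hv))

lemma wdeg_mul [Semiring A] [NoZeroDivisors A] {f g : MonoidAlgebra A (FreeMonoid X)}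
    (hf : f ≠ 0) (hg : g ≠ 0) : wdeg (f * g) = wdeg f + wdeg g := by
  apply le_antisymm (wdeg_mul_le f g)
  obtain ⟨u, h1, h2⟩ := exists_wdeg hf
  obtain ⟨v, h3, h4⟩ := exists_wdeg hg
  rw [← h2, ← h4, ← FreeMonoid.length_mul]
  apply le_wdeg
  rw [coeff_mul_top h2 h4]
  exact mul_ne_zero h1 h3

/-- Right transduction: strip the suffix `w`. -/
noncomputable def strip [Semiring A] (w : FreeMonoid X) :
    MonoidAlgebra A (FreeMonoid X) →+ MonoidAlgebra A (FreeMonoid X) :=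
  comapDomainAddMonoidHom (· * w) (fun _ _ h => mul_right_cancel h)

lemma coeff_strip [Semiring A] (w v : FreeMonoid X) (f : MonoidAlgebra A (FreeMonoid X)) :
    (strip w f).coeff v = f.coeff (v * w) := rfl

lemma strip_mul [Semiring A] (b c : MonoidAlgebra A (FreeMonoid X)) (w v : FreeMonoid X)
    (hv : wdeg b ≤ v.length) : (b * c).coeff (v * w) = (b * strip w c).coeff v := by
  classical
  induction c using MonoidAlgebra.induction_linear with
  | zero => simp
  | add f g hf hg => simp [mul_add, hf, hg]
  | single u r =>
    by_cases hu : ∃ z, u = z * w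
    · obtain ⟨z, rfl⟩ := hu
      have : strip w (single (z * w) r) = single z r := by
        ext x
        rw [coeff_strip, coeff_single, coeff_single, Finsupp.single_apply, Finsupp.single_apply]
        simp
      rw [this, coeff_mul, coeff_mul]
      simp [← mul_assoc]
    · have : strip w (single u r) = 0 := by
        ext x
        rw [coeff_strip, coeff_single, Finsupp.single_apply, if_neg (fun h => hu ⟨x, h⟩)]
        simp
      rw [this, coeff_mul, Finsupp.sum]
      simp only [mul_zero, coeff_zero, Finsupp.coe_zero, Pi.zero_apply]
      apply Finset.sum_eq_zero
      intro p hp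
      have hp' := le_wdeg (Finsupp.mem_support_iff.1 hp)
      rw [coeff_single, Finsupp.sum_single_index (by simp), if_neg]
      intro h
      obtain ⟨z, -, h2⟩ := fm_prefix h (hp'.trans hv)
      exact hu ⟨z, h2⟩

/-- Weak algorithm (fraction-free form). -/
lemma weak_alg [CommRing A] {b c b' c' : MonoidAlgebra A (FreeMonoid X)}
    (hc : c ≠ 0) (hb : wdeg b' ≤ wdeg b)
    (h : SLt (wdeg b + wdeg c) (b * c - b' * c')) :
    ∃ (r : A) (d : MonoidAlgebra A (FreeMonoid X)), r ≠ 0 ∧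
      SLt (wdeg b) (b * single 1 r - b' * d) := by
  classical
  obtain ⟨w, h1, h2⟩ := exists_wdeg hc
  refine ⟨c.coeff w, strip w c', h1, ?_⟩
  have hs : strip w c = single 1 (c.coeff w) := by
    ext x
    rw [coeff_strip, coeff_single]
    by_cases hx : x = 1
    · simp [hx]
    · rw [Finsupp.single_apply, if_neg (Ne.symm hx)]
      by_contra h3
      have h4 := le_wdeg h3
      rw [FreeMonoid.length_mul] at h4
      exact hx (FreeMonoid.length_eq_zero.1 (by omega))
  intro v hv
  rw [coeff_sub, Finsupp.sub_apply, ← hs, ← strip_mul b c w v hv,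
    ← strip_mul b' c' w v (hb.trans hv), ← Finsupp.sub_apply, ← coeff_sub]
  exact h _ (by rw [FreeMonoid.length_mul]; omega)

end Words

section Field
variable {k X : Type*} [Field k]

lemma wdeg_of_SLt_sub {f g : MonoidAlgebra k (FreeMonoid X)} (hf : f ≠ 0)
    (h : SLt (wdeg f) (f - g)) : g ≠ 0 ∧ wdeg g = wdeg f := by
  obtain ⟨w, h1, h2⟩ := exists_wdeg hf
  have h3 := h w h2.ge
  rw [coeff_sub, Finsupp.sub_apply, sub_eq_zero] at h3
  have hg : g ≠ 0 := by
    rintro rfl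
    simp at h3
    exact h1 h3
  refine ⟨hg, le_antisymm ?_ (h2 ▸ le_wdeg (h3 ▸ h1))⟩
  obtain ⟨v, h4, h5⟩ := exists_wdeg hg
  by_contra hlt
  have h6 := h v (by omega)
  rw [coeff_sub, Finsupp.sub_apply, sub_eq_zero] at h6
  have := le_wdeg (h6 ▸ h4)
  omega

lemma weak_alg_field {b c b' c' : MonoidAlgebra k (FreeMonoid X)}
    (hc : c ≠ 0) (hb : wdeg b' ≤ wdeg b)
    (h : SLt (wdeg b + wdeg c) (b * c - b' * c')) :
    ∃ (d : MonoidAlgebra k (FreeMonoid X)), SLt (wdeg b) (b - b' * d) := by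
  obtain ⟨r, d, hr, hd⟩ := weak_alg hc hb h
  refine ⟨d * single 1 r⁻¹, fun v hv => ?_⟩
  have h1 := hd v hv
  have h2 : b - b' * (d * single 1 r⁻¹) = (b * single 1 r - b' * d) * single 1 r⁻¹ := by
    rw [sub_mul, mul_assoc, mul_assoc, single_mul_single, mul_inv_cancel₀ hr, mul_one,
      ← one_def, mul_one]
  rw [h2, coeff_mul_single_one, h1, zero_mul]

lemma eq_scalar_of_wdeg {d : MonoidAlgebra k (FreeMonoid X)} (h : wdeg d = 0) :
    d = single 1 (d.coeff 1) := by
  classical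
  ext v
  rw [coeff_single, Finsupp.single_apply]
  split_ifs with hv
  · rw [hv]
  · by_contra h1
    have := le_wdeg h1
    exact hv (FreeMonoid.length_eq_zero.1 (by omega)).symm

lemma wdeg_pow {a : MonoidAlgebra k (FreeMonoid X)} (ha : a ≠ 0) (N : ℕ) :
    wdeg (a ^ N) = N * wdeg a := by
  induction N with
  | zero =>
    simp only [pow_zero, zero_mul]
    apply Nat.le_zero.1
    apply Finset.sup_le
    intro w hw
    have := support_coeff_one_subset hw
    simp only [Finset.mem_one] at this
    simp [this]
  | succ n ih => rw [pow_succ, wdeg_mul (pow_ne_zero n ha) ha, ih]; ring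

lemma exists_left_factor {a b : MonoidAlgebra k (FreeMonoid X)} (hb : b ≠ 0)
    (hab : a * b = b * a) (hd : wdeg b ≤ wdeg a) : ∃ d, SLt (wdeg a) (a - b * d) :=
  weak_alg_field (c' := a) hb hd (by rw [hab, sub_self]; intro w _; simp)

lemma lead_unique {a b b' : MonoidAlgebra k (FreeMonoid X)} (ha : 0 < wdeg a) (hb : b ≠ 0)
    (hb' : b' ≠ 0) (hab : Commute a b) (hab' : Commute a b') (hd : wdeg b = wdeg b') :
    ∃ r : k, SLt (wdeg b) (b - b' * single 1 r) := by
  have ha0 : a ≠ 0 := by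
    rintro rfl
    simp [wdeg] at ha
  have hN : wdeg b ≤ wdeg (a ^ wdeg b) := by
    rw [wdeg_pow ha0]
    exact Nat.le_mul_of_pos_right _ ha
  have hA := pow_ne_zero (wdeg b) ha0
  obtain ⟨d, h1⟩ := exists_left_factor hb (hab.pow_left (wdeg b)).eq hN
  obtain ⟨d', h1'⟩ := exists_left_factor hb' (hab'.pow_left (wdeg b)).eq (hd ▸ hN)
  obtain ⟨h2, h3⟩ := wdeg_of_SLt_sub hA h1
  have hd0 : d ≠ 0 := by rintro rfl; simp at h2
  rw [wdeg_mul hb hd0] at h3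
  have h4 : SLt (wdeg b + wdeg d) (b * d - b' * d') := by
    rw [h3]
    have := h1'.sub h1
    rwa [sub_sub_sub_cancel_left] at this
  obtain ⟨e, h5⟩ := weak_alg_field hd0 hd.ge h4
  obtain ⟨h6, h7⟩ := wdeg_of_SLt_sub hb h5
  have he0 : e ≠ 0 := by rintro rfl; simp at h6
  rw [wdeg_mul hb' he0] at h7
  have := eq_scalar_of_wdeg (d := e) (by omega)
  exact ⟨e.coeff 1, by rw [← this]; exact h5⟩

open Polynomial in
lemma centralizer_fg {a : MonoidAlgebra k (FreeMonoid X)} (ha : 0 < wdeg a) :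
    ∃ g : Fin (wdeg a) → MonoidAlgebra k (FreeMonoid X), (∀ i, Commute a (g i)) ∧
      ∀ x, Commute a x → ∃ f : Fin (wdeg a) → k[X], x = ∑ i, aeval a (f i) * g i := by
  classical
  have ha0 : a ≠ 0 := by
    rintro rfl
    simp [wdeg] at ha
  have key : ∀ i : Fin (wdeg a), ∃ y, Commute a y ∧
      ∀ x, Commute a x → x ≠ 0 → wdeg x % wdeg a = i → y ≠ 0 ∧ wdeg y % wdeg a = i ∧
        wdeg y ≤ wdeg x := by
    intro i
    by_cases h : ∃ n : ℕ, ∃ y, Commute a y ∧ y ≠ 0 ∧ wdeg y % wdeg a = i ∧ wdeg y = n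
    · obtain ⟨y, h1, h2, h3, h4⟩ := Nat.find_spec h
      refine ⟨y, h1, fun x hx hx0 hxi => ⟨h2, h3, ?_⟩⟩
      rw [h4]
      exact Nat.find_min' h ⟨x, hx, hx0, hxi, rfl⟩
    · refine ⟨0, Commute.zero_right a, fun x hx hx0 hxi => ?_⟩
      exact absurd ⟨_, x, hx, hx0, hxi, rfl⟩ h
  choose g hg1 hg2 using key
  refine ⟨g, hg1, ?_⟩
  have main : ∀ n : ℕ, ∀ x, Commute a x → (SLt n x) →
      ∃ f : Fin (wdeg a) → k[X], x = ∑ i, aeval a (f i) * g i := by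
    intro n
    induction n with
    | zero =>
      intro x _ hx
      refine ⟨0, ?_⟩
      have : x = 0 := by ext w; simpa using hx w (Nat.zero_le _)
      simp [this]
    | succ n ih =>
      intro x hx hxn
      by_cases hx0 : x = 0
      · exact ⟨0, by simp [hx0]⟩
      let i : Fin (wdeg a) := ⟨wdeg x % wdeg a, Nat.mod_lt _ ha⟩
      obtain ⟨h1, h2, h3⟩ := hg2 i x hx hx0 rfl
      have h2' : wdeg (g i) ≡ wdeg x [MOD wdeg a] := h2
      obtain ⟨m, hm⟩ := (Nat.modEq_iff_dvd' h3).1 h2'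
      have hdeg : wdeg x = wdeg (a ^ m * g i) := by
        rw [wdeg_mul (pow_ne_zero _ ha0) h1, wdeg_pow ha0, mul_comm]
        omega
      obtain ⟨r, hr⟩ := lead_unique ha hx0 (mul_ne_zero (pow_ne_zero m ha0) h1) hx
        (((Commute.refl a).pow_right m).mul_right (hg1 i)) hdeg
      have hcen : ∀ y : MonoidAlgebra k (FreeMonoid X), Commute y (single 1 r) := fun y =>
        (single_commute (fun _ => Commute.one_left _) (fun _ => Commute.all _ _) y).symm
      obtain ⟨f, hf⟩ := ih (x - a ^ m * g i * single 1 r)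
        (hx.sub_right ((((Commute.refl a).pow_right m).mul_right (hg1 i)).mul_right (hcen a)))
        (hr.mono (by
          have := (SLt_iff hx0).1 hxn
          omega))
      refine ⟨f + Pi.single i (Polynomial.C r * Polynomial.X ^ m), ?_⟩
      have h5 : ∑ j, aeval a ((Pi.single i (Polynomial.C r * Polynomial.X ^ m) :
          Fin (wdeg a) → k[X]) j) * g j = a ^ m * g i * single 1 r := by
        rw [Finset.sum_eq_single i]
        · rw [Pi.single_eq_same, (hcen _).eq]
          simp [mul_assoc]
        · intro j _ hj
          simp [Pi.single_eq_of_ne hj]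
        · simp
      simp only [Pi.add_apply, map_add, add_mul, Finset.sum_add_distrib]
      rw [h5, ← hf]
      abel
  intro x hx
  exact main (wdeg x + 1) x hx (fun w hw => by
    by_contra h
    have := le_wdeg h
    omega)

end Field

section Order
variable {k : Type*} [Field k] {s : ℕ}

/-- The number whose base `s+1` digits are the letters of the word. -/
def wval (u : FreeMonoid (Fin s)) : ℕ := Nat.ofDigits (s + 1) (u.toList.map Fin.val)

/-- The sign of `theta z u` compares the infinite word `u u u ⋯` with `z`. -/
def theta (z : ℚ) (u : FreeMonoid (Fin s)) : ℚ :=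
  wval u - z * (((s : ℚ) + 1) ^ u.length - 1)

lemma theta_one (z : ℚ) : theta z (1 : FreeMonoid (Fin s)) = 0 := by
  simp [theta, wval]

lemma theta_mul (z : ℚ) (u v : FreeMonoid (Fin s)) :
    theta z (u * v) = theta z u + ((s : ℚ) + 1) ^ u.length * theta z v := by
  have : wval (u * v) = wval u + (s + 1) ^ u.length * wval v := by
    unfold wval
    rw [FreeMonoid.toList_mul, List.map_append, Nat.ofDigits_append, List.length_map]
    rfl
  unfold theta
  rw [this, FreeMonoid.length_mul, pow_add]
  push_cast
  ring

lemma theta_mul_nonpos {z : ℚ} {u v : FreeMonoid (Fin s)} (hu : theta z u ≤ 0)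
    (hv : theta z v ≤ 0) : theta z (u * v) ≤ 0 := by
  rw [theta_mul]
  have : (0 : ℚ) < ((s : ℚ) + 1) ^ u.length := by positivity
  nlinarith

lemma theta_mul_eq_zero {z : ℚ} {u v : FreeMonoid (Fin s)} (hu : theta z u ≤ 0)
    (hv : theta z v ≤ 0) : theta z (u * v) = 0 ↔ theta z u = 0 ∧ theta z v = 0 := by
  rw [theta_mul]
  have h : (0 : ℚ) < ((s : ℚ) + 1) ^ u.length := by positivity
  constructor
  · intro h1
    have h2 : ((s : ℚ) + 1) ^ u.length * theta z v ≤ 0 := mul_nonpos_of_nonneg_of_nonpos h.le hv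
    have h3 : theta z u = 0 := by linarith
    refine ⟨h3, ?_⟩
    rw [h3, zero_add] at h1
    exact (mul_eq_zero.1 h1).resolve_left h.ne'
  · rintro ⟨h1, h2⟩
    simp [h1, h2]

lemma theta_inj {z : ℚ} {u v : FreeMonoid (Fin s)} (hs : 0 < s) (hu : theta z u = 0)
    (hv : theta z v = 0) (hl : u.length = v.length) : u = v := by
  unfold theta at hu hv
  rw [hl] at hu
  have h1 : (wval u : ℚ) = wval v := by linarith
  have h2 : wval u = wval v := by exact_mod_cast h1
  have h3 := Nat.ofDigits_inj_of_len_eq (b := s + 1) (by omega)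
    (L1 := u.toList.map Fin.val) (L2 := v.toList.map Fin.val)
    (by rw [List.length_map, List.length_map]; exact hl)
    (by
      intro l hl
      obtain ⟨x, -, rfl⟩ := List.mem_map.1 hl
      have := x.2
      omega)
    (by
      intro l hl
      obtain ⟨x, -, rfl⟩ := List.mem_map.1 hl
      have := x.2
      omega) h2
  exact List.map_injective_iff.2 Fin.val_injective h3

/-- Elements supported on words with `theta ≤ 0`. -/
def subB (k : Type*) [Field k] {s : ℕ} (z : ℚ) :
    Subalgebra k (MonoidAlgebra k (FreeMonoid (Fin s))) where
  carrier := {f | ∀ u, f.coeff u ≠ 0 → theta z u ≤ 0}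
  mul_mem' := by
    classical
    intro f g hf hg w hw
    obtain ⟨u, hu, v, hv, rfl⟩ :=
      Finset.mem_mul.1 (support_coeff_mul_subset f g (Finsupp.mem_support_iff.2 hw))
    exact theta_mul_nonpos (hf u (Finsupp.mem_support_iff.1 hu))
      (hg v (Finsupp.mem_support_iff.1 hv))
  add_mem' := by
    intro f g hf hg w hw
    by_cases h : f.coeff w = 0
    · apply hg
      intro h'
      exact hw (by simp [h, h'])
    · exact hf w h
  algebraMap_mem' := by
    classical
    intro r w hw
    have e : algebraMap k (MonoidAlgebra k (FreeMonoid (Fin s))) r = single 1 r := by simp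
    rw [e] at hw
    by_cases h : w = 1
    · rw [h, theta_one]
    · exfalso
      apply hw
      simp [Ne.symm h]

open Polynomial in
/-- Keep the words with `theta = 0`. -/
noncomputable def Phi (k : Type*) [Field k] {s : ℕ} (z : ℚ) :
    MonoidAlgebra k (FreeMonoid (Fin s)) →+ k[X] :=
  liftNC (Polynomial.C : k →+* k[X]).toAddMonoidHom
    (fun u => if theta z u = 0 then (Polynomial.X : k[X]) ^ u.length else 0)

lemma Phi_single (z : ℚ) (u : FreeMonoid (Fin s)) (r : k) :
    Phi k z (single u r) = if theta z u = 0 then Polynomial.C r * Polynomial.X ^ u.length else 0 := by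
  unfold Phi
  rw [liftNC_single]
  split_ifs <;> simp

lemma Phi_mul {z : ℚ} {f g : MonoidAlgebra k (FreeMonoid (Fin s))} (hf : f ∈ subB k z)
    (hg : g ∈ subB k z) : Phi k z (f * g) = Phi k z f * Phi k z g := by
  conv_rhs => rw [← sum_coeff_single f, ← sum_coeff_single g]
  rw [mul_def]
  simp only [Finsupp.sum, map_sum, Finset.sum_mul, Finset.mul_sum]
  rw [Finset.sum_comm]
  apply Finset.sum_congr rfl
  intro u hu
  apply Finset.sum_congr rfl
  intro v hv
  have h1 := hf _ (Finsupp.mem_support_iff.1 hv)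
  have h2 := hg _ (Finsupp.mem_support_iff.1 hu)
  rw [Phi_single, Phi_single, Phi_single]
  have := theta_mul_eq_zero h1 h2
  by_cases h3 : theta z v = 0
  · by_cases h4 : theta z u = 0
    · rw [if_pos (this.2 ⟨h3, h4⟩), if_pos h3, if_pos h4, FreeMonoid.length_mul, pow_add, map_mul]
      ring
    · rw [if_neg (fun h => h4 (this.1 h).2), if_neg h4, mul_zero]
  · rw [if_neg (fun h => h3 (this.1 h).1), if_neg h3, zero_mul]

open Polynomial in
/-- The algebra map on `subB`. -/
noncomputable def PhiHom (k : Type*) [Field k] {s : ℕ} (z : ℚ) :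
    subB k (s := s) z →ₐ[k] k[X] where
  toFun f := Phi k z f.1
  map_one' := by
    change Phi k z 1 = 1
    rw [one_def, Phi_single]
    simp [theta_one]
  map_zero' := (Phi k z).map_zero
  map_add' f g := (Phi k z).map_add f.1 g.1
  map_mul' f g := Phi_mul f.2 g.2
  commutes' r := by
    change Phi k z (algebraMap k (MonoidAlgebra k (FreeMonoid (Fin s))) r) = _
    have : algebraMap k (MonoidAlgebra k (FreeMonoid (Fin s))) r = single 1 r := by
      simp
    rw [this, Phi_single]
    simp [theta_one]

lemma Phi_coeff (hs : 0 < s) {z : ℚ} {u : FreeMonoid (Fin s)} (hu : theta z u = 0)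
    (f : MonoidAlgebra k (FreeMonoid (Fin s))) : (Phi k z f).coeff u.length = f.coeff u := by
  classical
  induction f using MonoidAlgebra.induction_linear with
  | zero => simp
  | add f g hf hg => simp [hf, hg]
  | single v r =>
    rw [Phi_single, coeff_single, Finsupp.single_apply]
    split_ifs with h1 h2 h2
    · subst h2; simp
    · rw [Polynomial.coeff_C_mul_X_pow, if_neg]
      exact fun h => h2 (theta_inj hs h1 hu h.symm)
    · subst h2
      exact absurd hu h1
    · simp

open Polynomial in
lemma exists_hom (hs : 0 < s) {a : MonoidAlgebra k (FreeMonoid (Fin s))} (ha : 0 < wdeg a) :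
    ∃ φ : Subalgebra.centralizer k ({a} : Set (MonoidAlgebra k (FreeMonoid (Fin s)))) →ₐ[k] k[X],
      ∃ x, (φ x).natDegree ≠ 0 := by
  classical
  obtain ⟨g, hg1, hg2⟩ := centralizer_fg ha
  have ha0 : a ≠ 0 := by
    rintro rfl
    simp [wdeg] at ha
  let gen : Option (Fin (wdeg a)) → MonoidAlgebra k (FreeMonoid (Fin s)) := fun i => i.elim a g
  have hgen : ∀ i, gen i ∈ Subalgebra.centralizer k
      ({a} : Set (MonoidAlgebra k (FreeMonoid (Fin s)))) := by
    intro i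
    rw [Subalgebra.mem_centralizer_iff]
    rintro _ rfl
    cases i with
    | none => rfl
    | some i => exact hg1 i
  let T : Finset (FreeMonoid (Fin s)) :=
    (Finset.univ.biUnion (fun i => (gen i).coeff.support)).filter (fun u => u ≠ 1)
  have hT : T.Nonempty := by
    obtain ⟨w, h1, h2⟩ := exists_wdeg ha0
    refine ⟨w, Finset.mem_filter.2 ⟨Finset.mem_biUnion.2 ⟨none, Finset.mem_univ _,
      Finsupp.mem_support_iff.2 h1⟩, ?_⟩⟩
    rintro rfl
    simp at h2
    omega
  let rho : FreeMonoid (Fin s) → ℚ := fun u => wval u / (((s : ℚ) + 1) ^ u.length - 1)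
  obtain ⟨w, hwT, hmax⟩ := Finset.exists_max_image T rho hT
  have hpos : ∀ u : FreeMonoid (Fin s), u ≠ 1 → 0 < ((s : ℚ) + 1) ^ u.length - 1 := by
    intro u hu
    have h1 : u.length ≠ 0 := fun h => hu (FreeMonoid.length_eq_zero.1 h)
    have h2 : (1 : ℚ) < (s : ℚ) + 1 := by
      have : (0 : ℚ) < s := by exact_mod_cast hs
      linarith
    have := one_lt_pow₀ h2 h1
    linarith
  have hw1 := (Finset.mem_filter.1 hwT).2
  have hle : ∀ u ∈ T, theta (rho w) u ≤ 0 := by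
    intro u hu
    have h1 := hpos u (Finset.mem_filter.1 hu).2
    have h2 := hmax u hu
    have h3 : (wval u : ℚ) = rho u * (((s : ℚ) + 1) ^ u.length - 1) := by
      simp only [rho]
      field_simp
    unfold theta
    rw [h3]
    nlinarith
  have hw0 : theta (rho w) w = 0 := by
    have h1 := hpos w hw1
    unfold theta
    simp only [rho]
    field_simp
    ring
  have hB : ∀ i, gen i ∈ subB k (rho w) := by
    intro i u hu
    by_cases h : u = 1
    · rw [h, theta_one]
    · exact hle u (Finset.mem_filter.2 ⟨Finset.mem_biUnion.2 ⟨i, Finset.mem_univ _,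
        Finsupp.mem_support_iff.2 hu⟩, h⟩)
  have hC : Subalgebra.centralizer k ({a} : Set (MonoidAlgebra k (FreeMonoid (Fin s)))) ≤
      subB k (rho w) := by
    intro x hx
    rw [Subalgebra.mem_centralizer_iff] at hx
    obtain ⟨f, rfl⟩ := hg2 x (hx a rfl)
    refine Subalgebra.sum_mem _ (fun i _ => Subalgebra.mul_mem _ ?_ (hB (some i)))
    have : aeval a (f i) = ((aeval (⟨a, hB none⟩ : subB k (rho w)) (f i) : subB k (rho w)) :
        MonoidAlgebra k (FreeMonoid (Fin s))) := by
      rw [← Subalgebra.coe_val, ← Polynomial.aeval_algHom_apply]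
      rfl
    rw [this]
    exact Subtype.coe_prop _
  obtain ⟨i, -, hi⟩ := Finset.mem_biUnion.1 (Finset.mem_filter.1 hwT).1
  refine ⟨(PhiHom k (rho w)).comp (Subalgebra.inclusion hC), ⟨gen i, hgen i⟩, ?_⟩
  change (Phi k (rho w) (gen i)).natDegree ≠ 0
  have h5 : (Phi k (rho w) (gen i)).coeff w.length ≠ 0 := by
    rw [Phi_coeff hs hw0]
    exact Finsupp.mem_support_iff.1 hi
  have h6 := Polynomial.le_natDegree_of_ne_zero h5
  have h7 : w.length ≠ 0 := fun h => hw1 (FreeMonoid.length_eq_zero.1 h)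
  omega

end Order

section Inj
open Polynomial
variable {k : Type*} [Field k] {s : ℕ}

lemma natDegree_of_aeval_eq_zero {p Q : k[X]} (hQ : Q ≠ 0) (h : aeval p Q = 0) :
    p.natDegree = 0 := by
  rw [← Polynomial.comp_eq_aeval] at h
  rcases Polynomial.comp_eq_zero_iff.1 h with h | ⟨-, h⟩
  · exact absurd h hQ
  · rw [h]; simp

lemma hom_injective {a : MonoidAlgebra k (FreeMonoid (Fin s))} (ha : 0 < wdeg a)
    (φ : Subalgebra.centralizer k ({a} : Set (MonoidAlgebra k (FreeMonoid (Fin s)))) →ₐ[k] k[X])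
    (hφ : ∃ x, (φ x).natDegree ≠ 0) : Function.Injective φ := by
  classical
  obtain ⟨g, hg1, hg2⟩ := centralizer_fg ha
  have hmem : ∀ x, Commute a x → x ∈ Subalgebra.centralizer k
      ({a} : Set (MonoidAlgebra k (FreeMonoid (Fin s)))) := by
    intro x hx
    rw [Subalgebra.mem_centralizer_iff]
    rintro _ rfl
    exact hx
  let C := Subalgebra.centralizer k ({a} : Set (MonoidAlgebra k (FreeMonoid (Fin s))))
  let ac : C := ⟨a, hmem a (Commute.refl a)⟩
  have hac : ∀ x : C, Commute ac x := by
    intro x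
    apply Subtype.ext
    exact Subalgebra.mem_centralizer_iff k |>.1 x.2 a rfl
  have hcomm : ∀ (p : k[X]) (x : C), (aeval ac).toRingHom p * x = x * (aeval ac).toRingHom p := by
    intro p x
    change aeval ac p * x = x * aeval ac p
    induction p using Polynomial.induction_on' with
    | add p q hp hq => simp [add_mul, mul_add, hp, hq]
    | monomial n r =>
      rw [aeval_monomial]
      exact (Algebra.commute_algebraMap_left r x).mul_left ((hac x).pow_left n)
  let : Algebra k[X] C := RingHom.toAlgebra' (aeval ac).toRingHom hcomm
  have hamap : ∀ p : k[X], algebraMap k[X] C p = aeval ac p := fun p => rfl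
  have : Module.Finite k[X] C := by
    refine ⟨⟨Finset.univ.image (fun i => (⟨g i, hmem _ (hg1 i)⟩ : C)), ?_⟩⟩
    rw [eq_top_iff]
    rintro x -
    obtain ⟨f, hf⟩ := hg2 x.1 (Subalgebra.mem_centralizer_iff k |>.1 x.2 a rfl)
    have : x = ∑ i, f i • (⟨g i, hmem _ (hg1 i)⟩ : C) := by
      apply Subtype.ext
      rw [hf, AddSubmonoidClass.coe_finsetSum]
      apply Finset.sum_congr rfl
      intro i _
      rw [Algebra.smul_def, hamap, Subalgebra.coe_mul, ← Subalgebra.coe_val,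
        ← Polynomial.aeval_algHom_apply]
      rfl
    rw [this]
    refine Submodule.sum_mem _ (fun i _ => Submodule.smul_mem _ _ (Submodule.subset_span ?_))
    simp
  have hIntegral : ∀ x : C, IsIntegral k[X] x := fun x => Algebra.IsIntegral.isIntegral x
  rw [injective_iff_map_eq_zero]
  intro x hx
  by_contra hx0
  obtain ⟨q, hq0, hq⟩ := (hIntegral x).isAlgebraic.exists_nonzero_coeff_and_aeval_eq_zero
    (mem_nonZeroDivisors_of_ne_zero hx0)
  have h1 : aeval (φ ac) (q.coeff 0) = 0 := by
    have h2 := hq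
    rw [← Polynomial.divX_mul_X_add q] at h2
    simp only [map_add, map_mul, aeval_X, aeval_C] at h2
    have h3 := congrArg φ h2
    rw [map_add, map_mul, hx, mul_zero, zero_add, map_zero, hamap,
      ← Polynomial.aeval_algHom_apply] at h3
    exact h3
  have h4 := natDegree_of_aeval_eq_zero hq0 h1
  obtain ⟨c, hc⟩ := Polynomial.natDegree_eq_zero.1 h4
  obtain ⟨y, hy⟩ := hφ
  apply hy
  obtain ⟨P, hP, hPy⟩ := hIntegral y
  apply natDegree_of_aeval_eq_zero (Q := P.map (evalRingHom c)) (hP.map _).ne_zero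
  have h6 : φ.toRingHom.comp (algebraMap k[X] C) = (Polynomial.C).comp (evalRingHom c) := by
    apply RingHom.ext
    intro p
    change φ (aeval ac p) = Polynomial.C (eval c p)
    rw [← Polynomial.aeval_algHom_apply, ← hc]
    exact Polynomial.aeval_algebraMap_apply_eq_algebraMap_eval c p
  have h7 := congrArg φ.toRingHom hPy
  rw [Polynomial.hom_eval₂, h6, map_zero] at h7
  rw [aeval_def, eval₂_map]
  exact h7

end Inj
section Gcd
variable {A X : Type*} [CommRing A] [IsDomain A]

lemma ff_gcd_aux (n : ℕ) : ∀ (x y u v : MonoidAlgebra A (FreeMonoid X)), wdeg x + wdeg y < n →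
    x ≠ 0 → y ≠ 0 → u ≠ 0 → x * u = y * v →
    ∃ (P x' y' U V : MonoidAlgebra A (FreeMonoid X)) (α β : A), α ≠ 0 ∧ β ≠ 0 ∧
      α • x = P * x' ∧ α • y = P * y' ∧ β • P = x * U + y * V := by
  induction n with
  | zero => intro x y u v h; omega
  | succ n ih =>
    have key : ∀ (x y u v : MonoidAlgebra A (FreeMonoid X)), wdeg x + wdeg y < n + 1 →
        wdeg y ≤ wdeg x → x ≠ 0 → y ≠ 0 → u ≠ 0 → x * u = y * v →
        ∃ (P x' y' U V : MonoidAlgebra A (FreeMonoid X)) (α β : A), α ≠ 0 ∧ β ≠ 0 ∧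
          α • x = P * x' ∧ α • y = P * y' ∧ β • P = x * U + y * V := by
      intro x y u v hn hle hx hy hu h
      obtain ⟨r, d, hr, hd⟩ := weak_alg (b := x) (b' := y) (c := u) (c' := v) hu hle
        (by rw [h, sub_self]; intro w _; simp)
      have hxr : x * single 1 r = r • x := by
        rw [← (single_commute (fun _ => Commute.one_left _) (fun _ => Commute.all _ _) x).eq]
        ext w
        rw [coeff_single_one_mul]
        simp
      rw [hxr] at hd
      by_cases h0 : r • x - y * d = 0
      · refine ⟨y, d, r • 1, 0, 1, r, 1, hr, one_ne_zero, sub_eq_zero.1 h0, ?_, ?_⟩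
        · simp
        · simp
      · have hlt := (SLt_iff h0).1 hd
        obtain ⟨P, x', y', U, V, α, β, hα, hβ, h1, h2, h3⟩ :=
          ih (r • x - y * d) y u (r • v - d * u) (by omega) h0 hy hu (by
            rw [sub_mul, smul_mul_assoc, h, mul_sub, mul_smul_comm, mul_assoc])
        refine ⟨P, x' + y' * d, r • y', r • U, V - d * U, α * r, β, mul_ne_zero hα hr, hβ,
          ?_, ?_, ?_⟩
        · rw [mul_add, ← h1, ← mul_assoc, ← h2, smul_sub, smul_mul_assoc, mul_smul]; abel
        · rw [mul_comm, mul_smul, h2, mul_smul_comm]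
        · rw [h3, sub_mul, mul_sub, smul_mul_assoc, mul_smul_comm, mul_assoc]; abel
    intro x y u v hn hx hy hu h
    rcases le_total (wdeg y) (wdeg x) with hle | hle
    · exact key x y u v hn hle hx hy hu h
    · have hv : v ≠ 0 := by
        rintro rfl
        rw [mul_zero] at h
        rcases mul_eq_zero.1 h with h | h
        · exact hx h
        · exact hu h
      obtain ⟨P, x', y', U, V, α, β, hα, hβ, h1, h2, h3⟩ :=
        key y x v u (by omega) hle hy hx hv h.symm
      exact ⟨P, y', x', V, U, α, β, hα, hβ, h2, h1, by rw [h3, add_comm]⟩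

lemma ff_gcd {x y u v : MonoidAlgebra A (FreeMonoid X)}
    (hx : x ≠ 0) (hy : y ≠ 0) (hu : u ≠ 0) (h : x * u = y * v) :
    ∃ (P x' y' U V : MonoidAlgebra A (FreeMonoid X)) (α β : A), α ≠ 0 ∧ β ≠ 0 ∧
      α • x = P * x' ∧ α • y = P * y' ∧ β • P = x * U + y * V :=
  ff_gcd_aux _ x y u v (Nat.lt_succ_self _) hx hy hu h

end Gcd

section Psi
open Polynomial
variable {k W : Type*} [Field k] [Monoid W]

/-- forward map -/
noncomputable def psiHom (k W : Type*) [Field k] [Monoid W] :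
    MonoidAlgebra k[X] W →+* (MonoidAlgebra k W)[X] :=
  liftNCRingHom (Polynomial.mapRingHom (algebraMap k (MonoidAlgebra k W)))
    ((Polynomial.C : MonoidAlgebra k W →+* (MonoidAlgebra k W)[X]).toMonoidHom.comp
      (MonoidAlgebra.of k W)) (by
      intro f w
      induction f using Polynomial.induction_on' with
      | add p q hp hq => rw [map_add]; exact hp.add_left hq
      | monomial n c =>
        rw [Polynomial.coe_mapRingHom, Polynomial.map_monomial, ← Polynomial.C_mul_X_pow_eq_monomial]
        refine Commute.mul_left ?_ (Polynomial.commute_X_pow _ _)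
        change Polynomial.C _ * Polynomial.C _ = Polynomial.C _ * Polynomial.C _
        rw [← Polynomial.C_mul, ← Polynomial.C_mul, Algebra.commutes])

/-- backward map -/
noncomputable def psiInv (k W : Type*) [Field k] [Monoid W] :
    (MonoidAlgebra k W)[X] →+* MonoidAlgebra k[X] W :=
  Polynomial.eval₂RingHom' (MonoidAlgebra.mapRingHom W (Polynomial.C : k →+* k[X]))
    (single 1 Polynomial.X) (fun _ => (single_commute (fun _ => Commute.one_left _)
      (fun _ => Commute.all _ _) _).symm)

lemma psiHom_single (w : W) (f : k[X]) : psiHom k W (single w f) =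
    Polynomial.map (algebraMap k (MonoidAlgebra k W)) f * Polynomial.C (single w 1) := by
  simp [psiHom]

lemma psiInv_C (r : MonoidAlgebra k W) :
    psiInv k W (Polynomial.C r) = MonoidAlgebra.mapRingHom W (Polynomial.C : k →+* k[X]) r := by
  simp [psiInv]

lemma psiInv_X : psiInv k W Polynomial.X = single 1 Polynomial.X := by
  simp [psiInv]

lemma psiInv_map (f : k[X]) : psiInv k W (Polynomial.map (algebraMap k (MonoidAlgebra k W)) f) =
    single 1 f := by
  induction f using Polynomial.induction_on' with
  | add p q hp hq => rw [Polynomial.map_add, map_add, hp, hq, single_add]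
  | monomial n c =>
    rw [Polynomial.map_monomial, ← Polynomial.C_mul_X_pow_eq_monomial, map_mul, map_pow, psiInv_C,
      psiInv_X, ← Polynomial.C_mul_X_pow_eq_monomial]
    simp [single_pow, single_mul_single]

/-- the equivalence -/
noncomputable def psi (k W : Type*) [Field k] [Monoid W] :
    MonoidAlgebra k[X] W ≃+* (MonoidAlgebra k W)[X] :=
  RingEquiv.ofRingHom (psiHom k W) (psiInv k W) (by
    refine RingHom.ext fun f => ?_
    rw [RingHom.comp_apply, RingHom.id_apply]
    induction f using Polynomial.induction_on' with
    | add p q hp hq => simp only [map_add, hp, hq]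
    | monomial n c =>
      rw [← Polynomial.C_mul_X_pow_eq_monomial, map_mul, map_mul, map_pow, map_pow, psiInv_X,
        psiInv_C]
      congr 1
      · induction c using MonoidAlgebra.induction_linear with
        | zero => simp
        | add p q hp hq => simp only [map_add, hp, hq]
        | single w f =>
          rw [MonoidAlgebra.coe_mapRingHom, MonoidAlgebra.map_single, psiHom_single]
          change Polynomial.map _ (Polynomial.C f) * _ = _
          rw [Polynomial.map_C, ← Polynomial.C_mul]
          simp [single_mul_single]
      · rw [psiHom_single]; simp [← MonoidAlgebra.one_def]) (by
    refine RingHom.ext fun f => ?_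
    rw [RingHom.comp_apply, RingHom.id_apply]
    induction f using MonoidAlgebra.induction_linear with
    | zero => simp
    | add p q hp hq => simp only [map_add, hp, hq]
    | single w f =>
      rw [psiHom_single, map_mul, psiInv_map, psiInv_C]
      simp [single_mul_single])

lemma psi_smul (γ : k[X]) (f : MonoidAlgebra k[X] W) :
    psi k W (γ • f) = Polynomial.map (algebraMap k (MonoidAlgebra k W)) γ * psi k W f := by
  have : γ • f = single 1 γ * f := by
    ext w
    rw [coeff_single_one_mul]
    simp
  rw [this, map_mul]
  congr 1
  change psiHom k W _ = _
  rw [psiHom_single]; simp [← MonoidAlgebra.one_def]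

end Psi

section Gauss
variable {A X : Type*} [CommRing A] [IsDomain A]

/-- not divisible by a prime scalar -/
def Prim (f : MonoidAlgebra A (FreeMonoid X)) : Prop :=
  ∀ π : A, Prime π → ∀ g, f ≠ π • g

lemma dvd_iff_map (π : A) (f : MonoidAlgebra A (FreeMonoid X)) :
    (∃ g, f = π • g) ↔ MonoidAlgebra.mapRingHom (FreeMonoid X)
      (Ideal.Quotient.mk (Ideal.span {π})) f = 0 := by
  constructor
  · rintro ⟨g, rfl⟩
    ext w
    rw [coeff_mapRingHom]
    simp
  · intro h
    have h1 : ∀ w, π ∣ f.coeff w := by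
      intro w
      have := congrArg (fun g => g.coeff w) h
      simp only [coeff_mapRingHom] at this
      rw [← Ideal.mem_span_singleton, ← Ideal.Quotient.eq_zero_iff_mem]
      simpa using this
    choose q hq using h1
    refine ⟨∑ w ∈ f.coeff.support, single w (q w), ?_⟩
    conv_lhs => rw [← sum_coeff_single f]
    rw [Finset.smul_sum, Finsupp.sum]
    refine Finset.sum_congr rfl fun w _ => ?_
    rw [hq w]
    simp

lemma gauss {π : A} (hπ : Prime π) {f g h : MonoidAlgebra A (FreeMonoid X)} (hf : f * g = π • h) :
    (∃ f', f = π • f') ∨ (∃ g', g = π • g') := by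
  rw [dvd_iff_map, dvd_iff_map]
  have : (Ideal.span {π}).IsPrime := (Ideal.span_singleton_prime hπ.ne_zero).2 hπ
  rw [← mul_eq_zero, ← map_mul]
  exact (dvd_iff_map _ _).1 ⟨h, hf⟩

lemma smul_cancel {π : A} (hπ : π ≠ 0) {f g : MonoidAlgebra A (FreeMonoid X)}
    (h : π • f = π • g) : f = g := by
  ext w
  have := congrArg (fun g => g.coeff w) h
  simpa [hπ] using this

variable [UniqueFactorizationMonoid A]

lemma prim_left {f : MonoidAlgebra A (FreeMonoid X)} (hf : Prim f) {α : A} (hα : α ≠ 0) :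
    ∀ {b b' : MonoidAlgebra A (FreeMonoid X)}, α • b' = f * b → ∃ b'', b' = f * b'' := by
  suffices H : ∀ {b b' : MonoidAlgebra A (FreeMonoid X)}, α • b' = f * b → ∃ b'', b = α • b'' by
    intro b b' h
    obtain ⟨c, rfl⟩ := H h
    refine ⟨c, smul_cancel hα ?_⟩
    rw [h, mul_smul_comm]
  induction α using UniqueFactorizationMonoid.induction_on_prime with
  | h₁ => exact (hα rfl).elim
  | h₂ x hx =>
    intro b b' h
    obtain ⟨u, rfl⟩ := hx
    exact ⟨(↑u⁻¹ : A) • b, by rw [smul_smul]; simp⟩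
  | h₃ x π hx hπ ih =>
    intro b b' h
    rw [mul_smul] at h
    rcases gauss hπ h.symm with ⟨f', h'⟩ | ⟨c, rfl⟩
    · exact (hf π hπ f' h').elim
    · rw [mul_smul_comm] at h
      obtain ⟨d, rfl⟩ := ih hx (smul_cancel hπ.ne_zero h)
      exact ⟨d, by rw [mul_smul]⟩

lemma prim_right {f : MonoidAlgebra A (FreeMonoid X)} (hf : Prim f) {α : A} (hα : α ≠ 0) :
    ∀ {b b' : MonoidAlgebra A (FreeMonoid X)}, α • b' = b * f →
      ∃ b'', b = α • b'' ∧ b' = b'' * f := by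
  suffices H : ∀ {b b' : MonoidAlgebra A (FreeMonoid X)}, α • b' = b * f → ∃ b'', b = α • b'' by
    intro b b' h
    obtain ⟨c, rfl⟩ := H h
    refine ⟨c, rfl, smul_cancel hα ?_⟩
    rw [h, smul_mul_assoc]
  induction α using UniqueFactorizationMonoid.induction_on_prime with
  | h₁ => exact (hα rfl).elim
  | h₂ x hx =>
    intro b b' h
    obtain ⟨u, rfl⟩ := hx
    exact ⟨(↑u⁻¹ : A) • b, by rw [smul_smul]; simp⟩
  | h₃ x π hx hπ ih =>
    intro b b' h
    rw [mul_smul] at h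
    rcases gauss hπ h.symm with ⟨c, rfl⟩ | ⟨f', h'⟩
    · rw [smul_mul_assoc] at h
      obtain ⟨d, rfl⟩ := ih hx (smul_cancel hπ.ne_zero h)
      exact ⟨d, by rw [mul_smul]⟩
    · exact (hf π hπ f' h').elim

lemma exists_prim {f : MonoidAlgebra A (FreeMonoid X)} (hf : f ≠ 0) :
    ∃ (γ : A) (f0 : MonoidAlgebra A (FreeMonoid X)), γ ≠ 0 ∧ Prim f0 ∧ f = γ • f0 := by
  obtain ⟨w, hw, -⟩ := exists_wdeg hf
  obtain ⟨c, hc⟩ : ∃ c, c = f.coeff w := ⟨_, rfl⟩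
  have wf : WellFounded (DvdNotUnit : A → A → Prop) := IsWellFounded.wf
  induction c using wf.induction generalizing f with
  | _ c ih =>
    by_cases hp : Prim f
    · exact ⟨1, f, one_ne_zero, hp, by simp⟩
    · simp only [Prim] at hp
      push Not at hp
      obtain ⟨π, hπ, g, rfl⟩ := hp
      simp only [coeff_smul, Finsupp.smul_apply, smul_eq_mul] at hw hc
      have h2 : g.coeff w ≠ 0 := right_ne_zero_of_mul hw
      obtain ⟨γ, f0, h3, h4, h5⟩ := ih (g.coeff w) ⟨h2, π, hπ.not_isUnit, by rw [hc, mul_comm]⟩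
        (f := g) (by rintro rfl; simp at h2) h2 rfl
      exact ⟨π * γ, f0, mul_ne_zero hπ.ne_zero h3, h4, by rw [mul_smul, h5]⟩

end Gauss

section NC
open Polynomial
variable {k X : Type*} [Field k]

lemma psi_smul_natDegree {γ : k[X]} (hγ : γ ≠ 0) {f : MonoidAlgebra k[X] (FreeMonoid X)}
    (hf : f ≠ 0) : (psi k _ (γ • f)).natDegree = γ.natDegree + (psi k _ f).natDegree := by
  have inj : Function.Injective (algebraMap k (MonoidAlgebra k (FreeMonoid X))) :=
    (algebraMap k _).injective
  rw [psi_smul, Polynomial.natDegree_mul, Polynomial.natDegree_map]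
  · rwa [Ne, Polynomial.map_eq_zero_iff inj]
  · simpa using hf

lemma isUnit_of_mul {R : Type*} [Ring R] [IsDomain R] {x y : R} (h : IsUnit (x * y)) :
    IsUnit x ∧ IsUnit y := by
  obtain ⟨u, hu⟩ := h
  have h1 : x * (y * (↑u⁻¹ : R)) = 1 := by rw [← mul_assoc, ← hu]; simp
  have h2 : ((↑u⁻¹ : R) * x) * y = 1 := by rw [mul_assoc, ← hu]; simp
  have hx : x ≠ 0 := by rintro rfl; simp at h1
  have hy : y ≠ 0 := by rintro rfl; simp at h2
  have h3 : (y * (↑u⁻¹ : R)) * x = 1 := by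
    apply mul_left_cancel₀ hx
    rw [← mul_assoc, h1]; simp
  have h4 : y * ((↑u⁻¹ : R) * x) = 1 := by rw [← mul_assoc, h3]
  exact ⟨⟨⟨x, _, h1, h3⟩, rfl⟩, ⟨⟨y, _, h4, h2⟩, rfl⟩⟩

lemma nc_lemma_prim {L F G E : MonoidAlgebra k[X] (FreeMonoid X)}
    {p q : MonoidAlgebra k (FreeMonoid X)} (hq : q ≠ 0)
    (hL : psi k _ L = Polynomial.C q * Polynomial.X - Polynomial.C p)
    (hF : IsUnit (psi k _ F).leadingCoeff) (hLF : L * F = F * L) (hGF : G * F = F * G)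
    (hGL : G * L = F * E) (hG : G ≠ 0) (hdeg : (psi k _ G).natDegree < (psi k _ F).natDegree)
    (hLp : Prim L) (hFp : Prim F) : ∃ T, p = T * q := by
  have hF0 : F ≠ 0 := by
    rintro rfl; simp at hdeg
  have hLdeg : (psi k _ L).natDegree = 1 := by
    rw [hL]; compute_degree!
  have hL0 : L ≠ 0 := by
    rintro rfl; simp at hLdeg
  obtain ⟨P1, L', F', U, V, α, β, hα, hβ, h1, h2, h3⟩ := ff_gcd hL0 hF0 hF0 hLF
  have hP1 : P1 ≠ 0 := by
    rintro rfl
    rw [zero_mul, ← smul_zero α] at h1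
    exact hL0 (smul_cancel hα h1)
  obtain ⟨δ, P, hδ, hP, rfl⟩ := exists_prim hP1
  rw [smul_mul_assoc, ← mul_smul_comm] at h1 h2
  rw [smul_smul] at h3
  obtain ⟨L2, rfl⟩ := prim_left hP hα h1
  obtain ⟨F2, rfl⟩ := prim_left hP hα h2
  have hP0 : psi k _ P ≠ 0 := by
    intro h
    rw [map_mul, h, zero_mul] at hLdeg; simp at hLdeg
  have hL20 : psi k _ L2 ≠ 0 := by
    intro h
    rw [map_mul, h, mul_zero] at hLdeg; simp at hLdeg
  rw [map_mul, Polynomial.leadingCoeff_mul] at hF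
  obtain ⟨hPu, -⟩ := isUnit_of_mul hF
  rw [map_mul, Polynomial.natDegree_mul hP0 hL20] at hLdeg
  rcases Nat.eq_zero_or_pos (psi k _ P).natDegree with hd | hd
  · exfalso
    obtain ⟨u, hu⟩ := hPu
    have hPC : psi k _ P = Polynomial.C (u : MonoidAlgebra k (FreeMonoid X)) := by
      rw [hu, Polynomial.leadingCoeff, hd]
      exact Polynomial.eq_C_of_natDegree_eq_zero hd
    obtain ⟨P', hP'⟩ := (psi k (FreeMonoid X)).surjective
      (Polynomial.C (↑u⁻¹ : MonoidAlgebra k (FreeMonoid X)))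
    have hPP : P * P' = 1 := by
      apply (psi k _).injective
      rw [map_mul, hPC, hP', ← Polynomial.C_mul]; simp
    have h4 : (β * δ) • (G * P) = (P * F2) * (E * U + G * V) := by
      rw [← mul_smul_comm, h3, mul_add, ← mul_assoc, hGL, ← mul_assoc, hGF, mul_add]
      simp only [mul_assoc]
    obtain ⟨B, hB⟩ := prim_left hFp (mul_ne_zero hβ hδ) h4
    have hGB : G = (P * F2) * (B * P') := by
      rw [← mul_assoc, ← hB, mul_assoc, hPP, mul_one]
    have hB0 : B * P' ≠ 0 := by
      intro h; rw [h, mul_zero] at hGB; exact hG hGB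
    rw [hGB, map_mul _ (P * F2), Polynomial.natDegree_mul (by simpa using hF0)
      (by simpa using hB0)] at hdeg
    omega
  · have hd1 : (psi k _ P).natDegree = 1 := by omega
    have hd0 : (psi k _ L2).natDegree = 0 := by omega
    obtain ⟨l, hl⟩ := Polynomial.natDegree_eq_zero.1 hd0
    obtain ⟨u, hu⟩ := hPu
    rw [Polynomial.leadingCoeff, hd1] at hu
    rw [map_mul, ← hl] at hL
    have e1 := congrArg (fun f => f.coeff 1) hL
    have e0 := congrArg (fun f => f.coeff 0) hL
    simp [Polynomial.coeff_C] at e1 e0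
    refine ⟨-((psi k _ P).coeff 0 * (↑u⁻¹ : MonoidAlgebra k (FreeMonoid X))), ?_⟩
    rw [← e1, ← hu, neg_mul, mul_assoc, ← mul_assoc _ (u : MonoidAlgebra k (FreeMonoid X)) l]
    rw [Units.inv_mul, one_mul, e0, neg_neg]

lemma nc_lemma_aux {L F G E : MonoidAlgebra k[X] (FreeMonoid X)}
    {p q : MonoidAlgebra k (FreeMonoid X)} (hq : q ≠ 0)
    (hL : psi k _ L = Polynomial.C q * Polynomial.X - Polynomial.C p)
    (hF : IsUnit (psi k _ F).leadingCoeff) (hLF : L * F = F * L) (hGF : G * F = F * G)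
    (hGL : G * L = F * E) (hG : G ≠ 0) (hdeg : (psi k _ G).natDegree < (psi k _ F).natDegree) :
    ∃ T, p = T * q := by
  have hF0 : F ≠ 0 := by
    rintro rfl; simp at hdeg
  have hLdeg : (psi k _ L).natDegree = 1 := by
    rw [hL]; compute_degree!
  have hL0 : L ≠ 0 := by
    rintro rfl; simp at hLdeg
  by_cases hLp : Prim L
  · obtain ⟨γ, F0, hγ, hF0p, rfl⟩ := exists_prim hF0
    obtain ⟨G0, rfl, hG0⟩ := prim_right hLp hγ (b := G) (b' := F0 * E)
      (by rw [hGL, smul_mul_assoc])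
    have hF00 : F0 ≠ 0 := by rintro rfl; simp at hF0
    have hG00 : G0 ≠ 0 := by rintro rfl; simp at hG
    refine nc_lemma_prim hq hL ?_ (smul_cancel hγ ?_) (smul_cancel hγ (smul_cancel hγ ?_))
      hG0.symm hG00 ?_ hLp hF0p
    · rw [psi_smul, Polynomial.leadingCoeff_mul] at hF
      exact (isUnit_of_mul hF).2
    · rw [mul_smul_comm, smul_mul_assoc] at hLF
      exact hLF
    · simpa only [mul_smul_comm, smul_mul_assoc] using hGF
    · rw [psi_smul_natDegree hγ hG00, psi_smul_natDegree hγ hF00] at hdeg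
      omega
  · simp only [Prim] at hLp
    push Not at hLp
    obtain ⟨π, hπ, l, rfl⟩ := hLp
    have hl0 : l ≠ 0 := by rintro rfl; simp at hL0
    rw [psi_smul_natDegree hπ.ne_zero hl0] at hLdeg
    have hπd : 0 < π.natDegree := hπ.irreducible.natDegree_pos
    have hd0 : (psi k _ l).natDegree = 0 := by omega
    have hπ1 : π.natDegree = 1 := by omega
    obtain ⟨l0, hl⟩ := Polynomial.natDegree_eq_zero.1 hd0
    rw [psi_smul, ← hl] at hL
    have e1 := congrArg (fun f => f.coeff 1) hL
    have e0 := congrArg (fun f => f.coeff 0) hL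
    simp [Polynomial.coeff_C, -coe_algebraMap] at e1 e0
    have hc : π.coeff 1 ≠ 0 := by
      rw [← hπ1]; simpa using hπ.ne_zero
    refine ⟨algebraMap k _ (-(π.coeff 0 * (π.coeff 1)⁻¹)), ?_⟩
    rw [← e1, ← mul_assoc, ← map_mul, neg_mul, mul_assoc, inv_mul_cancel₀ hc, mul_one, map_neg,
      neg_mul, e0, neg_neg]

lemma nc_lemma {F G E : (MonoidAlgebra k (FreeMonoid X))[X]}
    {p q : MonoidAlgebra k (FreeMonoid X)} (hq : q ≠ 0) (hF : F.Monic)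
    (hLF : (Polynomial.C q * Polynomial.X - Polynomial.C p) * F =
      F * (Polynomial.C q * Polynomial.X - Polynomial.C p)) (hGF : G * F = F * G)
    (hGL : G * (Polynomial.C q * Polynomial.X - Polynomial.C p) = F * E) (hG : G ≠ 0)
    (hdeg : G.natDegree < F.natDegree) :
    ∃ T, p = T * q := by
  have hs : ∀ f, psi k (FreeMonoid X) ((psi k (FreeMonoid X)).symm f) = f :=
    fun f => (psi k (FreeMonoid X)).apply_symm_apply f
  refine nc_lemma_aux (L := (psi k _).symm (Polynomial.C q * Polynomial.X - Polynomial.C p))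
    (F := (psi k _).symm F) (G := (psi k _).symm G) (E := (psi k _).symm E) hq (hs _) ?_ ?_ ?_ ?_
    ?_ ?_
  · rw [hs, hF]; exact isUnit_one
  · rw [← map_mul, hLF, map_mul]
  · rw [← map_mul, hGF, map_mul]
  · rw [← map_mul, hGL, map_mul]
  · simpa using hG
  · rw [hs, hs]; exact hdeg

end NC

section IC
open Polynomial
variable {k X C : Type*} [Field k] [CommRing C] [IsDomain C]

lemma integrallyClosed_of_sat (ι : C →+* MonoidAlgebra k (FreeMonoid X))
    (hι : Function.Injective ι)
    (hsat : ∀ T q p, q ≠ 0 → ι p = T * ι q → ∃ t, ι t = T) : IsIntegrallyClosed C := by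
  rw [isIntegrallyClosed_iff (FractionRing C)]
  intro x hx
  obtain ⟨F, hFm, hFx⟩ := hx
  obtain ⟨p, q, hq, rfl⟩ := IsFractionRing.div_surjective (A := C) x
  have hq0 : q ≠ 0 := nonZeroDivisors.ne_zero hq
  have hinj : Function.Injective (algebraMap C (FractionRing C)) :=
    IsFractionRing.injective C (FractionRing C)
  have hq1 : algebraMap C (FractionRing C) q ≠ 0 := by
    rwa [Ne, map_eq_zero_iff _ hinj]
  set x := algebraMap C (FractionRing C) p / algebraMap C (FractionRing C) q with hxdef
  obtain ⟨g, hg⟩ : (Polynomial.X - Polynomial.C x) ∣ F.map (algebraMap C (FractionRing C)) := by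
    rw [Polynomial.dvd_iff_isRoot, Polynomial.IsRoot, Polynomial.eval_map]; exact hFx
  have hFm' := hFm.map (algebraMap C (FractionRing C))
  have hg0 : g ≠ 0 := by
    rintro rfl; rw [mul_zero] at hg; exact hFm'.ne_zero hg
  have hdeg := congrArg Polynomial.natDegree hg
  rw [Polynomial.natDegree_mul (Polynomial.X_sub_C_ne_zero x) hg0, Polynomial.natDegree_X_sub_C,
    hFm.natDegree_map] at hdeg
  obtain ⟨b, hb, hb'⟩ := IsLocalization.integerNormalization_spec (nonZeroDivisors C) g
  set G := IsLocalization.integerNormalization (nonZeroDivisors C) g with hG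
  have hb0 : b ≠ 0 := nonZeroDivisors.ne_zero hb
  have hb1 : algebraMap C (FractionRing C) b ≠ 0 := by
    rwa [Ne, map_eq_zero_iff _ hinj]
  have hGm : G.map (algebraMap C (FractionRing C)) =
      Polynomial.C (algebraMap C (FractionRing C) b) * g := by
    rw [hb', ← Polynomial.smul_eq_C_mul, algebraMap_smul]
  have hG0 : G ≠ 0 := by
    intro h
    rw [h, Polynomial.map_zero] at hGm
    rcases mul_eq_zero.1 hGm.symm with h | h
    · exact hb1 (Polynomial.C_eq_zero.1 h)
    · exact hg0 h
  have hGdeg : G.natDegree < F.natDegree := by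
    rw [← Polynomial.natDegree_map_eq_of_injective hinj G, hGm, Polynomial.natDegree_C_mul hb1]
    omega
  have hrel : G * (Polynomial.C q * Polynomial.X - Polynomial.C p) = F * Polynomial.C (b * q) := by
    apply Polynomial.map_injective _ hinj
    have hpx : algebraMap C (FractionRing C) p = algebraMap C (FractionRing C) q * x := by
      rw [hxdef]; field_simp
    simp only [Polynomial.map_mul, Polynomial.map_sub, Polynomial.map_C, Polynomial.map_X, map_mul]
    rw [hGm, hg, hpx, Polynomial.C_mul]
    ring
  obtain ⟨T, hT⟩ := nc_lemma (F := F.map ι) (G := G.map ι) (E := Polynomial.C (ι (b * q)))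
    (p := ι p) (q := ι q) (by rwa [Ne, map_eq_zero_iff _ hι]) (hFm.map ι)
    (by
      have := congrArg (Polynomial.map ι)
        (mul_comm (Polynomial.C q * Polynomial.X - Polynomial.C p) F)
      simpa using this)
    (by rw [← Polynomial.map_mul, mul_comm, Polynomial.map_mul])
    (by simpa using congrArg (Polynomial.map ι) hrel)
    (by rwa [Ne, Polynomial.map_eq_zero_iff hι])
    (by rwa [Polynomial.natDegree_map_eq_of_injective hι,
      Polynomial.natDegree_map_eq_of_injective hι])
  obtain ⟨t, rfl⟩ := hsat T q p hq0 hT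
  rw [← map_mul] at hT
  refine ⟨t, ?_⟩
  rw [hxdef, hι hT, map_mul]; field_simp

end IC

section Luroth
open Polynomial
variable {k : Type*} [Field k]

lemma coeff_coeff_swap' (p : k[X][X]) (i j : ℕ) :
    ((Polynomial.Bivariate.swap p).coeff i).coeff j = (p.coeff j).coeff i := by
  induction p using Polynomial.induction_on' with
  | add p q hp hq => simp only [map_add, Polynomial.coeff_add, hp, hq]
  | monomial n f =>
    rw [Polynomial.Bivariate.swap_monomial, Polynomial.coeff_mul_C, Polynomial.coeff_map,
      Polynomial.coeff_C_mul, Polynomial.coeff_X_pow, Polynomial.coeff_monomial]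
    by_cases h : n = j
    · simp [h]
    · simp [h, Ne.symm h]

lemma luroth_deg {μ Q : k[X][X]} {i : ℕ} (hd : 0 < (μ.coeff i).natDegree)
    (h : μ * Q = (μ.coeff i).map Polynomial.C - Polynomial.C (μ.coeff i)) : Q.natDegree = 0 := by
  set s := μ.coeff i with hs
  have hlt : (Polynomial.C s : k[X][X]).natDegree < (s.map (Polynomial.C : k →+* k[X])).natDegree := by
    rw [Polynomial.natDegree_C, Polynomial.natDegree_map_eq_of_injective Polynomial.C_injective]
    exact hd
  have h' := congrArg Polynomial.Bivariate.swap h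
  rw [map_mul, map_sub, Polynomial.Bivariate.swap_map_C, Polynomial.Bivariate.swap_C] at h'
  set μ' := Polynomial.Bivariate.swap μ
  set Q' := Polynomial.Bivariate.swap Q
  have hdeg : (Polynomial.C s - s.map (Polynomial.C : k →+* k[X])).natDegree = s.natDegree := by
    rw [Polynomial.natDegree_sub_eq_right_of_natDegree_lt hlt,
      Polynomial.natDegree_map_eq_of_injective Polynomial.C_injective]
  have hne : (Polynomial.C s - s.map (Polynomial.C : k →+* k[X])) ≠ 0 := by
    intro h0; rw [h0] at hdeg; simp at hdeg; omega
  have hμ0 : μ' ≠ 0 := by intro h0; rw [h0, zero_mul] at h'; exact hne h'.symm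
  have hQ0 : Q' ≠ 0 := by intro h0; rw [h0, mul_zero] at h'; exact hne h'.symm
  have hle : s.natDegree ≤ μ'.natDegree := by
    apply Polynomial.le_natDegree_of_ne_zero
    intro h0
    have := coeff_coeff_swap' μ s.natDegree i
    rw [h0, ← hs, Polynomial.coeff_zero, Polynomial.coeff_natDegree, eq_comm,
      Polynomial.leadingCoeff_eq_zero] at this
    rw [this] at hd; simp at hd
  have hsum := congrArg Polynomial.natDegree h'
  rw [Polynomial.natDegree_mul hμ0 hQ0, hdeg] at hsum
  have hQd : Q'.natDegree = 0 := by omega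
  have hlead := congrArg (fun f => f.coeff s.natDegree) h'
  obtain ⟨w, hw⟩ := Polynomial.natDegree_eq_zero.1 hQd
  rw [← hw] at hlead
  simp only [Polynomial.coeff_mul_C, Polynomial.coeff_sub, Polynomial.coeff_C, Polynomial.coeff_map,
    hd.ne', if_false, Polynomial.coeff_natDegree, zero_sub] at hlead
  have hu : IsUnit w := by
    apply isUnit_of_mul_isUnit_right (x := μ'.coeff s.natDegree)
    rw [hlead, IsUnit.neg_iff, Polynomial.isUnit_C]
    apply IsUnit.mk0
    rw [Ne, Polynomial.leadingCoeff_eq_zero]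
    rintro h0; rw [h0] at hd; simp at hd
  obtain ⟨c, -, rfl⟩ := Polynomial.isUnit_iff.1 hu
  have : Q = Polynomial.C (Polynomial.C c) := by
    rw [← Polynomial.Bivariate.swap_swap_apply Q]
    change Polynomial.Bivariate.swap Q' = _
    rw [← hw, Polynomial.Bivariate.swap_C_C]
  rw [this, Polynomial.natDegree_C]

variable {C : Type*} [CommRing C] [IsDomain C] [Algebra k C] [Algebra C k[X]]
  [IsScalarTower k C k[X]]

lemma reduce_aux (s : C) (hs : 0 < (algebraMap C k[X] s).natDegree) (n : ℕ) :
    ∀ f : k[X], f.natDegree < n → ∃ N : C[X], N.natDegree < (algebraMap C k[X] s).natDegree ∧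
      ((algebraMap C k[X] s).map (algebraMap k C) - Polynomial.C s) ∣ f.map (algebraMap k C) - N ∧
      ∃ g : k[X], N.coeff 0 = aeval s g := by
  induction n with
  | zero => intro f hf; omega
  | succ n ih =>
    intro f hf
    by_cases hfs : f.natDegree < (algebraMap C k[X] s).natDegree
    · refine ⟨f.map (algebraMap k C), lt_of_le_of_lt Polynomial.natDegree_map_le hfs, by simp,
        Polynomial.C (f.coeff 0), ?_⟩
      rw [Polynomial.coeff_map, Polynomial.aeval_C]
    · set t : k[X] := (algebraMap C k[X] s) with ht
      have hf0 : f ≠ 0 := by rintro rfl; rw [Polynomial.natDegree_zero] at hfs; omega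
      have hq : (f / t).natDegree < n := by
        by_cases hq0 : f / t = 0
        · rw [hq0, Polynomial.natDegree_zero]; omega
        · have := Polynomial.natDegree_lt_natDegree hq0
            (Polynomial.degree_div_lt hf0 (Polynomial.natDegree_pos_iff_degree_pos.1 hs))
          omega
      obtain ⟨N, h1, h2, g, h3⟩ := ih _ hq
      have hr : (f % t).natDegree < t.natDegree := Polynomial.natDegree_mod_lt f hs.ne'
      refine ⟨Polynomial.C s * N + (f % t).map (algebraMap k C), ?_, ?_,
        Polynomial.X * g + Polynomial.C ((f % t).coeff 0), ?_⟩
      · refine lt_of_le_of_lt (Polynomial.natDegree_add_le _ _) (max_lt ?_ ?_)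
        · exact lt_of_le_of_lt (Polynomial.natDegree_C_mul_le _ _) h1
        · exact lt_of_le_of_lt Polynomial.natDegree_map_le hr
      · have : f.map (algebraMap k C) = t.map (algebraMap k C) * (f / t).map (algebraMap k C)
            + (f % t).map (algebraMap k C) := by
          rw [← Polynomial.map_mul, ← Polynomial.map_add, EuclideanDomain.div_add_mod]
        rw [this]
        have e : t.map (algebraMap k C) * (f / t).map (algebraMap k C)
            + (f % t).map (algebraMap k C) - (Polynomial.C s * N + (f % t).map (algebraMap k C)) =
            (t.map (algebraMap k C) - Polynomial.C s) * (f / t).map (algebraMap k C) +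
            Polynomial.C s * ((f / t).map (algebraMap k C) - N) := by ring
        rw [e]
        exact dvd_add (dvd_mul_right _ _) (h2.mul_left _)
      · simp [h3]

lemma subalgebra_equiv [IsIntegrallyClosed C] (hinj : Function.Injective (algebraMap C k[X]))
    (hC : ∃ x : C, (algebraMap C k[X] x).natDegree ≠ 0) : Nonempty (C ≃ₐ[k] k[X]) := by
  have htf : Module.IsTorsionFree C k[X] :=
    Module.isTorsionFree_iff_algebraMap_injective.2 hinj
  have hmapcomp : ∀ f : k[X], (f.map (algebraMap k C)).map (algebraMap C k[X]) =
      f.map (Polynomial.C : k →+* k[X]) := by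
    intro f
    rw [Polynomial.map_map, ← IsScalarTower.algebraMap_eq]; rfl
  have hroot : ∀ x : C, aeval (Polynomial.X : k[X])
      ((algebraMap C k[X] x).map (algebraMap k C) - Polynomial.C x) = 0 := by
    intro x
    rw [map_sub, Polynomial.aeval_C, ← Polynomial.eval_map_algebraMap, hmapcomp,
      Polynomial.eval_map, Polynomial.eval₂_C_X]
    exact sub_self _
  have hIntegral : IsIntegral C (Polynomial.X : k[X]) := by
    obtain ⟨x, hx⟩ := hC
    have hx0 : (algebraMap C k[X] x).leadingCoeff ≠ 0 := by
      rw [Ne, Polynomial.leadingCoeff_eq_zero]; rintro h; rw [h] at hx; simp at hx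
    obtain ⟨y, hy⟩ : ∃ y, y = x * algebraMap k C (algebraMap C k[X] x).leadingCoeff⁻¹ := ⟨_, rfl⟩
    have hy' : algebraMap C k[X] y = algebraMap C k[X] x *
        Polynomial.C (algebraMap C k[X] x).leadingCoeff⁻¹ := by
      rw [hy, map_mul, ← IsScalarTower.algebraMap_apply]; rfl
    have hym : (algebraMap C k[X] y).Monic := by
      rw [hy']
      exact Polynomial.monic_mul_leadingCoeff_inv (by rintro h; rw [h] at hx; simp at hx)
    have hyd : 0 < (algebraMap C k[X] y).natDegree := by
      rw [hy', Polynomial.natDegree_mul_C (inv_ne_zero hx0)]; omega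
    refine ⟨(algebraMap C k[X] y).map (algebraMap k C) - Polynomial.C y, ?_, hroot y⟩
    refine (hym.map _).sub_of_left (lt_of_le_of_lt Polynomial.degree_C_le ?_)
    rw [hym.degree_map]
    exact Polynomial.natDegree_pos_iff_degree_pos.1 hyd
  set μ := minpoly C (Polynomial.X : k[X]) with hμ
  have hμm : μ.Monic := minpoly.monic hIntegral
  obtain ⟨i, hi⟩ : ∃ i, 0 < (algebraMap C k[X] (μ.coeff i)).natDegree := by
    by_contra! hcon
    have hl : μ.map (algebraMap C k[X]) ∈ Polynomial.lifts (Polynomial.C : k →+* k[X]) := by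
      rw [Polynomial.lifts_iff_coeff_lifts]
      intro n
      rw [Polynomial.coeff_map]
      exact ⟨_, (Polynomial.eq_C_of_natDegree_le_zero (hcon n)).symm⟩
    obtain ⟨ν, hν⟩ := (Polynomial.mem_lifts _).1 hl
    have h1 : aeval (Polynomial.X : k[X]) μ = 0 := minpoly.aeval _ _
    rw [← Polynomial.eval_map_algebraMap, ← hν, Polynomial.eval_map, Polynomial.eval₂_C_X] at h1
    rw [h1, Polynomial.map_zero] at hν
    exact (hμm.map _).ne_zero hν.symm
  set s := μ.coeff i with hs
  obtain ⟨Q, hQ⟩ := minpoly.isIntegrallyClosed_dvd hIntegral (hroot s)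
  rw [← hμ] at hQ
  have hQd : Q.natDegree = 0 := by
    rw [← Polynomial.natDegree_map_eq_of_injective hinj]
    refine luroth_deg (μ := μ.map (algebraMap C k[X])) (i := i) ?_ ?_
    · rw [Polynomial.coeff_map]; exact hi
    · rw [← Polynomial.map_mul, ← hQ, Polynomial.map_sub, hmapcomp, Polynomial.map_C,
        Polynomial.coeff_map]
  have hμd : μ.natDegree = (algebraMap C k[X] s).natDegree := by
    have := congrArg Polynomial.natDegree hQ
    rw [Polynomial.natDegree_sub_C, Polynomial.natDegree_map_eq_of_injective
      (algebraMap k C).injective] at this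
    rw [this, hμm.natDegree_mul', hQd, add_zero]
    rintro rfl
    rw [mul_zero] at hQ
    have h2 := congrArg Polynomial.natDegree hQ
    rw [Polynomial.natDegree_sub_C, Polynomial.natDegree_map_eq_of_injective
      (algebraMap k C).injective, Polynomial.natDegree_zero] at h2
    omega
  have hsurj : Function.Surjective (aeval s : k[X] →ₐ[k] C) := by
    intro c
    obtain ⟨N, h1, h2, g, h3⟩ := reduce_aux s hi _ (algebraMap C k[X] c) (Nat.lt_succ_self _)
    have h4 : μ ∣ N - Polynomial.C c := by
      have h5 := minpoly.isIntegrallyClosed_dvd hIntegral (hroot c)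
      have h6 : μ ∣ (algebraMap C k[X] c).map (algebraMap k C) - N := (Dvd.intro _ hQ.symm).trans h2
      have := dvd_sub h5 h6
      simpa using this
    have h5 : N - Polynomial.C c = 0 := by
      by_contra h0
      have := Polynomial.natDegree_le_of_dvd h4 h0
      rw [Polynomial.natDegree_sub_C] at this
      omega
    refine ⟨g, ?_⟩
    rw [← h3, sub_eq_zero.1 h5, Polynomial.coeff_C_zero]
  have hinj' : Function.Injective (aeval s : k[X] →ₐ[k] C) := by
    rw [injective_iff_map_eq_zero]
    intro f hf
    by_contra h0
    have h1 : aeval (algebraMap C k[X] s) f = 0 := by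
      have := congrArg (algebraMap C k[X]) hf
      rwa [← Polynomial.aeval_algebraMap_apply, map_zero] at this
    have := natDegree_of_aeval_eq_zero h0 h1
    omega
  exact ⟨(AlgEquiv.ofBijective _ ⟨hinj', hsurj⟩).symm⟩

end Luroth

section Final
open Polynomial
variable {k : Type*} [Field k] {s : ℕ}

lemma bergman_monoidAlgebra (hs : 0 < s) (a : MonoidAlgebra k (FreeMonoid (Fin s)))
    (ha : 0 < wdeg a) :
    Nonempty (Subalgebra.centralizer k ({a} : Set (MonoidAlgebra k (FreeMonoid (Fin s))))
      ≃ₐ[k] k[X]) := by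
  obtain ⟨φ, hφ⟩ := exists_hom hs ha
  have hinj := hom_injective ha φ hφ
  let e := AlgEquiv.ofInjective φ hinj
  let ι : φ.range →+* MonoidAlgebra k (FreeMonoid (Fin s)) :=
    ((Subalgebra.val _).comp e.symm.toAlgHom).toRingHom
  have hιC : ∀ x, ι x ∈ Subalgebra.centralizer k
      ({a} : Set (MonoidAlgebra k (FreeMonoid (Fin s)))) := fun x => (e.symm x).2
  have hιs : ∀ y ∈ Subalgebra.centralizer k
      ({a} : Set (MonoidAlgebra k (FreeMonoid (Fin s)))), ∃ t, ι t = y := by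
    intro y hy
    refine ⟨e ⟨y, hy⟩, ?_⟩
    change ((e.symm (e ⟨y, hy⟩) : _) : MonoidAlgebra k (FreeMonoid (Fin s))) = y
    rw [AlgEquiv.symm_apply_apply]
  have hιi : Function.Injective ι := fun x y h => e.symm.injective (Subtype.ext h)
  have hic : IsIntegrallyClosed φ.range := by
    refine integrallyClosed_of_sat ι hιi ?_
    intro T q p hq hT
    apply hιs
    have hp := Subalgebra.mem_centralizer_iff k |>.1 (hιC p) a rfl
    have hq' := Subalgebra.mem_centralizer_iff k |>.1 (hιC q) a rfl
    rw [Subalgebra.mem_centralizer_iff]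
    rintro _ rfl
    have hq0 : ι q ≠ 0 := by rwa [Ne, map_eq_zero_iff _ hιi]
    apply mul_right_cancel₀ hq0
    rw [mul_assoc, ← hT, hp, hT, mul_assoc, mul_assoc, hq']
  obtain ⟨f⟩ := subalgebra_equiv (k := k) (C := φ.range) Subtype.val_injective (by
    obtain ⟨x, hx⟩ := hφ
    exact ⟨⟨φ x, x, rfl⟩, hx⟩)
  exact ⟨e.trans f⟩

end Final

end Bergman

theorem bergman_centralizer (k : Type*) [Field k] (s : ℕ) (hs : 1 ≤ s) (a : FreeAlgebra k (Fin s))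
    (ha : a ∉ Set.range (algebraMap k (FreeAlgebra k (Fin s)))) :
    Nonempty ((Subalgebra.centralizer k ({a} : Set (FreeAlgebra k (Fin s)))) ≃ₐ[k] Polynomial k) := by
  let E : FreeAlgebra k (Fin s) ≃ₐ[k] MonoidAlgebra k (FreeMonoid (Fin s)) :=
    FreeAlgebra.equivMonoidAlgebraFreeMonoid
  have hd : 0 < Bergman.wdeg (E a) := by
    rw [Nat.pos_iff_ne_zero]
    intro h
    have h1 := Bergman.eq_scalar_of_wdeg h
    apply ha
    refine ⟨(E a).coeff 1, E.injective ?_⟩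
    rw [AlgEquiv.commutes, h1]
    simp
  obtain ⟨f⟩ := Bergman.bergman_monoidAlgebra hs (E a) hd
  have hmap : (Subalgebra.centralizer k ({a} : Set (FreeAlgebra k (Fin s)))).map
      (E : FreeAlgebra k (Fin s) →ₐ[k] MonoidAlgebra k (FreeMonoid (Fin s))) =
      Subalgebra.centralizer k ({E a} : Set (MonoidAlgebra k (FreeMonoid (Fin s)))) := by
    ext y
    simp only [Subalgebra.mem_map, Subalgebra.mem_centralizer_iff, Set.mem_singleton_iff,
      forall_eq]
    constructor
    · rintro ⟨x, hx, rfl⟩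
      change E a * E x = E x * E a
      rw [← map_mul, hx, map_mul]
    · intro hy
      refine ⟨E.symm y, E.injective ?_, E.apply_symm_apply y⟩
      rw [map_mul, map_mul, E.apply_symm_apply, hy]
  exact ⟨((E.subalgebraMap _).trans (Subalgebra.equivOfEq _ _ hmap)).trans f⟩
end

section
/- Amitsur–Levitzki theorem (vanishing part): let R be a commutative ring, n ≥ 1 and r ≥ 2n. Then for any n×n matrices A_1,…,A_r with entries in R one has S_r(A_1,…,A_r) = Σ_{σ ∈ S_r} sign(σ) · A_{σ(1)}A_{σ(2)}⋯A_{σ(r)} = 0. -/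
open Matrix Polynomial in
/-- Jacobi's formula for the characteristic polynomial. -/
lemma al_derivative_charpoly {n : ℕ} {Z : Type*} [CommRing Z]
    (b : Matrix (Fin n) (Fin n) Z) :
    derivative b.charpoly = (adjugate (charmatrix b)).trace := by
  rw [Matrix.charpoly, Matrix.det_apply', Matrix.trace]
  simp only [Matrix.diag, Matrix.adjugate_apply, Matrix.det_apply', derivative_sum]
  rw [Finset.sum_comm]
  refine Finset.sum_congr rfl fun σ _ => ?_
  rw [← smul_eq_mul, Int.cast_smul_eq_zsmul, derivative_smul,
    derivative_prod_finset, ← Int.cast_smul_eq_zsmul Z[X], smul_eq_mul, Finset.mul_sum]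
  refine Eq.trans ?_ (Equiv.sum_comp σ _)
  refine Finset.sum_congr rfl fun i _ => ?_
  congr 1
  rw [← Finset.mul_prod_erase _ _ (Finset.mem_univ i), mul_comm]
  congr 1
  · rw [Matrix.updateRow_self, charmatrix_apply, Pi.single_apply]
    by_cases h : σ i = i
    · simp [h]
    · simp [h, Matrix.diagonal_apply, Ne.symm h]
  · refine Finset.prod_congr rfl fun j hj => ?_
    rw [Matrix.updateRow_ne]
    intro h
    exact (Finset.ne_of_mem_erase hj) (σ.injective h)

open Matrix Polynomial in
/-- A matrix all of whose powers are traceless is nilpotent. -/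
lemma al_nilpotent {n : ℕ} {Z : Type*} [CommRing Z]
    (htf : ∀ m : ℕ, m ≠ 0 → ∀ z : Z, (m : Z) * z = 0 → z = 0)
    (b : Matrix (Fin n) (Fin n) Z) (hb : ∀ k, (b ^ (k + 1)).trace = 0) : b ^ n = 0 := by
  nontriviality Z
  set q := matPolyEquiv (adjugate (charmatrix b)) with hq
  have h1 : b.charpoly.map (algebraMap Z (Matrix (Fin n) (Fin n) Z)) = (X - C b) * q := by
    rw [← matPolyEquiv_smul_one, ← matPolyEquiv_charmatrix, hq, ← map_mul, Matrix.mul_adjugate]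
    rfl
  have hrec : ∀ k, q.coeff k = algebraMap Z _ (b.charpoly.coeff (k+1)) + b * q.coeff (k+1) := by
    intro k
    have := congrArg (fun f => coeff f (k+1)) h1
    simp only [sub_mul, coeff_sub, coeff_X_mul, coeff_C_mul, coeff_map] at this
    rw [this]; abel
  have hrec0 : 0 = algebraMap Z _ (b.charpoly.coeff 0) + b * q.coeff 0 := by
    have := congrArg (fun f => coeff f 0) h1
    simp only [sub_mul, coeff_sub, coeff_X_mul_zero, coeff_C_mul, coeff_map] at this
    rw [this]; abel
  have htr : ∀ k, (q.coeff k).trace = (k + 1 : ℕ) * b.charpoly.coeff (k+1) := by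
    intro k
    have := congrArg (fun f => coeff f k) (al_derivative_charpoly b)
    simp only [coeff_derivative, Matrix.trace, Matrix.diag, finsetSum_coeff] at this
    simp only [Matrix.trace, Matrix.diag, hq, matPolyEquiv_coeff_apply]
    rw [← this]; push_cast; ring
  have hz : ∀ d k, q.natDegree < k + d → ∀ m, (b ^ (m+1) * q.coeff k).trace = 0 := by
    intro d
    induction d with
    | zero => intro k hk m; rw [coeff_eq_zero_of_natDegree_lt (by simpa using hk)]; simp
    | succ d ih =>
      intro k hk m
      rw [hrec, mul_add, ← mul_assoc, ← pow_succ, Matrix.trace_add, ih (k+1) (by omega),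
        ← Algebra.commutes, ← Algebra.smul_def, Matrix.trace_smul, hb]
      simp
  have hz' : ∀ k, (b * q.coeff k).trace = 0 := fun k => by
    simpa using hz (q.natDegree + 1) k (by omega) 0
  have htra : ∀ z : Z, (algebraMap Z (Matrix (Fin n) (Fin n) Z) z).trace = n * z := by
    intro z
    rw [Algebra.algebraMap_eq_smul_one, Matrix.trace_smul, Matrix.trace_one]
    simp [mul_comm]
  have hc : ∀ k, k < n → b.charpoly.coeff k = 0 := by
    intro k hk
    cases k with
    | zero =>
      have := congrArg Matrix.trace hrec0
      rw [Matrix.trace_add, hz', htra, Matrix.trace_zero, add_zero] at this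
      exact htf n (by omega) _ this.symm
    | succ k =>
      have := congrArg Matrix.trace (hrec k)
      rw [Matrix.trace_add, hz', htra, htr, add_zero] at this
      refine htf (n - (k+1)) (by omega) _ ?_
      rw [Nat.cast_sub hk.le, sub_mul, this, sub_self]
  have hp : b.charpoly = X ^ n := by
    have hm := b.charpoly_monic
    have hd : b.charpoly.natDegree = n := by simpa using b.charpoly_natDegree_eq_dim
    ext k
    rw [coeff_X_pow]
    rcases lt_trichotomy k n with h | h | h
    · rw [hc k h, if_neg h.ne]
    · rw [if_pos h, h]; have hl := hm.coeff_natDegree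
      rwa [hd] at hl
    · rw [if_neg h.ne', coeff_eq_zero_of_natDegree_lt (by omega)]
  have := b.aeval_self_charpoly
  simpa [hp] using this

lemma al_prod {n m : ℕ} {K L : Type*} [CommRing K] [Ring L] [Algebra K L]
    (A : Fin m → Matrix (Fin n) (Fin n) K) (e : Fin m → L) :
    (List.ofFn fun i => (A i).map (fun c => c • e i)).prod
      = (List.ofFn A).prod.map (fun c => c • (List.ofFn e).prod) := by
  induction m with
  | zero =>
    ext i j
    by_cases h : i = j <;> simp [h, Matrix.one_apply]
  | succ m ih =>
    simp only [List.ofFn_succ, List.prod_cons]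
    rw [ih (fun i => A i.succ) (fun i => e i.succ)]
    ext i j
    simp only [Matrix.map_apply, Matrix.mul_apply, Finset.sum_smul, smul_mul_smul_comm]

/-- Rosset's argument. -/
lemma al_pow {n : ℕ} {K V : Type*} [CommRing K] [Algebra ℚ K] [AddCommGroup V] [Module K V]
    (v : Fin n → Fin n → V)
    (a : Matrix (Fin n) (Fin n) (ExteriorAlgebra K V))
    (ha : ∀ i j, a i j = ExteriorAlgebra.ι K (v i j)) : a ^ (2 * n) = 0 := by
  have hanti : ∀ i j k l, a i j * a k l = - (a k l * a i j) := by
    intro i j k l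
    rw [ha, ha]
    exact eq_neg_of_add_eq_zero_left (ExteriorAlgebra.ι_add_mul_swap _ _)
  have hcen : ∀ x y : V, ExteriorAlgebra.ι K x * ExteriorAlgebra.ι K y ∈
      Subalgebra.center K (ExteriorAlgebra K V) := by
    intro x y
    rw [Subalgebra.mem_center_iff]
    intro z
    induction z using ExteriorAlgebra.induction with
    | algebraMap r => exact Algebra.commutes _ _
    | ι z =>
      have h1 : ExteriorAlgebra.ι K z * ExteriorAlgebra.ι K x = _ :=
        eq_neg_of_add_eq_zero_left (ExteriorAlgebra.ι_add_mul_swap _ _)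
      have h2 : ExteriorAlgebra.ι K z * ExteriorAlgebra.ι K y = _ :=
        eq_neg_of_add_eq_zero_left (ExteriorAlgebra.ι_add_mul_swap _ _)
      rw [← mul_assoc, h1, neg_mul, mul_assoc, h2, mul_neg, neg_neg, mul_assoc]
    | mul p q hp hq => rw [mul_assoc, hq, ← mul_assoc, hp, mul_assoc]
    | add p q hp hq => rw [add_mul, mul_add, hp, hq]
  have htf : ∀ m : ℕ, m ≠ 0 → ∀ z : ExteriorAlgebra K V, (m : ExteriorAlgebra K V) * z = 0 → z = 0 := by
    intro m hm z hz
    have h1 : (algebraMap ℚ K (m : ℚ)⁻¹) * (m : K) = 1 := by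
      rw [← map_natCast (algebraMap ℚ K) m, ← map_mul, inv_mul_cancel₀ (by exact_mod_cast hm), map_one]
    have h2 : (m : K) • z = 0 := by
      rw [Algebra.smul_def, map_natCast, hz]
    rw [← one_smul K z, ← h1, mul_smul, h2, smul_zero]
  let S := Subalgebra.center K (ExteriorAlgebra K V)
  have hmem : ∀ i j, (a ^ 2) i j ∈ S := by
    intro i j
    rw [pow_two, Matrix.mul_apply]
    refine Subalgebra.sum_mem _ fun k _ => ?_
    rw [ha, ha]; exact hcen _ _
  let b : Matrix (Fin n) (Fin n) S := fun i j => ⟨(a ^ 2) i j, hmem i j⟩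
  have hb : S.val.mapMatrix b = a ^ 2 := by ext i j; rfl
  have hbn : b ^ n = 0 := by
    apply al_nilpotent
    · intro m hm z hz
      apply Subtype.ext
      apply htf m hm
      have := congrArg S.val hz
      rwa [map_mul, map_natCast, map_zero] at this
    · intro k
      apply Subtype.ext
      apply htf 2 two_ne_zero
      have h1 : ((b ^ (k+1)).trace : ExteriorAlgebra K V) = (a * (a * S.val.mapMatrix (b ^ k))).trace := by
        rw [← mul_assoc, ← pow_two, ← hb, ← map_mul, ← pow_succ']
        change S.val _ = _
        simp only [Matrix.trace, map_sum]; rfl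
      have h2 : ((b ^ (k+1)).trace : ExteriorAlgebra K V) = ((a * S.val.mapMatrix (b ^ k)) * a).trace := by
        have : S.val.mapMatrix (b ^ k) * a = a * S.val.mapMatrix (b ^ k) := by
          rw [map_pow, hb]
          exact ((Commute.refl a).pow_left 2).pow_left k
        rw [h1, mul_assoc, this]
      have h3 : (a * (a * S.val.mapMatrix (b ^ k))).trace =
          - ((a * S.val.mapMatrix (b ^ k)) * a).trace := by
        simp only [Matrix.trace, Matrix.diag, Matrix.mul_apply, Finset.mul_sum, Finset.sum_mul]
        rw [Finset.sum_comm, ← Finset.sum_neg_distrib]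
        refine Finset.sum_congr rfl fun i _ => ?_
        rw [← Finset.sum_neg_distrib]
        refine Finset.sum_congr rfl fun j _ => ?_
        rw [← Finset.sum_neg_distrib]
        refine Finset.sum_congr rfl fun l _ => ?_
        have hc := Subalgebra.mem_center_iff.1 ((b ^ k) l j).2 (a j i)
        change _ * (_ * (((b ^ k) l j : S) : ExteriorAlgebra K V)) =
          - ((_ * (((b ^ k) l j : S) : ExteriorAlgebra K V)) * _)
        rw [← mul_assoc, hanti, mul_assoc _ _ (a j i), ← hc, neg_mul, mul_assoc]
      rw [← h2, ← h1] at h3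
      change ((2 : ℕ) : ExteriorAlgebra K V) * ((b ^ (k+1)).trace : ExteriorAlgebra K V) = 0
      rw [Nat.cast_two, two_mul]
      nth_rewrite 1 [h3]
      exact neg_add_cancel _
  rw [pow_mul, ← hb, ← map_pow, hbn, map_zero]

/-- The theorem over commutative `ℚ`-algebras. -/
lemma al_rat {K : Type*} [CommRing K] [Algebra ℚ K] (n r : ℕ) (hr : 2 * n ≤ r)
    (A : Fin r → Matrix (Fin n) (Fin n) K) :
    ∑ σ : Equiv.Perm (Fin r),
      ((Equiv.Perm.sign σ : ℤ) • (List.ofFn (fun i : Fin r => A (σ i))).prod) = 0 := by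
  classical
  let e : Fin r → (Fin r → K) := fun i => Pi.single i 1
  let E : Fin r → ExteriorAlgebra K (Fin r → K) := fun i => ExteriorAlgebra.ι K (e i)
  let a : Matrix (Fin n) (Fin n) (ExteriorAlgebra K (Fin r → K)) :=
    ∑ i, (A i).map (fun c => c • E i)
  have h0 : a ^ r = 0 := by
    have : a ^ (2 * n) = 0 := by
      refine al_pow (fun j k => ∑ i, A i j k • e i) a fun j k => ?_
      simp [a, E, Matrix.sum_apply]
    exact pow_eq_zero_of_le hr this
  have h1 : a ^ r = ∑ f : Fin r → Fin r,
      (List.ofFn fun i => A (f i)).prod.map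
        (fun c => c • ExteriorAlgebra.ιMulti K r (fun i => e (f i))) := by
    have := (MultilinearMap.mkPiAlgebraFin K r
      (Matrix (Fin n) (Fin n) (ExteriorAlgebra K (Fin r → K)))).map_sum
      (fun _ i => (A i).map (fun c => c • E i))
    simp only [MultilinearMap.mkPiAlgebraFin_apply] at this
    rw [List.ofFn_const, List.prod_replicate] at this
    refine this.trans (Finset.sum_congr rfl fun f _ => ?_)
    exact al_prod (fun i => A (f i)) (fun i => E (f i))
  let D : ExteriorAlgebra K (Fin r → K) →ₗ[K] K :=
    ExteriorAlgebra.liftAlternating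
      (fun i => if h : i = r then h ▸ Matrix.detRowAlternating else 0)
  have hD : ∀ f : Fin r → Fin r, D (ExteriorAlgebra.ιMulti K r (fun i => e (f i))) =
      Matrix.det (fun i => e (f i)) := by
    intro f
    simp only [D, ExteriorAlgebra.liftAlternating_apply_ιMulti]
    simp
    rfl
  ext j k
  have h2 := congrArg D (congrFun (congrFun (h1.symm.trans h0) j) k)
  simp only [Matrix.sum_apply, Matrix.map_apply, map_sum, map_smul, hD, smul_eq_mul,
    Matrix.zero_apply, map_zero] at h2
  rw [Matrix.zero_apply, ← h2, Matrix.sum_apply]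
  have hinj : Function.Injective (fun σ : Equiv.Perm (Fin r) => (σ : Fin r → Fin r)) :=
    DFunLike.coe_injective
  rw [← Finset.sum_subset (Finset.subset_univ (Finset.univ.map ⟨_, hinj⟩)), Finset.sum_map]
  · refine Finset.sum_congr rfl fun σ _ => ?_
    have : Matrix.det (fun i => e (σ i)) = ((Equiv.Perm.sign σ : ℤ) : K) := by
      have h := Matrix.det_permute (R := K) σ (1 : Matrix (Fin r) (Fin r) K)
      rw [Matrix.det_one, mul_one] at h
      rw [← h]
      congr 1
      ext i l
      simp [e, Matrix.one_apply, Pi.single_apply, eq_comm]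
    simp [this, mul_comm]
  · intro f _ hf
    have hni : ¬ Function.Injective f := by
      intro h
      apply hf
      simp only [Finset.mem_map, Finset.mem_univ, true_and, Function.Embedding.coeFn_mk]
      exact ⟨Equiv.ofBijective f (Finite.injective_iff_bijective.1 h), rfl⟩
    simp only [Function.Injective, not_forall] at hni
    obtain ⟨x, y, hxy, hne⟩ := hni
    have hdet : Matrix.det (fun i => e (f i)) = 0 :=
      Matrix.det_zero_of_row_eq hne (by simp only [hxy])
    simp only [hdet, mul_zero]

lemma al_map {K L : Type*} [CommRing K] [CommRing L] (φ : K →+* L) (n r : ℕ)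
    (A : Fin r → Matrix (Fin n) (Fin n) K) :
    φ.mapMatrix (∑ σ : Equiv.Perm (Fin r),
      ((Equiv.Perm.sign σ : ℤ) • (List.ofFn (fun i : Fin r => A (σ i))).prod)) =
    ∑ σ : Equiv.Perm (Fin r),
      ((Equiv.Perm.sign σ : ℤ) •
        (List.ofFn (fun i : Fin r => φ.mapMatrix (A (σ i)))).prod) := by
  rw [map_sum]
  refine Finset.sum_congr rfl fun σ _ => ?_
  rw [map_zsmul, map_list_prod, List.map_ofFn]
  rfl

lemma al_inj {K L : Type*} [CommRing K] [CommRing L] [Algebra ℚ L] (φ : K →+* L)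
    (hinj : Function.Injective φ) (n r : ℕ) (hr : 2 * n ≤ r)
    (A : Fin r → Matrix (Fin n) (Fin n) K) :
    ∑ σ : Equiv.Perm (Fin r),
      ((Equiv.Perm.sign σ : ℤ) • (List.ofFn (fun i : Fin r => A (σ i))).prod) = 0 := by
  have h1 := (al_map φ n r A).trans (al_rat n r hr fun i => φ.mapMatrix (A i))
  ext1 j k
  apply hinj
  have h2 := congrFun (congrFun h1 j) k
  rw [Matrix.zero_apply, map_zero]
  exact h2

/-- **Amitsur–Levitzki theorem (vanishing part).** Let `R` be a commutative ring,
`n ≥ 1` and `r ≥ 2n`. Then for any `n×n` matrices `A_1,…,A_r` with entries in `R`,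
the standard polynomial `S_r` vanishes on them:
`∑_{σ ∈ S_r} sign σ • A_{σ(1)} ⋯ A_{σ(r)} = 0`. -/
theorem amitsur_levitzki_vanishing (R : Type*) [CommRing R] (n r : ℕ)
    (hn : 1 ≤ n) (hr : 2 * n ≤ r)
    (A : Fin r → Matrix (Fin n) (Fin n) R) :
    ∑ σ : Equiv.Perm (Fin r),
      ((Equiv.Perm.sign σ : ℤ) • (List.ofFn (fun i : Fin r => A (σ i))).prod) = 0 := by
  let G : Fin r → Matrix (Fin n) (Fin n) (MvPolynomial (Fin r × Fin n × Fin n) ℤ) :=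
    fun i => Matrix.of fun j k => MvPolynomial.X (i, j, k)
  have hG : ∑ σ : Equiv.Perm (Fin r),
      ((Equiv.Perm.sign σ : ℤ) • (List.ofFn (fun i : Fin r => G (σ i))).prod) = 0 := by
    have hinj : Function.Injective
        (MvPolynomial.map (σ := Fin r × Fin n × Fin n) (Int.castRingHom ℚ)) :=
      MvPolynomial.map_injective _ Int.cast_injective
    exact al_inj _ hinj n r hr G
  let φ : MvPolynomial (Fin r × Fin n × Fin n) ℤ →+* R :=
    MvPolynomial.eval₂Hom (Int.castRingHom R) (fun x => A x.1 x.2.1 x.2.2)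
  have hA : ∀ i, φ.mapMatrix (G i) = A i := by
    intro i
    ext j k
    simp [φ, G]
  have h := al_map φ n r G
  rw [hG, map_zero] at h
  simpa only [hA] using h.symm
end

section
/- Amitsur–Levitzki theorem (minimality part): let R be a nontrivial commutative ring, n ≥ 1 and r < 2n. For every family of coefficients c_σ ∈ R indexed by permutations σ ∈ S_r, not all zero, there exist n×n matrices A_1,…,A_r with entries in R such that the multilinear polynomial value Σ_{σ ∈ S_r} c_σ · A_{σ(1)}A_{σ(2)}⋯A_{σ(r)} is nonzero. In particular the standard polynomial S_r is not an identity of M_n(R) when r < 2n. -/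
/-- Staircase matrix units. -/
def stairUnit (R : Type*) [CommRing R] (n x : ℕ) : Matrix (Fin n) (Fin n) R :=
  fun i j => if i.val = x / 2 ∧ j.val = (x + 1) / 2 then 1 else 0

theorem stairUnit_mul_ne {R : Type*} [CommRing R] {n x : ℕ} {M : Matrix (Fin n) (Fin n) R}
    {i m : Fin n} (h : (stairUnit R n x * M) i m ≠ 0) :
    i.val = x / 2 ∧ ∃ j : Fin n, j.val = (x + 1) / 2 ∧ M j m ≠ 0 := by
  rw [Matrix.mul_apply] at h
  obtain ⟨j, -, hj⟩ := Finset.exists_ne_zero_of_sum_ne_zero h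
  unfold stairUnit at hj
  by_cases hc : i.val = x / 2 ∧ j.val = (x + 1) / 2
  · rw [if_pos hc, one_mul] at hj
    exact ⟨hc.1, j, hc.2, hj⟩
  · rw [if_neg hc, zero_mul] at hj
    exact absurd rfl hj

theorem stairUnit_mul_eq {R : Type*} [CommRing R] {n x : ℕ} {M : Matrix (Fin n) (Fin n) R}
    {i j m : Fin n} (hi : i.val = x / 2) (hj : j.val = (x + 1) / 2) :
    (stairUnit R n x * M) i m = M j m := by
  rw [Matrix.mul_apply, Finset.sum_eq_single j]
  · simp [stairUnit, hi, hj]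
  · intro b _ hb
    have : ¬ (i.val = x / 2 ∧ b.val = (x + 1) / 2) := by
      rintro ⟨-, h⟩
      exact hb (Fin.ext (h.trans hj.symm))
    simp only [stairUnit]
    rw [if_neg this, zero_mul]
  · simp

theorem stair_rows_le {R : Type*} [CommRing R] {n : ℕ} {m : Fin n} (l : List ℕ) :
    ∀ i : Fin n, (l.map (stairUnit R n)).prod i m ≠ 0 → ∀ x ∈ l, i.val ≤ x / 2 := by
  induction l with
  | nil => simp
  | cons y t ih =>
    intro i h x hx
    rw [List.map_cons, List.prod_cons] at h
    obtain ⟨h1, j, hj, h2⟩ := stairUnit_mul_ne h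
    rcases List.mem_cons.1 hx with rfl | hx
    · exact h1.le
    · have := ih j h2 x hx
      omega

theorem stair_unique {R : Type*} [CommRing R] {n : ℕ} {m : Fin n} (l : List ℕ) :
    ∀ (k : ℕ) (i : Fin n), i.val = k / 2 → l.Perm (List.range' k l.length) →
      (l.map (stairUnit R n)).prod i m ≠ 0 → l = List.range' k l.length := by
  induction l with
  | nil => simp
  | cons x t ih =>
    intro k i hi hp h
    rw [List.map_cons, List.prod_cons] at h
    obtain ⟨h1, j, hj, h2⟩ := stairUnit_mul_ne h
    rw [List.length_cons, List.range'_succ] at hp ⊢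
    have hx : x = k := by
      by_contra hne
      have hk : k ∈ t := by
        have : k ∈ x :: t := hp.mem_iff.2 (by simp)
        rcases List.mem_cons.1 this with h | h
        · exact absurd h.symm hne
        · exact h
      have h3 := stair_rows_le t j h2 k hk
      have h4 : x ∈ k :: List.range' (k + 1) t.length := hp.mem_iff.1 (by simp)
      simp only [List.mem_cons, List.mem_range'_1] at h4
      omega
    subst hx
    rw [← ih (x + 1) j hj ((List.perm_cons x).1 hp) h2]

theorem stair_value {R : Type*} [CommRing R] {n : ℕ} {m : Fin n} (len : ℕ) :
    ∀ (k : ℕ) (i : Fin n), i.val = k / 2 → m.val = (k + len) / 2 →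
      ((List.range' k len).map (stairUnit R n)).prod i m = 1 := by
  induction len with
  | zero =>
    intro k i hi hm
    have : i = m := Fin.ext (by omega)
    simp [this]
  | succ len ih =>
    intro k i hi hm
    rw [List.range'_succ, List.map_cons, List.prod_cons]
    have hlt : (k + 1) / 2 < n := by
      have := m.isLt
      omega
    rw [stairUnit_mul_eq (j := ⟨(k + 1) / 2, hlt⟩) hi rfl]
    exact ih (k + 1) _ rfl (by omega)

theorem ofFn_val_eq_range' (r : ℕ) :
    List.ofFn (fun i : Fin r => i.val) = List.range' 0 r := by
  rw [← List.range_eq_range']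
  apply List.ext_getElem <;> simp

/-- **Amitsur–Levitzki theorem (minimality part).** Let `R` be a nontrivial commutative
ring, `n ≥ 1` and `r < 2n`. For every family of coefficients `c_σ ∈ R`, not all zero,
there exist `n×n` matrices `A_1,…,A_r` over `R` such that
`∑_{σ ∈ S_r} c_σ • A_{σ(1)} ⋯ A_{σ(r)} ≠ 0`. -/
theorem amitsur_levitzki_minimality (R : Type*) [CommRing R] [Nontrivial R]
    (n r : ℕ) (hn : 1 ≤ n) (hr : r < 2 * n)
    (c : Equiv.Perm (Fin r) → R) (hc : ∃ σ, c σ ≠ 0) :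
    ∃ A : Fin r → Matrix (Fin n) (Fin n) R,
      ∑ σ : Equiv.Perm (Fin r),
        (c σ • (List.ofFn (fun i : Fin r => A (σ i))).prod) ≠ 0 := by
  obtain ⟨σ₀, h0⟩ := hc
  refine ⟨fun j => stairUnit R n (σ₀⁻¹ j).val, fun h => h0 ?_⟩
  have hm : r / 2 < n := by omega
  have key : ∀ σ : Equiv.Perm (Fin r),
      List.ofFn (fun i : Fin r => stairUnit R n (σ₀⁻¹ (σ i)).val) =
        (List.ofFn (fun i : Fin r => (σ₀⁻¹ (σ i)).val)).map (stairUnit R n) := by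
    intro σ
    rw [List.map_ofFn]
    rfl
  have h' := congrFun (congrFun h ⟨0, hn⟩) ⟨r / 2, hm⟩
  rw [Matrix.sum_apply, Finset.sum_eq_single σ₀] at h'
  · rw [Matrix.smul_apply, key] at h'
    have hs : ∀ i, σ₀⁻¹ (σ₀ i) = i := fun i => σ₀.symm_apply_apply i
    simp only [hs] at h'
    rw [ofFn_val_eq_range', stair_value r 0 _ rfl (by simp)] at h'
    simpa using h'
  · intro σ _ hne
    rw [Matrix.smul_apply, key]
    by_contra hz
    have hz' := right_ne_zero_of_smul hz
    have hu := stair_unique _ 0 _ (by simp) ?_ hz'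
    · apply hne
      rw [List.length_ofFn, ← ofFn_val_eq_range'] at hu
      have := List.ofFn_injective hu
      ext i
      have hi : σ₀⁻¹ (σ i) = i := Fin.ext (congrFun this i)
      rw [Equiv.Perm.inv_eq_iff_eq] at hi
      rw [hi]
    · rw [List.length_ofFn, ← ofFn_val_eq_range']
      exact Equiv.Perm.ofFn_comp_perm (σ₀⁻¹ * σ) (fun i : Fin r => i.val)
  · simp
end

section
/- Amitsur's theorem: let k be a field and s, n ≥ 1. The algebra of s generic n×n matrices over k, i.e. the k-subalgebra of M_n(R_n) generated by the generic matrices X_1,…,X_s, is a (noncommutative) domain: it is nontrivial and for any two of its elements u, v, if uv = 0 then u = 0 or v = 0. -/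
/-- The `ν`-th generic `n×n` matrix over the field `k`: the matrix whose `(i,j)` entry
is the commutative polynomial variable `x^{(ν)}_{ij}`. -/
noncomputable def genericMatrix (k : Type*) [Field k] (s n : ℕ) (ν : Fin s) :
    Matrix (Fin n) (Fin n) (MvPolynomial (Fin s × Fin n × Fin n) k) :=
  Matrix.of fun i j => MvPolynomial.X (ν, i, j)

section AmitsurAux

open MvPolynomial

variable {k : Type*} [Field k] {s n : ℕ}

/-- Rescaling `x_{ij} ↦ x_{ij} y^{(j-i) mod n}`. -/
noncomputable def amPhi (k : Type*) [Field k] (s n : ℕ) :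
    MvPolynomial (Fin s × Fin n × Fin n) k →ₐ[k]
      Polynomial (MvPolynomial (Fin s × Fin n × Fin n) k) :=
  MvPolynomial.aeval fun p =>
    Polynomial.C (MvPolynomial.X p) * Polynomial.X ^ ((p.2.2 - p.2.1 : Fin n) : ℕ)

/-- Simultaneous cyclic shift of the indices. -/
noncomputable def amSigma (k : Type*) [Field k] (s n : ℕ) (c : Fin n) :
    MvPolynomial (Fin s × Fin n × Fin n) k →ₐ[k] MvPolynomial (Fin s × Fin n × Fin n) k :=
  MvPolynomial.rename fun p => (p.1, p.2.1 + c, p.2.2 + c)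

lemma amSigma_injective [NeZero n] (c : Fin n) : Function.Injective (amSigma k s n c) := by
  apply MvPolynomial.rename_injective
  rintro ⟨a, b, d⟩ ⟨a', b', d'⟩ h
  simpa using h

lemma amPhi_eval_one (p : MvPolynomial (Fin s × Fin n × Fin n) k) :
    (amPhi k s n p).eval 1 = p := by
  induction p using MvPolynomial.induction_on with
  | C a =>
    rw [← MvPolynomial.algebraMap_eq, AlgHom.commutes]
    simp [Polynomial.algebraMap_apply]
  | add p q hp hq => simp [hp, hq]
  | mul_X p i hp => simp [hp, amPhi] at hp ⊢

lemma amPhi_sigma [NeZero n] (c : Fin n) (p : MvPolynomial (Fin s × Fin n × Fin n) k) :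
    amPhi k s n (amSigma k s n c p) = Polynomial.mapAlgHom (amSigma k s n c) (amPhi k s n p) := by
  have h : (amPhi k s n).comp (amSigma k s n c)
      = (Polynomial.mapAlgHom (amSigma k s n c)).comp (amPhi k s n) := by
    apply MvPolynomial.algHom_ext
    rintro ⟨a, i, j⟩
    simp [amPhi, amSigma]
  exact DFunLike.congr_fun h p

lemma amPhi_sigma_coeff [NeZero n] (c : Fin n) (p : MvPolynomial (Fin s × Fin n × Fin n) k)
    (d : ℕ) :
    (amPhi k s n (amSigma k s n c p)).coeff d = amSigma k s n c ((amPhi k s n p).coeff d) := by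
  rw [amPhi_sigma]
  simp

/-- Equivariance and support condition. -/
structure AmGood [NeZero n]
    (M : Matrix (Fin n) (Fin n) (MvPolynomial (Fin s × Fin n × Fin n) k)) : Prop where
  equi : ∀ c i j, amSigma k s n c (M i j) = M (i + c) (j + c)
  supp : ∀ i j d, (amPhi k s n (M i j)).coeff d ≠ 0 → i + Fin.ofNat n d = j

lemma am_ofNat_add [NeZero n] (a b : ℕ) :
    Fin.ofNat n (a + b) = Fin.ofNat n a + Fin.ofNat n b := by
  ext
  simp [Fin.val_add]

lemma AmGood.of_mem [NeZero n]
    {M : Matrix (Fin n) (Fin n) (MvPolynomial (Fin s × Fin n × Fin n) k)}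
    (hM : M ∈ Algebra.adjoin k (Set.range (fun ν : Fin s => (Matrix.of fun i j => MvPolynomial.X (ν, i, j) :
      Matrix (Fin n) (Fin n) (MvPolynomial (Fin s × Fin n × Fin n) k))))) : AmGood M := by
  induction hM using Algebra.adjoin_induction with
  | mem x hx =>
    obtain ⟨ν, rfl⟩ := hx
    refine ⟨fun c i j => by simp [amSigma], fun i j d h => ?_⟩
    simp only [Matrix.of_apply, amPhi, MvPolynomial.aeval_X, Polynomial.coeff_C_mul,
      Polynomial.coeff_X_pow] at h
    have hd : d = ((j - i : Fin n) : ℕ) := by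
      by_contra h'
      simp [h'] at h
    subst hd
    have : Fin.ofNat n ((j - i : Fin n) : ℕ) = j - i := by ext; simp
    rw [this]
    abel
  | algebraMap r =>
    refine ⟨fun c i j => ?_, fun i j d h => ?_⟩
    · by_cases hij : i = j
      · subst hij; simp [Matrix.algebraMap_matrix_apply]
      · simp [Matrix.algebraMap_matrix_apply, hij]
    · by_cases hij : i = j
      · subst hij
        simp only [Matrix.algebraMap_matrix_apply, if_true, AlgHom.commutes] at h
        rw [Polynomial.algebraMap_apply, Polynomial.coeff_C] at h
        have hd : d = 0 := by
          by_contra h'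
          simp [h'] at h
        subst hd
        have : Fin.ofNat n 0 = 0 := by ext; simp
        simp [this]
      · simp [Matrix.algebraMap_matrix_apply, hij] at h
  | add x y _ _ hx hy =>
    refine ⟨fun c i j => by simp [hx.equi, hy.equi], fun i j d h => ?_⟩
    by_cases h1 : (amPhi k s n (x i j)).coeff d = 0
    · apply hy.supp i j d
      intro h2
      simp [h1, h2] at h
    · exact hx.supp i j d h1
  | mul x y _ _ hx hy =>
    refine ⟨fun c i j => ?_, fun i j d h => ?_⟩
    · simp only [Matrix.mul_apply, map_sum, map_mul, hx.equi, hy.equi]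
      exact Equiv.sum_comp (Equiv.addRight c) (fun l => x (i + c) l * y l (j + c))
    · simp only [Matrix.mul_apply, map_sum, map_mul, Polynomial.finsetSum_coeff,
        Polynomial.coeff_mul] at h
      obtain ⟨l, _, hl⟩ := Finset.exists_ne_zero_of_sum_ne_zero h
      obtain ⟨⟨a, b⟩, hab, h3⟩ := Finset.exists_ne_zero_of_sum_ne_zero hl
      have h1 := hx.supp i l a (left_ne_zero_of_mul h3)
      have h2 := hy.supp l j b (right_ne_zero_of_mul h3)
      have hab : a + b = d := by simpa using hab
      rw [← hab, am_ofNat_add, ← add_assoc, h1, h2]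

/-- Top degree component of a nonzero good matrix. -/
lemma AmGood.exists_top [NeZero n]
    {M : Matrix (Fin n) (Fin n) (MvPolynomial (Fin s × Fin n × Fin n) k)}
    (hM : AmGood M) (h0 : M ≠ 0) :
    ∃ d : ℕ, (∀ i j, (amPhi k s n (M i j)).natDegree ≤ d) ∧
      ∀ i, (amPhi k s n (M i (i + Fin.ofNat n d))).coeff d ≠ 0 := by
  classical
  have h1 : ∃ i j, M i j ≠ 0 := by
    by_contra! h
    exact h0 (Matrix.ext h)
  obtain ⟨i₁, j₁, h1⟩ := h1
  have hne : (Finset.univ.filter fun p : Fin n × Fin n => M p.1 p.2 ≠ 0).Nonempty :=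
    ⟨(i₁, j₁), by simpa using h1⟩
  obtain ⟨⟨i₀, j₀⟩, hp, hmax⟩ := Finset.exists_max_image _
    (fun p : Fin n × Fin n => (amPhi k s n (M p.1 p.2)).natDegree) hne
  simp only [Finset.mem_filter, Finset.mem_univ, true_and] at hp hmax
  have hphi : amPhi k s n (M i₀ j₀) ≠ 0 := by
    intro h
    apply hp
    rw [← amPhi_eval_one (M i₀ j₀), h, Polynomial.eval_zero]
  refine ⟨(amPhi k s n (M i₀ j₀)).natDegree, fun i j => ?_, fun i => ?_⟩
  · by_cases h : M i j = 0
    · simp [h]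
    · exact hmax (i, j) h
  · have hc : (amPhi k s n (M i₀ j₀)).coeff (amPhi k s n (M i₀ j₀)).natDegree ≠ 0 := by
      simpa using hphi
    generalize (amPhi k s n (M i₀ j₀)).natDegree = d at hc
    have hj := hM.supp _ _ _ hc
    have he : M i (i + Fin.ofNat n d) = amSigma k s n (i - i₀) (M i₀ j₀) := by
      rw [hM.equi, ← hj]
      congr 1 <;> abel
    rw [he, amPhi_sigma_coeff]
    intro h
    exact hc (amSigma_injective (i - i₀) (by rw [h, map_zero]))

lemma AmGood.mul_ne_zero [NeZero n]
    {M N : Matrix (Fin n) (Fin n) (MvPolynomial (Fin s × Fin n × Fin n) k)}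
    (hM : AmGood M) (hN : AmGood N) (hM0 : M ≠ 0) (hN0 : N ≠ 0) : M * N ≠ 0 := by
  obtain ⟨d, hd, hd'⟩ := hM.exists_top hM0
  obtain ⟨e, he, he'⟩ := hN.exists_top hN0
  intro h
  have h1 : (M * N) 0 (0 + Fin.ofNat n d + Fin.ofNat n e) = 0 := by rw [h]; rfl
  have h2 := congrArg (fun p => (amPhi k s n p).coeff (d + e)) h1
  simp only [Matrix.mul_apply, map_sum, map_mul, Polynomial.finsetSum_coeff, map_zero,
    Polynomial.coeff_zero] at h2
  rw [Finset.sum_eq_single (0 + Fin.ofNat n d)] at h2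
  · rw [Polynomial.coeff_mul_add_eq_of_natDegree_le (hd _ _) (he _ _)] at h2
    exact _root_.mul_ne_zero (hd' _) (he' _) h2
  · intro l _ hl
    rw [Polynomial.coeff_mul_add_eq_of_natDegree_le (hd _ _) (he _ _)]
    have : (amPhi k s n (M 0 l)).coeff d = 0 := by
      by_contra h3
      exact hl (hM.supp _ _ _ h3).symm
    rw [this, zero_mul]
  · simp

end AmitsurAux

/-- **Amitsur's theorem.** The algebra of `s` generic `n×n` matrices over a field `k`,
i.e. the `k`-subalgebra of `M_n(R_n)` generated by the generic matrices `X_1,…,X_s`,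
is a (noncommutative) domain: it is nontrivial, and `uv = 0` implies `u = 0` or `v = 0`. -/
theorem amitsur_generic_matrices_domain (k : Type*) [Field k] (s n : ℕ)
    (hs : 1 ≤ s) (hn : 1 ≤ n) :
    Nontrivial (Algebra.adjoin k (Set.range (genericMatrix k s n))) ∧
    ∀ u v : Algebra.adjoin k (Set.range (genericMatrix k s n)),
      u * v = 0 → u = 0 ∨ v = 0 := by
  haveI : NeZero n := ⟨by omega⟩
  refine ⟨inferInstance, fun u v huv => ?_⟩
  by_contra! h
  have hu : AmGood (u : Matrix (Fin n) (Fin n) (MvPolynomial (Fin s × Fin n × Fin n) k)) :=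
    AmGood.of_mem u.2
  have hv : AmGood (v : Matrix (Fin n) (Fin n) (MvPolynomial (Fin s × Fin n × Fin n) k)) :=
    AmGood.of_mem v.2
  refine AmGood.mul_ne_zero hu hv ?_ ?_ ?_
  · intro h0; exact h.1 (Subtype.ext h0)
  · intro h0; exact h.2 (Subtype.ext h0)
  · exact congrArg Subtype.val huv
end

section
/- Let k be a field and s ≥ 1. If f, g ∈ k⟨x_1,…,x_s⟩ commute (fg = gf), then f and g are algebraically dependent over k: there exists a nonzero polynomial P ∈ k[U,V] with Σ_{(a,b)} P_{a,b} f^a g^b = 0. Equivalently, the free associative algebra contains no commutative subalgebra of rank ≥ 2. -/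
namespace CommDep

/-- All words in the support of `p` have length at most `n`. -/
def DegLE {k X : Type*} [Field k] (p : MonoidAlgebra k (FreeMonoid X)) (n : ℕ) : Prop :=
  ∀ w : FreeMonoid X, p.coeff w ≠ 0 → w.length ≤ n

variable {k X : Type*} [Field k]

lemma coeff_top {p q : MonoidAlgebra k (FreeMonoid X)} {v u : FreeMonoid X}
    (hp : DegLE p v.length) (hq : DegLE q u.length) :
    (p * q).coeff (v * u) = p.coeff v * q.coeff u := by
  apply MonoidAlgebra.coeff_mul_mul_of_uniqueMul
  intro a b ha hb hab
  have h1 := hp a (Finsupp.mem_support_iff.mp ha)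
  have h2 := hq b (Finsupp.mem_support_iff.mp hb)
  have h3 := congrArg FreeMonoid.length hab
  rw [FreeMonoid.length_mul, FreeMonoid.length_mul] at h3
  have h4 : a.length = v.length := by omega
  exact List.append_inj (s₁ := a.toList) (s₂ := v.toList) hab h4

lemma DegLE.mul {p q : MonoidAlgebra k (FreeMonoid X)} {m n : ℕ}
    (hp : DegLE p m) (hq : DegLE q n) : DegLE (p * q) (m + n) := by
  classical
  intro w hw
  have h := MonoidAlgebra.support_coeff_mul_subset p q (Finsupp.mem_support_iff.mpr hw)
  obtain ⟨a, ha, b, hb, rfl⟩ := Finset.mem_mul.mp h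
  rw [FreeMonoid.length_mul]
  have h1 := hp a (Finsupp.mem_support_iff.mp ha)
  have h2 := hq b (Finsupp.mem_support_iff.mp hb)
  omega

lemma DegLE.one : DegLE (1 : MonoidAlgebra k (FreeMonoid X)) 0 := by
  classical
  intro w hw
  rw [MonoidAlgebra.one_def, MonoidAlgebra.coeff_single, Finsupp.single_apply] at hw
  split_ifs at hw with h
  · subst h; simp
  · exact absurd rfl hw

lemma DegLE.pow {p : MonoidAlgebra k (FreeMonoid X)} {n : ℕ}
    (hp : DegLE p n) (m : ℕ) : DegLE (p ^ m) (m * n) := by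
  induction m with
  | zero => simpa using DegLE.one
  | succ m ih => rw [pow_succ, Nat.succ_mul]; exact ih.mul hp

lemma DegLE.mono {p : MonoidAlgebra k (FreeMonoid X)} {n m : ℕ}
    (hp : DegLE p n) (h : n ≤ m) : DegLE p m := fun w hw => (hp w hw).trans h

lemma length_pow' (u : FreeMonoid X) (m : ℕ) : (u ^ m).length = m * u.length := by
  induction m with
  | zero => simp
  | succ m ih => rw [pow_succ, FreeMonoid.length_mul, ih, Nat.succ_mul]

lemma coeff_pow_top {p : MonoidAlgebra k (FreeMonoid X)} {u : FreeMonoid X}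
    (hp : DegLE p u.length) (m : ℕ) : (p ^ m).coeff (u ^ m) = p.coeff u ^ m := by
  induction m with
  | zero => simp [MonoidAlgebra.one_def]
  | succ m ih =>
    rw [pow_succ, pow_succ, coeff_top (by rw [length_pow']; exact hp.pow m) hp, ih, pow_succ]

lemma exists_top {p : MonoidAlgebra k (FreeMonoid X)} (hp : p ≠ 0) :
    ∃ u, p.coeff u ≠ 0 ∧ DegLE p u.length := by
  have hne : p.coeff.support.Nonempty := by
    rw [Finsupp.support_nonempty_iff]
    exact fun h => hp (MonoidAlgebra.coeff_eq_zero.mp h)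
  obtain ⟨u, hu, hmax⟩ := Finset.exists_max_image _ FreeMonoid.length hne
  exact ⟨u, Finsupp.mem_support_iff.mp hu, fun w hw => hmax w (Finsupp.mem_support_iff.mpr hw)⟩

/-- The suffix of `u` obtained by dropping `i` letters. -/
def suffix (u : FreeMonoid X) (i : ℕ) : FreeMonoid X := FreeMonoid.ofList (u.toList.drop i)

lemma key {F h : MonoidAlgebra k (FreeMonoid X)} {u : FreeMonoid X} (hu : F.coeff u ≠ 0)
    (hF : DegLE F u.length) (hc : h * F = F * h) (hh : DegLE h u.length) (h0 : h ≠ 0) :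
    ∃ i : Fin (u.length + 1), h.coeff (suffix u i) ≠ 0 := by
  obtain ⟨v, hv, hvm⟩ := exists_top h0
  have hle := hh v hv
  refine ⟨⟨u.length - v.length, by omega⟩, ?_⟩
  set i := u.length - v.length with hi
  have hlen : (suffix u i).length = v.length := by
    change (u.toList.drop i).length = v.length
    rw [List.length_drop]
    change u.length - i = _
    omega
  set t : FreeMonoid X := v * FreeMonoid.ofList (u.toList.take i) with ht
  have htl : t.length = u.length := by
    rw [ht, FreeMonoid.length_mul]
    change v.length + (u.toList.take i).length = _
    rw [List.length_take]
    change v.length + min i u.length = _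
    omega
  have heq : v * u = t * suffix u i := by
    rw [ht, mul_assoc]
    congr 1
    exact (List.take_append_drop i u.toList).symm
  have h1 := coeff_top hvm hF
  rw [hc, heq, coeff_top (by rwa [htl]) (by rwa [hlen])] at h1
  intro hz
  change h.coeff (suffix u i) = 0 at hz
  rw [hz, mul_zero] at h1
  exact mul_ne_zero hv hu h1.symm

/-- Coefficients along suffixes of `u`. -/
noncomputable def phi (k : Type*) [Field k] (u : FreeMonoid X) :
    MonoidAlgebra k (FreeMonoid X) →ₗ[k] (Fin (u.length + 1) → k) where
  toFun h i := h.coeff (suffix u i)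
  map_add' _ _ := rfl
  map_smul' _ _ := rfl

lemma not_li (F G : MonoidAlgebra k (FreeMonoid X)) (hFG : F * G = G * F) :
    ¬ LinearIndependent k (fun p : ℕ × ℕ => F ^ p.1 * G ^ p.2) := by
  intro hli
  by_cases hF0 : DegLE F 0
  · have hFc : F = F.coeff 1 • (1 : MonoidAlgebra k (FreeMonoid X)) := by
      ext w
      by_cases hw : w = 1
      · subst hw; simp [MonoidAlgebra.one_def]
      · have : F.coeff w = 0 := by
          by_contra hne
          exact hw (FreeMonoid.length_eq_zero.mp (Nat.le_zero.mp (hF0 w hne)))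
        rw [this]
        simp [MonoidAlgebra.one_def, Finsupp.single_apply, Ne.symm hw]
    have := linearIndependent_iff.mp hli
      (Finsupp.single (1, 0) 1 - Finsupp.single (0, 0) (F.coeff 1)) (by
        rw [map_sub, Finsupp.linearCombination_single, Finsupp.linearCombination_single]
        simp only [pow_one, pow_zero, mul_one, one_smul]
        rw [← hFc, sub_self])
    have := DFunLike.congr_fun this (1, 0)
    simp at this
  · have hFne : F ≠ 0 := by
      rintro rfl
      exact hF0 (fun w hw => absurd rfl hw)
    obtain ⟨u, hu, hFu⟩ := exists_top hFne
    have hupos : 1 ≤ u.length := by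
      by_contra h
      exact hF0 (hFu.mono (by omega))
    obtain ⟨e, hGe⟩ : ∃ e, DegLE G e := by
      by_cases hG : G = 0
      · exact ⟨0, by rw [hG]; exact fun w hw => absurd rfl hw⟩
      · obtain ⟨v, -, hv⟩ := exists_top hG
        exact ⟨_, hv⟩
    set d := u.length with hd
    set N := d * (1 + e) with hN
    set m := N * (1 + e) with hm
    have hUl : (u ^ m).length = m * d := length_pow' u m
    have hli2 := hli.comp (fun p : Fin (N + 1) × Fin (N + 1) => ((p.1 : ℕ), (p.2 : ℕ))) (by
      rintro ⟨a, b⟩ ⟨a', b'⟩ h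
      simp only [Prod.mk.injEq, Fin.val_inj] at h
      exact Prod.ext h.1 h.2)
    have hspan : ∀ x ∈ Submodule.span k (Set.range ((fun p : ℕ × ℕ => F ^ p.1 * G ^ p.2) ∘
        (fun p : Fin (N + 1) × Fin (N + 1) => ((p.1 : ℕ), (p.2 : ℕ))))),
        x * F ^ m = F ^ m * x ∧ DegLE x (m * d) := by
      intro x hx
      induction hx using Submodule.span_induction with
      | mem x hx =>
        obtain ⟨⟨a, b⟩, rfl⟩ := hx
        constructor
        · have h1 : Commute F G := hFG
          exact (((Commute.refl F).pow_pow a m).mul_left (h1.symm.pow_pow b m)).eq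
        · refine ((hFu.pow a).mul (hGe.pow b)).mono ?_
          have ha : (a : ℕ) ≤ N := by omega
          have hb : (b : ℕ) ≤ N := by omega
          calc (a : ℕ) * d + b * e ≤ N * d + N * e := by gcongr
            _ ≤ N * d + N * e * d := by
              have := Nat.mul_le_mul_left (N * e) hupos
              omega
            _ = m * d := by rw [hm]; ring
      | zero => exact ⟨by simp, fun w hw => absurd rfl hw⟩
      | add x y _ _ hx hy =>
        refine ⟨by rw [add_mul, mul_add, hx.1, hy.1], fun w hw => ?_⟩
        by_contra hlt
        apply hw
        rw [MonoidAlgebra.coeff_add, Finsupp.add_apply,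
          not_not.mp (fun h => hlt (hx.2 w h)), not_not.mp (fun h => hlt (hy.2 w h)), add_zero]
      | smul c x _ hx =>
        refine ⟨by rw [smul_mul_assoc, mul_smul_comm, hx.1], fun w hw => hx.2 w ?_⟩
        intro h
        apply hw
        rw [MonoidAlgebra.coeff_smul, Finsupp.smul_apply, h, smul_zero]
    have hinj : Set.InjOn (phi k (u ^ m))
        (Submodule.span k (Set.range ((fun p : ℕ × ℕ => F ^ p.1 * G ^ p.2) ∘
        (fun p : Fin (N + 1) × Fin (N + 1) => ((p.1 : ℕ), (p.2 : ℕ)))))) := by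
      intro x hx y hy hxy
      by_contra hne
      obtain ⟨h1, h2⟩ := hspan _ (Submodule.sub_mem _ hx hy)
      obtain ⟨i, hi⟩ := key (F := F ^ m) (u := u ^ m)
        (by rw [coeff_pow_top hFu]; exact pow_ne_zero _ hu)
        (by rw [hUl]; exact hFu.pow m) h1 (by rwa [hUl]) (sub_ne_zero.mpr hne)
      apply hi
      have h3 : phi k (u ^ m) (x - y) = 0 := by rw [map_sub, hxy, sub_self]
      exact congrFun h3 i
    have hcard := (hli2.map_injOn _ hinj).fintype_card_le_finrank
    simp only [Fintype.card_prod, Fintype.card_fin, Module.finrank_fintype_fun_eq_card] at hcard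
    rw [hUl] at hcard
    have : m * d = N * N := by rw [hm, hN]; ring
    rw [this] at hcard
    nlinarith [Nat.mul_le_mul hupos (Nat.le_add_right 1 e)]

end CommDep

/-- Evaluation of a two-variable polynomial `P ∈ k[U,V]` at a pair of elements `u, v`
of a (possibly noncommutative) `k`-algebra: `∑_{(a,b)} P_{a,b} • u^a * v^b`. -/
noncomputable def pairEval {k A : Type*} [CommSemiring k] [Semiring A] [Algebra k A]
    (P : MvPolynomial (Fin 2) k) (u v : A) : A :=
  ∑ m ∈ P.support, MvPolynomial.coeff m P • (u ^ (m 0) * v ^ (m 1))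

/-- Commuting elements of the free associative algebra `k⟨x_1,…,x_s⟩` are algebraically
dependent over `k`: there is a nonzero `P ∈ k[U,V]` with `∑ P_{a,b} f^a g^b = 0`.
Equivalently, the free associative algebra contains no commutative subalgebra of
rank `≥ 2`. -/
theorem commuting_implies_algebraically_dependent (k : Type*) [Field k] (s : ℕ)
    (hs : 1 ≤ s) (f g : FreeAlgebra k (Fin s)) (hcomm : f * g = g * f) :
    ∃ P : MvPolynomial (Fin 2) k, P ≠ 0 ∧ pairEval P f g = 0 := by
  classical
  by_contra hcon
  push Not at hcon
  let φ := FreeAlgebra.equivMonoidAlgebraFreeMonoid (R := k) (X := Fin s)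
  refine CommDep.not_li (φ f) (φ g) (by rw [← map_mul, hcomm, map_mul]) ?_
  have hli : LinearIndependent k (fun m : Fin 2 →₀ ℕ => f ^ (m 0) * g ^ (m 1)) := by
    rw [linearIndependent_iff]
    intro l hl
    by_contra hl0
    refine hcon (AddMonoidAlgebra.ofCoeff l) (fun h => hl0 ?_) hl
    exact congrArg AddMonoidAlgebra.coeff h
  have h2 := (hli.comp (fun p : ℕ × ℕ => Finsupp.single 0 p.1 + Finsupp.single 1 p.2) (by
    rintro ⟨a, b⟩ ⟨a', b'⟩ h
    have h0 := DFunLike.congr_fun h 0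
    have h1 := DFunLike.congr_fun h 1
    simp at h0 h1
    exact Prod.ext h0 h1)).map' φ.toLinearMap (LinearMap.ker_eq_bot.mpr φ.injective)
  have h3 : (fun p : ℕ × ℕ => φ f ^ p.1 * φ g ^ p.2) = φ.toLinearMap ∘
      ((fun m : Fin 2 →₀ ℕ => f ^ (m 0) * g ^ (m 1)) ∘
        (fun p : ℕ × ℕ => Finsupp.single 0 p.1 + Finsupp.single 1 p.2)) := by
    ext1 p
    simp
  rw [h3]
  exact h2
end

section
/- Centralizers in the free associative algebra are integrally closed: let k be a field, s ≥ 1, and let f ∈ k⟨x_1,…,x_s⟩ be a non-scalar element, with centralizer C = {b : fb = bf}. If g, P, Q ∈ C, Q ≠ 0, and g·Q^m = P^m for some positive integer m, then there exists h ∈ C with h^m = g. -/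
namespace CIC

open MonoidAlgebra

noncomputable section

section Degree

variable {k : Type*} [Field k] {X : Type*}

/-- degree of an element -/
def dg (x : MonoidAlgebra k (FreeMonoid X)) : ℕ := x.coeff.support.sup FreeMonoid.length

/-- all monomials have length `< n` -/
def DL (n : ℕ) (x : MonoidAlgebra k (FreeMonoid X)) : Prop :=
  ∀ v, x.coeff v ≠ 0 → v.length < n

theorem DL_dg (x : MonoidAlgebra k (FreeMonoid X)) : DL (dg x + 1) x := by
  intro v hv
  have : v.length ≤ dg x := Finset.le_sup (f := FreeMonoid.length) (Finsupp.mem_support_iff.2 hv)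
  omega

theorem DL.mono {m n : ℕ} (h : m ≤ n) {x : MonoidAlgebra k (FreeMonoid X)} (hx : DL m x) :
    DL n x := fun v hv => lt_of_lt_of_le (hx v hv) h

theorem dg_le {n : ℕ} {x : MonoidAlgebra k (FreeMonoid X)} (hx : DL (n + 1) x) : dg x ≤ n :=
  Finset.sup_le fun v hv => Nat.le_of_lt_succ (hx v (Finsupp.mem_support_iff.1 hv))

theorem DL_zero_iff {x : MonoidAlgebra k (FreeMonoid X)} : DL 0 x ↔ x = 0 := by
  constructor
  · intro h
    ext v
    by_contra hv
    exact absurd (h v hv) (by omega)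
  · rintro rfl v hv
    simp at hv

theorem DL.cases {n : ℕ} {x : MonoidAlgebra k (FreeMonoid X)} (hx : DL n x) :
    x = 0 ∨ dg x < n := by
  rcases n with _ | n
  · exact Or.inl (DL_zero_iff.1 hx)
  · exact Or.inr (Nat.lt_succ_of_le (dg_le hx))

theorem DL.add {n : ℕ} {x y : MonoidAlgebra k (FreeMonoid X)} (hx : DL n x) (hy : DL n y) :
    DL n (x + y) := by
  intro v hv
  by_cases h : x.coeff v = 0
  · refine hy v fun h' => hv ?_
    simp [h, h']
  · exact hx v h

theorem DL.smul {n : ℕ} {x : MonoidAlgebra k (FreeMonoid X)} (c : k) (hx : DL n x) :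
    DL n (c • x) := by
  intro v hv
  refine hx v fun h' => hv ?_
  simp [h']

theorem DL.neg {n : ℕ} {x : MonoidAlgebra k (FreeMonoid X)} (hx : DL n x) : DL n (-x) := by
  intro v hv
  refine hx v fun h' => hv ?_
  simp [h']

theorem DL.sub {n : ℕ} {x y : MonoidAlgebra k (FreeMonoid X)} (hx : DL n x) (hy : DL n y) :
    DL n (x - y) := by
  rw [sub_eq_add_neg]; exact hx.add hy.neg

/-- right transduction -/
def tr (w : FreeMonoid X) : MonoidAlgebra k (FreeMonoid X) →+ MonoidAlgebra k (FreeMonoid X) :=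
  comapDomainAddMonoidHom (fun v => v * w) (fun _ _ h => mul_right_cancel h)

@[simp] theorem coeff_tr (w v : FreeMonoid X) (x : MonoidAlgebra k (FreeMonoid X)) :
    (tr w x).coeff v = x.coeff (v * w) := by
  rfl

theorem tr_DL {n : ℕ} {x : MonoidAlgebra k (FreeMonoid X)} (w : FreeMonoid X)
    (hx : DL (n + w.length) x) : DL n (tr w x) := by
  intro v hv
  rw [coeff_tr] at hv
  have := hx _ hv
  rw [FreeMonoid.length_mul] at this
  omega

theorem tr_mul_letter (c : X) (b y : MonoidAlgebra k (FreeMonoid X)) :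
    tr (.of c) (b * y) = b * tr (.of c) y + y.coeff 1 • tr (.of c) b := by
  classical
  induction y using MonoidAlgebra.induction_linear with
  | zero => simp
  | add y z hy hz => 
    rw [mul_add, map_add, hy, hz, map_add, mul_add, coeff_add, Finsupp.add_apply, add_smul]
    abel
  | single v r =>
    rcases eq_or_ne v 1 with rfl | hv
    · have h1 : tr (k := k) (.of c) (single 1 r) = 0 := by
        ext u
        have : (1 : FreeMonoid X) ≠ u * .of c := by
          intro h
          have := congrArg FreeMonoid.length h
          simp at this
        simp [coeff_single, Finsupp.single_apply, this]
      rw [h1]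
      ext u
      simp [coeff_mul_single_one, mul_comm]
    · obtain ⟨v', c', rfl⟩ : ∃ v' c', v = v' * FreeMonoid.of c' := by
        have := List.eq_nil_or_concat (FreeMonoid.toList v)
        rcases this with h | ⟨L, b, h⟩
        · exact absurd (FreeMonoid.toList.injective h) hv
        · exact ⟨FreeMonoid.ofList L, b, FreeMonoid.toList.injective (by simpa using h)⟩
      have h2 : (single (v' * FreeMonoid.of c') r : MonoidAlgebra k (FreeMonoid X)).coeff 1 = 0 := by
        rw [coeff_single]
        exact Finsupp.single_eq_of_ne (Ne.symm hv)
      rw [h2, zero_smul, add_zero]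
      have h3 : (single (v' * FreeMonoid.of c') r : MonoidAlgebra k (FreeMonoid X))
          = single v' r * single (.of c') 1 := by simp [single_mul_single]
      rw [h3, ← mul_assoc]
      have h4 : ∀ z : MonoidAlgebra k (FreeMonoid X),
          tr (.of c) (z * single (.of c') 1) = if c = c' then z else 0 := by
        intro z
        ext u
        rw [coeff_tr]
        split_ifs with h
        · subst h
          rw [coeff_mul_single_mul]; simp
        · rw [coeff_mul_single_of_forall_mul_ne]
          · simp
          · intro d hd
            apply h
            have := congrArg (fun z => (FreeMonoid.toList z).getLast?) hd
            simpa using this.symm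
      rw [h4, h4]
      split_ifs <;> simp

theorem tr_one (x : MonoidAlgebra k (FreeMonoid X)) : tr 1 x = x := by
  ext; simp

theorem tr_mul (u w : FreeMonoid X) (x : MonoidAlgebra k (FreeMonoid X)) :
    tr (u * w) x = tr u (tr w x) := by
  ext; simp [mul_assoc]

theorem tr_prod (w : FreeMonoid X) {n : ℕ} {b : MonoidAlgebra k (FreeMonoid X)}
    (hb : DL (n + 1) b) (y : MonoidAlgebra k (FreeMonoid X)) :
    DL n (tr w (b * y) - b * tr w y) := by
  induction w using FreeMonoid.inductionOn' with
  | one => simp [tr_one, DL]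
  | of_mul c w ih =>
    have h : tr (.of c * w) (b * y) - b * tr (.of c * w) y
        = (tr w y).coeff 1 • tr (.of c) b + tr (.of c) (tr w (b * y) - b * tr w y) := by
      rw [tr_mul, tr_mul, map_sub, tr_mul_letter c b (tr w y)]
      abel
    rw [h]
    refine (DL.smul _ (tr_DL _ ?_)).add (tr_DL _ (ih.mono ?_))
    · simpa using hb
    · omega

theorem exists_top {x : MonoidAlgebra k (FreeMonoid X)} (hx : x ≠ 0) :
    ∃ w, x.coeff w ≠ 0 ∧ w.length = dg x ∧ tr w x = single 1 (x.coeff w) := by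
  have hne : x.coeff.support.Nonempty := by
    rw [Finsupp.support_nonempty_iff]
    intro h; exact hx (coeff_injective (by simpa using h))
  obtain ⟨w, hw, h⟩ := Finset.exists_mem_eq_sup _ hne FreeMonoid.length
  refine ⟨w, Finsupp.mem_support_iff.1 hw, h.symm, ?_⟩
  have hd : DL (1 + w.length) x := (DL_dg x).mono (by unfold dg; omega)
  have h1 := tr_DL w hd
  ext v
  by_cases hv : v = 1
  · subst hv; simp
  · rw [coeff_single, Finsupp.single_eq_of_ne hv]
    by_contra h0
    have := h1 v h0
    apply hv
    exact FreeMonoid.length_eq_zero.1 (by omega)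

theorem mul_single_one_smul (b : MonoidAlgebra k (FreeMonoid X)) (r : k) :
    b * single 1 r = r • b := by
  ext u; simp [coeff_mul_single_one, mul_comm]

theorem dg_smul {r : k} (hr : r ≠ 0) (b : MonoidAlgebra k (FreeMonoid X)) :
    dg (r • b) = dg b := by
  unfold dg
  congr 1
  ext v; simp [hr]

theorem dg_mul {a x : MonoidAlgebra k (FreeMonoid X)} (ha : a ≠ 0) (hx : x ≠ 0) :
    dg (a * x) = dg a + dg x := by
  apply le_antisymm
  · apply dg_le
    intro v hv
    classical
    rw [coeff_mul] at hv
    obtain ⟨u, hu, h1⟩ := Finset.exists_ne_zero_of_sum_ne_zero hv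
    obtain ⟨w, hw, h2⟩ := Finset.exists_ne_zero_of_sum_ne_zero h1
    have : u * w = v := by
      by_contra h; simp [h] at h2
    subst this
    have := DL_dg a u (Finsupp.mem_support_iff.1 hu)
    have := DL_dg x w (Finsupp.mem_support_iff.1 hw)
    rw [FreeMonoid.length_mul]; omega
  · obtain ⟨w, hw, hl, ht⟩ := exists_top hx
    obtain ⟨u, hu, hul, -⟩ := exists_top ha
    have h := tr_prod w (DL_dg a) x
    rw [ht, mul_single_one_smul] at h
    have h2 : (tr w (a * x)).coeff u ≠ 0 := by
      intro h0
      have := h u (by simp [coeff_tr] at h0; simp [h0, hu, hw])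
      omega
    rw [coeff_tr] at h2
    have := DL_dg (a * x) _ h2
    rw [FreeMonoid.length_mul] at this
    omega

theorem dg_pow {a : MonoidAlgebra k (FreeMonoid X)} (ha : a ≠ 0) (n : ℕ) :
    dg (a ^ n) = n * dg a := by
  induction n with
  | zero =>
    have : dg (1 : MonoidAlgebra k (FreeMonoid X)) ≤ 0 := by
      apply dg_le
      intro v hv
      by_contra h
      apply hv
      rw [one_def, coeff_single]
      apply Finsupp.single_eq_of_ne
      rintro rfl
      simp at h
    simp; omega
  | succ n ih => rw [pow_succ, dg_mul (pow_ne_zero _ ha) ha, ih]; ring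

/-- weak algorithm -/
theorem weak_alg {a b x y : MonoidAlgebra k (FreeMonoid X)} (hx : x ≠ 0)
    (hdeg : dg b ≤ dg a) (h : DL (dg a + dg x) (a * x - b * y)) :
    ∃ z, DL (dg a) (a - b * z) := by
  obtain ⟨w, hw, hl, ht⟩ := exists_top hx
  refine ⟨(x.coeff w)⁻¹ • tr w y, ?_⟩
  have h1 := tr_prod w (DL_dg a) x
  have h2 := tr_prod w ((DL_dg b).mono (Nat.succ_le_succ hdeg)) y
  rw [← hl] at h
  have h3 := tr_DL w h
  rw [map_sub] at h3
  rw [ht, mul_single_one_smul] at h1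
  have h4 := ((h3.sub h1).add h2).smul (x.coeff w)⁻¹
  convert h4 using 1
  rw [mul_smul_comm, show tr w (a * x) - tr w (b * y) - (tr w (a * x) - x.coeff w • a) +
    (tr w (b * y) - b * tr w y) = x.coeff w • a - b * tr w y by abel, smul_sub, smul_smul,
    inv_mul_cancel₀ hw, one_smul]

theorem eq_algebraMap_of_dg {x : MonoidAlgebra k (FreeMonoid X)} (h : dg x = 0) :
    x = single 1 (x.coeff 1) := by
  ext v
  rw [coeff_single]
  by_cases hv : v = 1
  · subst hv; simp
  · rw [Finsupp.single_eq_of_ne hv]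
    by_contra h0
    have := DL_dg x v h0
    apply hv
    exact FreeMonoid.length_eq_zero.1 (by omega)

/-- Two-term Euclidean algorithm with degree estimate -/
theorem euclid (n : ℕ) : ∀ a b x y : MonoidAlgebra k (FreeMonoid X), dg a + dg b ≤ n →
    b ≠ 0 → x ≠ 0 → a * x = b * y →
    ∃ d r s a' b', d = a * r + b * s ∧ a = d * a' ∧ b = d * b' ∧ dg b ≤ dg d + dg x := by
  induction n using Nat.strong_induction_on with
  | _ n ih =>
  intro a b x y hn hb hx h
  -- the main case
  have main : ∀ a b x y : MonoidAlgebra k (FreeMonoid X), dg a + dg b ≤ n →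
      b ≠ 0 → x ≠ 0 → a * x = b * y → dg b ≤ dg a →
      ∃ d r s a' b', d = a * r + b * s ∧ a = d * a' ∧ b = d * b' ∧ dg b ≤ dg d + dg x := by
    intro a b x y hn hb hx h hdeg
    obtain ⟨z, hz⟩ := weak_alg (a := a) (b := b) (y := y) hx hdeg
      (by rw [h, sub_self]; intro v hv; simp at hv)
    rcases hz.cases with h0 | hlt
    · refine ⟨b, 0, 1, z, 1, by simp, sub_eq_zero.1 h0, by simp, by omega⟩
    · obtain ⟨d, r, s, a', b', h1, h2, h3, h4⟩ := ih (dg (a - b * z) + dg b) (by omega)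
        (a - b * z) b x (y - z * x) le_rfl hb hx (by rw [sub_mul, mul_sub, h, mul_assoc])
      refine ⟨d, r, s - z * r, a' + b' * z, b', ?_, ?_, h3, h4⟩
      · rw [h1]; noncomm_ring
      · rw [mul_add, ← h2, ← mul_assoc, ← h3]; abel
  by_cases ha : a = 0
  · exact ⟨b, 0, 1, 0, 1, by simp, by simp [ha], by simp, by omega⟩
  rcases le_total (dg b) (dg a) with hd | hd
  · exact main a b x y hn hb hx h hd
  · have hy : y ≠ 0 := by
      rintro rfl
      rw [mul_zero] at h
      exact (mul_ne_zero ha hx) h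
    obtain ⟨d, r, s, a', b', h1, h2, h3, h4⟩ := main b a y x (by omega) ha hy h.symm hd
    refine ⟨d, s, r, b', a', by rw [h1, add_comm], h3, h2, ?_⟩
    have e1 := dg_mul ha hx
    have e2 := dg_mul hb hy
    rw [h] at e1
    omega

end Degree
end

end CIC

namespace CIC

open MonoidAlgebra

noncomputable section

section Comm

variable {k : Type*} [Field k] {X : Type*}

theorem not_DL_dg {x : MonoidAlgebra k (FreeMonoid X)} (hx : x ≠ 0) {n : ℕ} (h : DL n x) :
    dg x < n := by
  rcases h.cases with h | h
  · exact absurd h hx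
  · exact h

theorem lead_unique {f b c : MonoidAlgebra k (FreeMonoid X)} (hf : 0 < dg f)
    (hb : f * b = b * f) (hc : f * c = c * f) (hb0 : b ≠ 0) (hc0 : c ≠ 0) (hd : dg b = dg c) :
    ∃ l : k, DL (dg b) (b - l • c) := by
  have hf0 : f ≠ 0 := by
    rintro rfl
    simp [dg] at hf
  have hF0 : f ^ dg b ≠ 0 := pow_ne_zero _ hf0
  have hFd : dg b ≤ dg (f ^ dg b) := by
    rw [dg_pow hf0]; exact Nat.le_mul_of_pos_right _ hf
  have hbF : Commute (f ^ dg b) b := Commute.pow_left hb _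
  have hcF : Commute (f ^ dg b) c := Commute.pow_left hc _
  generalize f ^ dg b = F at *
  obtain ⟨z, hz⟩ := weak_alg (a := F) (b := b) (x := b) (y := F) hb0 hFd
    (by rw [hbF.eq, sub_self]; intro v hv; simp at hv)
  obtain ⟨z', hz'⟩ := weak_alg (a := F) (b := c) (x := c) (y := F) hc0 (hd ▸ hFd)
    (by rw [hcF.eq, sub_self]; intro v hv; simp at hv)
  have hz0 : z ≠ 0 := by
    rintro rfl
    rw [mul_zero, sub_zero] at hz
    exact absurd (not_DL_dg hF0 hz) (lt_irrefl _)
  have hge : dg F ≤ dg b + dg z := by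
    by_contra hlt
    rw [← dg_mul hb0 hz0] at hlt
    have h1 : DL (dg F) (b * z) := (DL_dg _).mono (by omega)
    have h2 := hz.add h1
    rw [sub_add_cancel] at h2
    exact absurd (not_DL_dg hF0 h2) (lt_irrefl _)
  obtain ⟨y, hy⟩ := weak_alg (a := b) (b := c) (x := z) (y := z') hz0 hd.ge
    (by
      have h := (hz'.sub hz).mono hge
      rwa [sub_sub_sub_cancel_left] at h)
  by_cases hy0 : y = 0
  · refine ⟨0, ?_⟩
    rw [hy0, mul_zero] at hy
    rwa [zero_smul]
  have h1 : DL (dg b + 1) (c * y) := by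
    have := (DL_dg b).sub (hy.mono (Nat.le_succ _))
    rwa [sub_sub_cancel] at this
  have h2 := dg_le h1
  rw [dg_mul hc0 hy0] at h2
  have h3 := eq_algebraMap_of_dg (x := y) (by omega)
  refine ⟨y.coeff 1, ?_⟩
  rwa [h3, mul_single_one_smul] at hy

theorem exists_gen {f : MonoidAlgebra k (FreeMonoid X)} (hf : 0 < dg f) :
    ∃ b : MonoidAlgebra k (FreeMonoid X), b ≠ 0 ∧ f * b = b * f ∧
      ∀ c, c ≠ 0 → f * c = c * f → ∃ i N, dg c + N * dg f = i * dg b := by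
  classical
  have hf0 : f ≠ 0 := by
    rintro rfl
    simp [dg] at hf
  have hex : ∃ r, 0 < r ∧ ∃ b : MonoidAlgebra k (FreeMonoid X), b ≠ 0 ∧ f * b = b * f ∧
      ∃ j, dg b = r + dg f * j := ⟨dg f, hf, f, hf0, rfl, 0, by simp⟩
  obtain ⟨hr, b, hb0, hb, j, hj⟩ := Nat.find_spec hex
  have hmin := fun m => Nat.find_min (H := hex) (m := m)
  generalize Nat.find hex = r at *
  refine ⟨b, hb0, hb, fun c hc0 hc => ?_⟩
  obtain ⟨i, q, hq, hqr⟩ : ∃ i q, dg c = r * i + q ∧ q < r :=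
    ⟨dg c / r, dg c % r, (Nat.div_add_mod _ _).symm, Nat.mod_lt _ hr⟩
  have hq0 : q = 0 := by
    by_contra hq0
    refine hmin q hqr ⟨Nat.pos_of_ne_zero hq0, c * b ^ (i * (dg f - 1)),
      mul_ne_zero hc0 (pow_ne_zero _ hb0), ?_, r * i + i * (dg f - 1) * j, ?_⟩
    · exact (Commute.mul_right (show Commute f c from hc) (Commute.pow_right hb _)).eq
    · rw [dg_mul hc0 (pow_ne_zero _ hb0), dg_pow hb0, hj, hq]
      obtain ⟨n, hn⟩ : ∃ n, dg f = n + 1 := ⟨dg f - 1, by omega⟩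
      rw [hn]
      simp only [Nat.add_sub_cancel]
      ring
  subst hq0
  refine ⟨i, i * j, ?_⟩
  rw [hq, hj]; ring

theorem comm_aux {f a b : MonoidAlgebra k (FreeMonoid X)} (hf : 0 < dg f)
    (hb0 : b ≠ 0) (hb : f * b = b * f) (ha : f * a = a * f)
    (hgen : ∀ c, c ≠ 0 → f * c = c * f → ∃ i N, dg c + N * dg f = i * dg b)
    (hab : a * b = b * a) (c : MonoidAlgebra k (FreeMonoid X)) (hc : f * c = c * f) :
    a * c = c * a := by
  have hf0 : f ≠ 0 := by
    rintro rfl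
    simp [dg] at hf
  by_contra hne
  have key : ∀ r : ℕ, ∃ (N : ℕ) (c' : MonoidAlgebra k (FreeMonoid X)), f * c' = c' * f ∧
      a * c' - c' * a = f ^ N * (a * c - c * a) ∧ dg c' + r ≤ dg c + N * dg f := by
    intro r
    induction r with
    | zero => exact ⟨0, c, hc, by simp, by simp⟩
    | succ r ih =>
      obtain ⟨N, c', h1, h2, h3⟩ := ih
      have hne' : f ^ N * (a * c - c * a) ≠ 0 :=
        mul_ne_zero (pow_ne_zero _ hf0) (sub_ne_zero.2 hne)
      have hc0 : c' ≠ 0 := by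
        rintro rfl
        apply hne'
        rw [← h2]; simp
      obtain ⟨i, M, hi⟩ := hgen c' hc0 h1
      have hfc : dg (f ^ M * c') = dg c' + M * dg f := by
        rw [dg_mul (pow_ne_zero _ hf0) hc0, dg_pow hf0, add_comm]
      have hfc' : Commute f (f ^ M * c') := (Commute.pow_right (Commute.refl f) M).mul_right h1
      have hfb' : Commute f (b ^ i) := Commute.pow_right hb i
      obtain ⟨l, hl⟩ := lead_unique hf hfc'.eq hfb'.eq
        (mul_ne_zero (pow_ne_zero _ hf0) hc0) (pow_ne_zero _ hb0)
        (by rw [hfc, dg_pow hb0, hi])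
      have hab' : Commute a (b ^ i) := Commute.pow_right hab i
      have haf' : Commute a (f ^ M) := Commute.pow_right (Eq.symm ha) M
      have hbr : a * (f ^ M * c' - l • b ^ i) - (f ^ M * c' - l • b ^ i) * a
          = f ^ (M + N) * (a * c - c * a) := by
        rw [pow_add, mul_assoc, ← h2, mul_sub, sub_mul, mul_smul_comm, smul_mul_assoc, hab'.eq,
          ← mul_assoc, haf'.eq]
        noncomm_ring
      refine ⟨M + N, f ^ M * c' - l • b ^ i, ?_, hbr, ?_⟩
      · rw [mul_sub, sub_mul, hfc'.eq, mul_smul_comm, smul_mul_assoc, hfb'.eq]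
      · rcases hl.cases with h0 | h0
        · exfalso
          rw [h0] at hbr
          simp only [mul_zero, zero_mul, sub_zero] at hbr
          exact mul_ne_zero (pow_ne_zero (M + N) hf0) (sub_ne_zero.2 hne) hbr.symm
        · rw [hfc] at h0
          rw [add_mul]
          omega
  obtain ⟨N, c', h1, h2, h3⟩ := key (dg a + dg c + 1)
  have hne' : f ^ N * (a * c - c * a) ≠ 0 :=
    mul_ne_zero (pow_ne_zero _ hf0) (sub_ne_zero.2 hne)
  have hc0 : c' ≠ 0 := by
    rintro rfl
    apply hne'
    rw [← h2]; simp
  have ha0 : a ≠ 0 := by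
    rintro rfl
    apply hne; simp
  have hdl : DL (dg a + dg c' + 1) (a * c' - c' * a) := by
    refine DL.sub ?_ ?_
    · rw [← dg_mul ha0 hc0]; exact DL_dg _
    · rw [add_comm (dg a), ← dg_mul hc0 ha0]; exact DL_dg _
  have h4 := dg_le hdl
  rw [h2, dg_mul (pow_ne_zero _ hf0) (sub_ne_zero.2 hne), dg_pow hf0] at h4
  omega

theorem centralizer_comm {f a c : MonoidAlgebra k (FreeMonoid X)} (hf : 0 < dg f)
    (ha : f * a = a * f) (hc : f * c = c * f) : a * c = c * a := by
  obtain ⟨b, hb0, hb, hgen⟩ := exists_gen hf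
  have h1 := fun c hc => comm_aux hf hb0 hb hb hgen rfl c hc
  exact comm_aux hf hb0 hb ha hgen (h1 a ha).symm c hc

end Comm
end

end CIC

namespace CIC

open MonoidAlgebra

noncomputable section

section Gauss

variable {k : Type*} [Field k] {X : Type*}

/-- `k⟨X⟩ → k[t]⟨X⟩` -/
def up (k X : Type*) [Field k] :
    MonoidAlgebra k (FreeMonoid X) →+* MonoidAlgebra (Polynomial k) (FreeMonoid X) :=
  mapRingHom (FreeMonoid X) Polynomial.C

/-- `k[t]⟨X⟩ → k(t)⟨X⟩` -/
def fr (k X : Type*) [Field k] : MonoidAlgebra (Polynomial k) (FreeMonoid X) →+*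
    MonoidAlgebra (FractionRing (Polynomial k)) (FreeMonoid X) :=
  mapRingHom (FreeMonoid X) (algebraMap (Polynomial k) (FractionRing (Polynomial k)))

/-- `k[t]⟨X⟩ → k⟨X⟩[t]` -/
def ph (k X : Type*) [Field k] : MonoidAlgebra (Polynomial k) (FreeMonoid X) →+*
    Polynomial (MonoidAlgebra k (FreeMonoid X)) :=
  liftNCRingHom (Polynomial.mapRingHom (algebraMap k (MonoidAlgebra k (FreeMonoid X))))
    ((Polynomial.C : _ →+* Polynomial (MonoidAlgebra k (FreeMonoid X))).toMonoidHom.comp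
      (of k (FreeMonoid X)))
    (by
      intro p w
      refine Polynomial.ext fun n => ?_
      simp only [Polynomial.coe_mapRingHom, MonoidHom.comp_apply, RingHom.toMonoidHom_eq_coe,
        MonoidHom.coe_coe, Polynomial.coeff_mul_C, Polynomial.coeff_C_mul, Polynomial.coeff_map]
      exact Algebra.commutes _ _)

theorem ph_single (w : FreeMonoid X) (p : Polynomial k) :
    ph k X (single w p) = p.map (algebraMap k (MonoidAlgebra k (FreeMonoid X))) *
      Polynomial.C (single w 1) := by
  exact liftNCRingHom_single _ _ _ _ _

theorem coeff_ph (x : MonoidAlgebra (Polynomial k) (FreeMonoid X)) (n : ℕ) (w : FreeMonoid X) :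
    ((ph k X x).coeff n).coeff w = (x.coeff w).coeff n := by
  classical
  induction x using MonoidAlgebra.induction_linear with
  | zero => simp
  | add x y hx hy => simp [hx, hy]
  | single v p =>
    rw [ph_single, Polynomial.coeff_mul_C, Polynomial.coeff_map, ← Algebra.smul_def]
    rw [coeff_smul, Finsupp.smul_apply, coeff_single, coeff_single]
    by_cases h : w = v
    · subst h; simp
    · rw [Finsupp.single_eq_of_ne h, Finsupp.single_eq_of_ne h]; simp

theorem ph_up (a : MonoidAlgebra k (FreeMonoid X)) : ph k X (up k X a) = Polynomial.C a := by
  refine Polynomial.ext fun n => ?_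
  ext w
  rw [coeff_ph, up, coeff_mapRingHom, Polynomial.coeff_C, Polynomial.coeff_C]
  split_ifs <;> simp

theorem ph_smul (p : Polynomial k) (x : MonoidAlgebra (Polynomial k) (FreeMonoid X)) :
    ph k X (p • x) = p.map (algebraMap k (MonoidAlgebra k (FreeMonoid X))) * ph k X x := by
  have : p • x = single 1 p * x := by
    ext w; simp [coeff_single_one_mul]
  rw [this, map_mul, ph_single, ← one_def, map_one, mul_one]

theorem fr_injective : Function.Injective (fr k X) :=
  map_injective _ (IsFractionRing.injective (Polynomial k) (FractionRing (Polynomial k)))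

theorem fr_smul (p : Polynomial k) (x : MonoidAlgebra (Polynomial k) (FreeMonoid X)) :
    fr k X (p • x) = algebraMap (Polynomial k) (FractionRing (Polynomial k)) p • fr k X x := by
  ext w; simp [fr, coeff_mapRingHom, Algebra.smul_def]

theorem descend_left {b c : MonoidAlgebra (Polynomial k) (FreeMonoid X)}
    {a : MonoidAlgebra k (FreeMonoid X)} (ha : a ≠ 0) (h : b * c = up k X a) :
    ∃ b0, b = up k X b0 := by
  have h1 : ph k X b * ph k X c = Polynomial.C a := by rw [← map_mul, h, ph_up]
  have hne : ph k X b * ph k X c ≠ 0 := by rw [h1]; simpa using ha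
  have h2 := Polynomial.natDegree_mul (left_ne_zero_of_mul hne) (right_ne_zero_of_mul hne)
  rw [h1, Polynomial.natDegree_C] at h2
  have h3 : (ph k X b).natDegree = 0 := by omega
  refine ⟨(ph k X b).coeff 0, ?_⟩
  ext w n
  rw [← coeff_ph, ← coeff_ph, ph_up, ← Polynomial.eq_C_of_natDegree_eq_zero h3]

theorem exists_smul_of_mod {π : Polynomial k} (hπ : π ≠ 0)
    (x : MonoidAlgebra (Polynomial k) (FreeMonoid X))
    (h : mapRingHom (FreeMonoid X) (Ideal.Quotient.mk (Ideal.span {π})) x = 0) :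
    ∃ y, x = π • y := by
  refine ⟨.ofCoeff (x.coeff.mapRange (fun r => r / π) (by simp)), ?_⟩
  refine coeff_injective (Finsupp.ext fun w => ?_)
  have h1 : (mapRingHom (FreeMonoid X) (Ideal.Quotient.mk (Ideal.span {π})) x).coeff w = 0 := by
    rw [h]; simp
  rw [coeff_mapRingHom, Ideal.Quotient.eq_zero_iff_mem, Ideal.mem_span_singleton] at h1
  rw [coeff_smul, Finsupp.smul_apply, coeff_ofCoeff, Finsupp.mapRange_apply, smul_eq_mul,
    EuclideanDomain.mul_div_cancel' hπ h1]

theorem smul_cancel {p : Polynomial k} (hp : p ≠ 0)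
    {x y : MonoidAlgebra (Polynomial k) (FreeMonoid X)} (h : p • x = p • y) : x = y := by
  refine coeff_injective (Finsupp.ext fun w => ?_)
  have := congrArg (fun z => z.coeff w) h
  simpa [hp] using this

theorem gauss (p : Polynomial k) : p ≠ 0 →
    ∀ b c a : MonoidAlgebra (Polynomial k) (FreeMonoid X), b * c = p • a →
    ∃ (b' c' : MonoidAlgebra (Polynomial k) (FreeMonoid X)) (r : Polynomial k), r ≠ 0 ∧ r • b' = b ∧ b' * c' = a := by
  induction p using UniqueFactorizationMonoid.induction_on_prime with
  | h₁ => intro h; exact absurd rfl h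
  | h₂ p hp =>
    intro _ b c a h
    obtain ⟨u, rfl⟩ := hp
    refine ⟨b, (↑u⁻¹ : Polynomial k) • c, 1, one_ne_zero, one_smul _ _, ?_⟩
    rw [mul_smul_comm, h, smul_smul, Units.inv_mul, one_smul]
  | h₃ p π hp hπ ih =>
    intro _ b c a h
    have hdom : IsDomain (Polynomial k ⧸ Ideal.span {π}) := by
      rw [Ideal.Quotient.isDomain_iff_prime, Ideal.span_singleton_prime hπ.ne_zero]
      exact hπ
    have h0 : mapRingHom (FreeMonoid X) (Ideal.Quotient.mk (Ideal.span {π})) b *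
        mapRingHom (FreeMonoid X) (Ideal.Quotient.mk (Ideal.span {π})) c = 0 := by
      rw [← map_mul, h]
      ext w
      rw [coeff_mapRingHom, coeff_smul, Finsupp.smul_apply, smul_eq_mul, mul_assoc, map_mul,
        Ideal.Quotient.eq_zero_iff_mem.2 (Ideal.mem_span_singleton_self π)]
      simp
    rw [mul_smul] at h
    rcases mul_eq_zero.1 h0 with h1 | h1
    · obtain ⟨y, rfl⟩ := exists_smul_of_mod hπ.ne_zero b h1
      rw [smul_mul_assoc] at h
      obtain ⟨b', c', r, hr, e1, e2⟩ := ih hp y c a (smul_cancel hπ.ne_zero h)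
      exact ⟨b', c', π * r, mul_ne_zero hπ.ne_zero hr, by rw [mul_smul, e1], e2⟩
    · obtain ⟨y, rfl⟩ := exists_smul_of_mod hπ.ne_zero c h1
      rw [mul_smul_comm] at h
      exact ih hp b y a (smul_cancel hπ.ne_zero h)

theorem clear_denom (x : MonoidAlgebra (FractionRing (Polynomial k)) (FreeMonoid X)) :
    ∃ (p : Polynomial k) (y : MonoidAlgebra (Polynomial k) (FreeMonoid X)), p ≠ 0 ∧
      fr k X y = algebraMap (Polynomial k) (FractionRing (Polynomial k)) p • x := by
  induction x using MonoidAlgebra.induction_linear with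
  | zero => exact ⟨1, 0, one_ne_zero, by simp⟩
  | add x y hx hy =>
    obtain ⟨p, x', hp, hx⟩ := hx
    obtain ⟨q, y', hq, hy⟩ := hy
    refine ⟨p * q, q • x' + p • y', mul_ne_zero hp hq, ?_⟩
    rw [map_add, fr_smul, fr_smul, hx, hy, smul_smul, smul_smul, smul_add, map_mul, mul_comm]
  | single w r =>
    obtain ⟨a, b, hb, rfl⟩ := IsFractionRing.div_surjective (A := Polynomial k) r
    have hb0 : b ≠ 0 := nonZeroDivisors.ne_zero hb
    refine ⟨b, single w a, hb0, ?_⟩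
    have hb1 : algebraMap (Polynomial k) (FractionRing (Polynomial k)) b ≠ 0 := by
      simpa using hb0
    rw [fr, mapRingHom_single, smul_single, smul_eq_mul, mul_div_cancel₀ _ hb1]

theorem dg_fr_up (x : MonoidAlgebra k (FreeMonoid X)) : dg (fr k X (up k X x)) = dg x := by
  unfold dg
  congr 1
  ext v
  simp [fr, up, coeff_mapRingHom]

theorem main_div {P Q d v : MonoidAlgebra k (FreeMonoid X)} (hQ : Q ≠ 0) (hd : d ≠ 0)
    (h : P * d = Q * d * v) : ∃ h, P = Q * h := by
  set S : MonoidAlgebra (Polynomial k) (FreeMonoid X) :=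
    up k X Q + (Polynomial.X : Polynomial k) • up k X P with hS
  have hupne : ∀ x : MonoidAlgebra k (FreeMonoid X), x ≠ 0 → fr k X (up k X x) ≠ 0 := by
    intro x hx h0
    apply hx
    have h1 : up k X x = 0 := fr_injective (by rw [h0, map_zero])
    exact map_injective (M := FreeMonoid X) (Polynomial.C : k →+* Polynomial k).toAddMonoidHom
      Polynomial.C_injective (h1.trans (map_zero (up k X)).symm)
  have hcm : fr k X S * fr k X (up k X d) = fr k X (up k X (Q * d)) *
      fr k X (1 + (Polynomial.X : Polynomial k) • up k X v) := by
    rw [← map_mul, ← map_mul, hS, add_mul, smul_mul_assoc, ← map_mul, ← map_mul, h, mul_add,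
      mul_one, mul_smul_comm, ← map_mul]
  obtain ⟨δ, r, s, a', b', -, h2, h3, h4⟩ := euclid _ _ _ _ _ le_rfl
    (hupne _ (mul_ne_zero hQ hd)) (hupne _ hd) hcm
  rw [dg_fr_up, dg_fr_up, dg_mul hQ hd] at h4
  obtain ⟨p, b, hp, hb⟩ := clear_denom δ
  obtain ⟨q, c, hq, hc⟩ := clear_denom b'
  have hbc : b * c = (p * q) • up k X (Q * d) := by
    apply fr_injective
    rw [fr_smul, map_mul, hb, hc, smul_mul_assoc, mul_smul_comm, ← h3, smul_smul,
      map_mul (algebraMap _ _)]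
  obtain ⟨b1, c1, l, hl, e1, e2⟩ := gauss _ (mul_ne_zero hp hq) _ _ _ hbc
  obtain ⟨b0, rfl⟩ := descend_left (mul_ne_zero hQ hd) e2
  have hp1 : algebraMap (Polynomial k) (FractionRing (Polynomial k)) p ≠ 0 := by simpa using hp
  have hl1 : algebraMap (Polynomial k) (FractionRing (Polynomial k)) l ≠ 0 := by simpa using hl
  rw [← e1, fr_smul] at hb
  have hdeg : dg δ = dg b0 := by
    rw [← dg_fr_up b0, ← dg_smul hl1 (fr k X _), hb, dg_smul hp1]
  -- `S` is a left multiple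
  obtain ⟨q', z, hq', hz⟩ := clear_denom a'
  have hSz : up k X b0 * (l • z) = (p * q') • S := by
    apply fr_injective
    rw [fr_smul, map_mul, h2, fr_smul, hz, mul_smul_comm, ← smul_mul_assoc, hb, smul_mul_assoc,
      mul_smul_comm, smul_smul, map_mul (algebraMap _ _)]
  have hpq := mul_ne_zero hp hq'
  generalize p * q' = t at hSz hpq
  generalize l • z = y at hSz
  have hcomm : ∀ x : MonoidAlgebra k (FreeMonoid X),
      Polynomial.C x * t.map (algebraMap k (MonoidAlgebra k (FreeMonoid X))) =
      t.map (algebraMap k (MonoidAlgebra k (FreeMonoid X))) * Polynomial.C x := by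
    intro x
    refine Polynomial.ext fun n => ?_
    rw [Polynomial.coeff_C_mul, Polynomial.coeff_mul_C, Polynomial.coeff_map]
    exact (Algebra.commutes _ _).symm
  have hpoly := congrArg (ph k X) hSz
  rw [map_mul, ph_up, ph_smul, hS, map_add, ph_smul, ph_up, ph_up, Polynomial.map_X] at hpoly
  have hlc : t.leadingCoeff ≠ 0 := by simpa using hpq
  have hP : ∃ P1, P = b0 * P1 := by
    have h5 := congrArg (fun x => Polynomial.coeff x (t.natDegree + 1)) hpoly
    rw [mul_add] at h5
    simp only [Polynomial.coeff_add, Polynomial.coeff_C_mul, Polynomial.coeff_mul_C,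
      Polynomial.coeff_map, ← mul_assoc, Polynomial.coeff_mul_X] at h5
    rw [Polynomial.coeff_natDegree, Polynomial.coeff_eq_zero_of_natDegree_lt (Nat.lt_succ_self _),
      map_zero, zero_mul, zero_add, ← Algebra.smul_def] at h5
    refine ⟨t.leadingCoeff⁻¹ • (ph k X y).coeff (t.natDegree + 1), ?_⟩
    rw [mul_smul_comm, h5, smul_smul, inv_mul_cancel₀ hlc, one_smul]
  obtain ⟨P1, hP1⟩ := hP
  have hQ1 : ∃ Q1, Q = b0 * Q1 := by
    have h6 : Polynomial.C b0 * (ph k X y - Polynomial.C P1 *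
        t.map (algebraMap k (MonoidAlgebra k (FreeMonoid X))) * Polynomial.X) =
        t.map (algebraMap k (MonoidAlgebra k (FreeMonoid X))) * Polynomial.C Q := by
      rw [mul_sub, hpoly, ← mul_assoc, ← mul_assoc, ← Polynomial.C_mul, ← hP1, hcomm P, mul_add,
        Polynomial.X_mul, ← mul_assoc, add_sub_cancel_right]
    have h5 := congrArg (fun x => Polynomial.coeff x t.natDegree) h6
    simp only [Polynomial.coeff_C_mul, Polynomial.coeff_mul_C, Polynomial.coeff_map] at h5
    rw [Polynomial.coeff_natDegree, ← Algebra.smul_def] at h5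
    generalize (ph k X y - Polynomial.C P1 * t.map (algebraMap k (MonoidAlgebra k (FreeMonoid X))) *
      Polynomial.X).coeff t.natDegree = e at h5
    refine ⟨t.leadingCoeff⁻¹ • e, ?_⟩
    rw [mul_smul_comm, h5, smul_smul, inv_mul_cancel₀ hlc, one_smul]
  obtain ⟨Q1, hQ1⟩ := hQ1
  have hb00 : b0 ≠ 0 := by rintro rfl; simp [hQ] at hQ1
  have hQ10 : Q1 ≠ 0 := by rintro rfl; simp [hQ] at hQ1
  have hdQ : dg Q = dg b0 + dg Q1 := by rw [hQ1, dg_mul hb00 hQ10]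
  have hs := eq_algebraMap_of_dg (x := Q1) (by omega)
  have hs0 : Q1.coeff 1 ≠ 0 := by
    intro h0
    rw [h0] at hs
    exact hQ10 (by simpa using hs)
  refine ⟨(Q1.coeff 1)⁻¹ • P1, ?_⟩
  rw [hQ1, hs, mul_single_one_smul, hP1]
  simp [smul_smul, hs0]

theorem principal (c : ℕ → MonoidAlgebra k (FreeMonoid X)) (h0 : ∀ i, c i ≠ 0)
    (hc : ∀ i j, Commute (c i) (c j)) (j : ℕ) :
    ∃ d, (∃ r : ℕ → MonoidAlgebra k (FreeMonoid X), d = ∑ i ∈ Finset.range (j + 1), c i * r i) ∧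
      ∀ i < j + 1, ∃ s, c i = d * s := by
  induction j with
  | zero =>
    refine ⟨c 0, ⟨fun _ => 1, by simp⟩, fun i hi => ⟨1, ?_⟩⟩
    obtain rfl : i = 0 := by omega
    simp
  | succ j ih =>
    obtain ⟨d, ⟨r, hr⟩, hd⟩ := ih
    obtain ⟨s0, hs0⟩ := hd 0 (by omega)
    have hs : s0 ≠ 0 := by
      rintro rfl
      exact h0 0 (by simpa using hs0)
    obtain ⟨d', u, w, a', b', h1, h2, h3, -⟩ := euclid _ d (c (j + 1)) (s0 * c (j + 1)) (c 0)
      le_rfl (h0 _) (mul_ne_zero hs (h0 _)) (by rw [← mul_assoc, ← hs0, (hc _ _).eq])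
    refine ⟨d', ⟨fun i => if i = j + 1 then w else r i * u, ?_⟩, ?_⟩
    · simp only [Finset.sum_range_succ _ (j + 1)]
      rw [if_pos trivial, h1, hr, Finset.sum_mul]
      congr 1
      refine Finset.sum_congr rfl fun i hi => ?_
      rw [if_neg (by have := Finset.mem_range.1 hi; omega), mul_assoc]
    · intro i hi
      rcases Nat.lt_succ_iff_lt_or_eq.1 hi with hlt | rfl
      · obtain ⟨s, hs⟩ := hd i hlt
        exact ⟨a' * s, by rw [← mul_assoc, ← h2, hs]⟩
      · exact ⟨b', h3⟩

theorem div_of_pow {P Q g : MonoidAlgebra k (FreeMonoid X)} (hPQ : Commute P Q) (hQ : Q ≠ 0)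
    (m : ℕ) (hm : 1 ≤ m) (h : g * Q ^ m = P ^ m) : ∃ h, P = Q * h := by
  by_cases hP : P = 0
  · exact ⟨0, by simp [hP]⟩
  obtain ⟨n, rfl⟩ : ∃ n, m = n + 1 := ⟨m - 1, by omega⟩
  have hgQ : Commute g Q := by
    have h1 : Q * g * Q ^ (n + 1) = g * Q * Q ^ (n + 1) := by
      rw [mul_assoc, h, ← (hPQ.pow_left _).eq, ← h, mul_assoc, mul_assoc, ← pow_succ, ← pow_succ']
    exact (mul_right_cancel₀ (pow_ne_zero _ hQ) h1).symm
  obtain ⟨d, ⟨r, hr⟩, hd⟩ := principal (fun i => P ^ i * Q ^ (n - i))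
    (fun i => mul_ne_zero (pow_ne_zero _ hP) (pow_ne_zero _ hQ))
    (fun i j => Commute.mul_left
      (((Commute.refl P).pow_pow _ _).mul_right (hPQ.pow_pow _ _))
      ((hPQ.symm.pow_pow _ _).mul_right ((Commute.refl Q).pow_pow _ _))) n
  have hd0 : d ≠ 0 := by
    rintro rfl
    obtain ⟨s, hs⟩ := hd 0 (by omega)
    simp [hQ] at hs
  have key : ∀ i ∈ Finset.range (n + 1), ∃ v, P * (P ^ i * Q ^ (n - i)) = Q * d * v := by
    intro i hi
    have hi' := Finset.mem_range.1 hi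
    by_cases hin : i = n
    · subst hin
      obtain ⟨s, hs⟩ := hd 0 (by omega)
      refine ⟨s * g, ?_⟩
      simp only [pow_zero, one_mul, Nat.sub_zero] at hs
      rw [mul_assoc, ← mul_assoc d, ← hs, Nat.sub_self, pow_zero, mul_one, ← pow_succ', ← h,
        ← mul_assoc, ← pow_succ', (hgQ.pow_right _).eq]
    · obtain ⟨s, hs⟩ := hd (i + 1) (by omega)
      refine ⟨s, ?_⟩
      rw [mul_assoc, ← hs, ← mul_assoc, ← pow_succ', ← mul_assoc Q, ← (hPQ.pow_left _).eq,
        mul_assoc, ← pow_succ']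
      congr 2
      omega
  choose! v hv using key
  have : P * d = Q * d * ∑ i ∈ Finset.range (n + 1), v i * r i := by
    conv_lhs => rw [hr]
    rw [Finset.mul_sum, Finset.mul_sum]
    refine Finset.sum_congr rfl fun i hi => ?_
    rw [← mul_assoc, hv i hi, mul_assoc]
  exact main_div hQ hd0 this

theorem main {f g P Q : MonoidAlgebra k (FreeMonoid X)} (hf : 0 < dg f)
    (hP : f * P = P * f) (hQ : f * Q = Q * f) (hQ0 : Q ≠ 0) (m : ℕ) (hm : 1 ≤ m)
    (h : g * Q ^ m = P ^ m) : ∃ x, f * x = x * f ∧ x ^ m = g := by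
  have hPQ : Commute P Q := centralizer_comm hf hP hQ
  obtain ⟨x, hx⟩ := div_of_pow hPQ hQ0 m hm h
  have hQx : Commute x Q := by
    have h1 : Q * (x * Q) = Q * (Q * x) := by
      rw [← mul_assoc, ← hx, hPQ.eq]
    exact mul_left_cancel₀ hQ0 h1
  refine ⟨x, ?_, ?_⟩
  · apply mul_left_cancel₀ hQ0
    rw [← mul_assoc, ← hQ, mul_assoc, ← hx, hP, hx, mul_assoc]
  · apply mul_right_cancel₀ (pow_ne_zero m hQ0)
    rw [h, ← hQx.mul_pow, hQx.eq, hx]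

end Gauss
end

end CIC

/-- **Centralizers in the free associative algebra are integrally closed.**
Let `f` be a non-scalar element of `k⟨x_1,…,x_s⟩` with centralizer `C`. If
`g, P, Q ∈ C`, `Q ≠ 0`, and `g·Q^m = P^m` for some positive integer `m`, then
there exists `h ∈ C` with `h^m = g`. -/
theorem centralizer_integrally_closed (k : Type*) [Field k] (s : ℕ) (hs : 1 ≤ s)
    (f : FreeAlgebra k (Fin s))
    (hf : f ∉ Set.range (algebraMap k (FreeAlgebra k (Fin s))))
    (g P Q : FreeAlgebra k (Fin s))
    (hg : g ∈ Subalgebra.centralizer k ({f} : Set (FreeAlgebra k (Fin s))))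
    (hP : P ∈ Subalgebra.centralizer k ({f} : Set (FreeAlgebra k (Fin s))))
    (hQ : Q ∈ Subalgebra.centralizer k ({f} : Set (FreeAlgebra k (Fin s))))
    (hQ0 : Q ≠ 0) (m : ℕ) (hm : 1 ≤ m) (heq : g * Q ^ m = P ^ m) :
    ∃ h ∈ Subalgebra.centralizer k ({f} : Set (FreeAlgebra k (Fin s))), h ^ m = g := by
  simp only [Subalgebra.mem_centralizer_iff, Set.mem_singleton_iff, forall_eq] at *
  have e := FreeAlgebra.equivMonoidAlgebraFreeMonoid (R := k) (X := Fin s)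
  have hef : 0 < CIC.dg (e f) := by
    by_contra h0
    apply hf
    have h1 := CIC.eq_algebraMap_of_dg (x := e f) (by omega)
    refine ⟨(e f).coeff 1, e.injective ?_⟩
    rw [AlgEquiv.commutes, h1]
    simp
  obtain ⟨x, hx1, hx2⟩ := CIC.main (f := e f) (g := e g) (P := e P) (Q := e Q) hef
    (by rw [← map_mul, hP, map_mul]) (by rw [← map_mul, hQ, map_mul])
    (by simpa using hQ0) m hm (by rw [← map_pow, ← map_pow, ← map_mul, heq])
  refine ⟨e.symm x, e.injective ?_, e.injective ?_⟩
  · simpa using hx1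
  · simpa using hx2
end

section
/- Bergman's homomorphism proposition: let k be a field, s ≥ 1, and let C be a finitely generated k-subalgebra of the free associative algebra k⟨x_1,…,x_s⟩ which contains a non-scalar element. Then there exists a k-algebra homomorphism f : C → k[v] into the univariate polynomial ring such that the image of f is not contained in the constants, i.e. f(c) is a non-constant polynomial for some c ∈ C. -/
namespace BergmanHom

/-- The number whose base `s + 1` digits are the letters of the word `u`. -/
def num {s : ℕ} (u : FreeMonoid (Fin s)) : ℕ :=
  Nat.ofDigits (s + 1) (u.toList.map (fun i : Fin s => (i : ℕ)))

/-- The defect of a word relative to the slope `r`. It vanishes exactly when the periodic word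
`u u u …`, read as a number in base `s + 1`, has slope `r`. -/
def defect {s : ℕ} (r : ℚ) (u : FreeMonoid (Fin s)) : ℚ :=
  r * (((s : ℚ) + 1) ^ u.length - 1) - num u

theorem num_mul {s : ℕ} (u v : FreeMonoid (Fin s)) :
    num (u * v) = num u + (s + 1) ^ u.length * num v := by
  simp [num, Nat.ofDigits_append, FreeMonoid.length]

theorem num_inj {s : ℕ} (hs : 1 ≤ s) {u v : FreeMonoid (Fin s)} (hl : u.length = v.length)
    (h : num u = num v) : u = v := by
  have key := Nat.ofDigits_inj_of_len_eq (b := s + 1) (by omega)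
    (L1 := u.toList.map (fun i : Fin s => (i : ℕ)))
    (L2 := v.toList.map (fun i : Fin s => (i : ℕ))) (by simpa [FreeMonoid.length] using hl)
    (by
      intro l hl
      obtain ⟨i, -, rfl⟩ := List.mem_map.1 hl
      have := i.2
      omega)
    (by
      intro l hl
      obtain ⟨i, -, rfl⟩ := List.mem_map.1 hl
      have := i.2
      omega) h
  exact FreeMonoid.toList.injective (List.map_injective_iff.2 Fin.val_injective key)

theorem defect_one {s : ℕ} (r : ℚ) : defect r (1 : FreeMonoid (Fin s)) = 0 := by
  simp [defect, num]

theorem defect_mul {s : ℕ} (r : ℚ) (u v : FreeMonoid (Fin s)) :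
    defect r (u * v) = defect r u + ((s : ℚ) + 1) ^ u.length * defect r v := by
  simp only [defect, num_mul, FreeMonoid.length_mul, pow_add]
  push_cast
  ring

/-- Words of non-negative defect form a submonoid. -/
def nonnegWords (s : ℕ) (r : ℚ) : Submonoid (FreeMonoid (Fin s)) where
  carrier := {u | 0 ≤ defect r u}
  one_mem' := (defect_one r).ge
  mul_mem' := by
    intro u v hu hv
    simp only [Set.mem_ofPred_eq] at hu hv ⊢
    rw [defect_mul]
    positivity

theorem defect_mul_eq_zero {s : ℕ} {r : ℚ} {u v : FreeMonoid (Fin s)}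
    (hu : 0 ≤ defect r u) (hv : 0 ≤ defect r v) :
    defect r (u * v) = 0 ↔ defect r u = 0 ∧ defect r v = 0 := by
  have hp : (0 : ℚ) < ((s : ℚ) + 1) ^ u.length := by positivity
  rw [defect_mul, add_eq_zero_iff_of_nonneg hu (by positivity), mul_eq_zero]
  simp [hp.ne']

open Classical in
/-- The monoid homomorphism sending words of zero defect to powers of the variable and the words
of positive defect to zero. -/
noncomputable def wordHom (k : Type*) [Field k] (s : ℕ) (r : ℚ) :
    nonnegWords s r →* Polynomial k where
  toFun u := if defect r (u : FreeMonoid (Fin s)) = 0 then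
    Polynomial.X ^ (u : FreeMonoid (Fin s)).length else 0
  map_one' := by simp [defect_one]
  map_mul' u v := by
    have h := defect_mul_eq_zero (r := r) u.2 v.2
    by_cases h1 : defect r (u : FreeMonoid (Fin s)) = 0 <;>
      by_cases h2 : defect r (v : FreeMonoid (Fin s)) = 0 <;>
      simp [h, h1, h2, pow_add]

theorem coeff_lift {k : Type*} [Field k] {s : ℕ} (hs : 1 ≤ s) {r : ℚ}
    (u : nonnegWords s r) (hu : defect r (u : FreeMonoid (Fin s)) = 0)
    (a : MonoidAlgebra k (nonnegWords s r)) :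
    (MonoidAlgebra.lift k (Polynomial k) _ (wordHom k s r) a).coeff
      (u : FreeMonoid (Fin s)).length = a.coeff u := by
  classical
  induction a using MonoidAlgebra.induction_linear with
  | zero => simp
  | add x y hx hy => simp [hx, hy]
  | single m c =>
    rw [MonoidAlgebra.lift_single, MonoidAlgebra.coeff_single, Finsupp.single_apply]
    by_cases hm : m = u
    · subst hm
      simp [wordHom, hu]
    · by_cases hd : defect r (m : FreeMonoid (Fin s)) = 0
      · have hl : (u : FreeMonoid (Fin s)).length ≠ (m : FreeMonoid (Fin s)).length := by
          intro hl
          apply hm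
          apply Subtype.ext
          apply num_inj hs hl.symm
          simp only [defect] at hu hd
          rw [hl] at hu
          have : (num (m : FreeMonoid (Fin s)) : ℚ) = num (u : FreeMonoid (Fin s)) := by linarith
          exact_mod_cast this
        simp [wordHom, hd, hm, Polynomial.coeff_X_pow, hl]
      · simp [wordHom, hd, hm]

/-- Inclusion of the monoid algebra of the words of non-negative defect. -/
noncomputable def incl (k : Type*) [Field k] (s : ℕ) (r : ℚ) :
    MonoidAlgebra k (nonnegWords s r) →ₐ[k] MonoidAlgebra k (FreeMonoid (Fin s)) :=
  MonoidAlgebra.mapDomainAlgHom k k (nonnegWords s r).subtype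

theorem incl_eq {k : Type*} [Field k] {s : ℕ} {r : ℚ}
    (a : MonoidAlgebra k (nonnegWords s r)) :
    incl k s r a = MonoidAlgebra.mapDomain (nonnegWords s r).subtype a := rfl

theorem incl_injective (k : Type*) [Field k] (s : ℕ) (r : ℚ) :
    Function.Injective (incl k s r) :=
  MonoidAlgebra.mapDomain_injective Subtype.val_injective

theorem coeff_incl {k : Type*} [Field k] {s : ℕ} {r : ℚ}
    (a : MonoidAlgebra k (nonnegWords s r)) (u : nonnegWords s r) :
    (incl k s r a).coeff u = a.coeff u := by
  rw [incl_eq]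
  exact Finsupp.mapDomain_apply Subtype.val_injective a.coeff u

theorem mem_range_incl {k : Type*} [Field k] {s : ℕ} {r : ℚ}
    (x : MonoidAlgebra k (FreeMonoid (Fin s)))
    (hx : ∀ u ∈ x.coeff.support, 0 ≤ defect r u) : x ∈ (incl k s r).range := by
  rw [← MonoidAlgebra.sum_coeff_single x]
  refine Subalgebra.sum_mem _ fun u hu => ?_
  refine ⟨MonoidAlgebra.single ⟨u, hx u hu⟩ (x.coeff u), ?_⟩
  change incl k s r _ = _
  rw [incl_eq, MonoidAlgebra.mapDomain_single]
  rfl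

end BergmanHom

open BergmanHom

/-- **Bergman's homomorphism proposition.** Let `C` be a finitely generated
`k`-subalgebra of the free associative algebra `k⟨x_1,…,x_s⟩` containing a
non-scalar element. Then there is a `k`-algebra homomorphism `f : C → k[v]`
whose image is not contained in the constants. -/
theorem bergman_homomorphism_to_polynomials (k : Type*) [Field k] (s : ℕ)
    (hs : 1 ≤ s) (C : Subalgebra k (FreeAlgebra k (Fin s))) (hfg : C.FG)
    (hns : ∃ c ∈ C, c ∉ Set.range (algebraMap k (FreeAlgebra k (Fin s)))) :
    ∃ f : C →ₐ[k] Polynomial k,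
      ∃ c : C, f c ∉ Set.range (Polynomial.C : k → Polynomial k) := by
  classical
  obtain ⟨S, rfl⟩ := hfg
  let E : FreeAlgebra k (Fin s) ≃ₐ[k] MonoidAlgebra k (FreeMonoid (Fin s)) :=
    FreeAlgebra.equivMonoidAlgebraFreeMonoid
  -- all non-empty words occurring in the generators
  let W : Finset (FreeMonoid (Fin s)) :=
    (S.biUnion fun g => (E g).coeff.support).filter fun u => u ≠ 1
  have hW : W.Nonempty := by
    by_contra hne
    rw [Finset.not_nonempty_iff_eq_empty] at hne
    obtain ⟨c, hc, hcn⟩ := hns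
    have hle : Algebra.adjoin k (S : Set (FreeAlgebra k (Fin s))) ≤ ⊥ := by
      rw [Algebra.adjoin_le_iff]
      intro g hg
      have hsupp : ∀ u, u ≠ 1 → (E g).coeff u = 0 := by
        intro u hu
        by_contra h0
        have : u ∈ W := Finset.mem_filter.2
          ⟨Finset.mem_biUnion.2 ⟨g, hg, Finsupp.mem_support_iff.2 h0⟩, hu⟩
        rw [hne] at this
        simp at this
      have hEg : E g = algebraMap k _ ((E g).coeff 1) := by
        ext u
        rw [MonoidAlgebra.coe_algebraMap]
        by_cases hu : u = 1
        · subst hu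
          simp
        · simp [hsupp u hu, Finsupp.single_apply, Ne.symm hu]
      refine Algebra.mem_bot.2 ⟨(E g).coeff 1, ?_⟩
      apply E.injective
      rw [AlgEquiv.commutes]
      exact hEg.symm
    exact hcn (Algebra.mem_bot.1 (hle hc))
  obtain ⟨w, hwW, hmax⟩ := W.exists_max_image
    (fun u => (num u : ℚ) / (((s : ℚ) + 1) ^ u.length - 1)) hW
  have hpos : ∀ u : FreeMonoid (Fin s), u ≠ 1 → (0 : ℚ) < ((s : ℚ) + 1) ^ u.length - 1 := by
    intro u hu
    have h0 : u.length ≠ 0 := by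
      intro h
      exact hu (FreeMonoid.length_eq_zero.1 h)
    have hs' : (1 : ℚ) ≤ s := by exact_mod_cast hs
    have := one_lt_pow₀ (show (1 : ℚ) < (s : ℚ) + 1 by linarith) h0
    linarith
  obtain ⟨hwS, hw1⟩ := Finset.mem_filter.1 hwW
  obtain ⟨g, hgS, hgw⟩ := Finset.mem_biUnion.1 hwS
  set r : ℚ := (num w : ℚ) / (((s : ℚ) + 1) ^ w.length - 1) with hr
  have hdw : defect r w = 0 := by
    rw [defect, hr, div_mul_cancel₀ _ (hpos w hw1).ne', sub_self]
  have hle : Algebra.adjoin k (S : Set (FreeAlgebra k (Fin s))) ≤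
      (incl k s r).range.comap (E : FreeAlgebra k (Fin s) →ₐ[k] _) := by
    rw [Algebra.adjoin_le_iff]
    intro h hh
    refine mem_range_incl (E h) fun u hu => ?_
    by_cases hu1 : u = 1
    · rw [hu1, defect_one]
    · have := hmax u (Finset.mem_filter.2 ⟨Finset.mem_biUnion.2 ⟨h, hh, hu⟩, hu1⟩)
      rw [div_le_iff₀ (hpos u hu1)] at this
      exact sub_nonneg.2 this
  let ι : Algebra.adjoin k (S : Set (FreeAlgebra k (Fin s))) →ₐ[k] (incl k s r).range :=
    ((E : FreeAlgebra k (Fin s) →ₐ[k] MonoidAlgebra k (FreeMonoid (Fin s))).comp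
      (Subalgebra.val _)).codRestrict _
      fun c => hle c.2
  let e := AlgEquiv.ofInjective (incl k s r) (incl_injective k s r)
  let c : Algebra.adjoin k (S : Set (FreeAlgebra k (Fin s))) := ⟨g, Algebra.subset_adjoin hgS⟩
  refine ⟨(MonoidAlgebra.lift k (Polynomial k) _ (wordHom k s r)).comp
    ((e.symm : (incl k s r).range →ₐ[k] _).comp ι), c, ?_⟩
  rintro ⟨b, hb⟩
  have h1 := coeff_lift (k := k) hs (⟨w, hdw.ge⟩ : nonnegWords s r) hdw (e.symm (ι c))
  have h2 := coeff_incl (e.symm (ι c)) (⟨w, hdw.ge⟩ : nonnegWords s r)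
  have h3 : incl k s r (e.symm (ι c)) = E g :=
    congrArg Subtype.val (e.apply_symm_apply (ι c))
  rw [h3] at h2
  rw [← h2] at h1
  change Polynomial.C b = MonoidAlgebra.lift k (Polynomial k) _ (wordHom k s r) (e.symm (ι c)) at hb
  rw [← hb, Polynomial.coeff_C_of_ne_zero (fun h => hw1 (FreeMonoid.length_eq_zero.1 h))] at h1
  exact Finsupp.mem_support_iff.1 hgw h1.symm
end

section
/- Midpoint degeneration for quadratic maps (Wang's argument): let K be a field with char K ≠ 2, n ≥ 1, and let f_1,…,f_n ∈ K[x_1,…,x_n] each have total degree at most 2. If a, b ∈ K^n are distinct points with f_i(a) = f_i(b) for all i, then the Jacobian determinant of (f_1,…,f_n) vanishes at the midpoint: det( (∂f_i/∂x_j)((a+b)/2) ) = 0. -/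
lemma finsupp_peel {n : ℕ} (s : Fin n →₀ ℕ) :
    s = 0 ∨ ∃ i t, s = t + Finsupp.single i 1 ∧ s.degree = t.degree + 1 := by
  by_cases h : s = 0
  · exact Or.inl h
  · right
    obtain ⟨i, hi⟩ := Finsupp.ne_iff.mp h
    have hs : s = (s - Finsupp.single i 1) + Finsupp.single i 1 := by
      refine (tsub_add_cancel_of_le ?_).symm
      rw [Finsupp.single_le_iff]
      exact Nat.one_le_iff_ne_zero.mpr hi
    refine ⟨i, s - Finsupp.single i 1, hs, ?_⟩
    conv_lhs => rw [hs]
    rw [map_add, Finsupp.degree_single]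

lemma monomial_midpoint {K : Type*} [Field K] (h2 : (2 : K) ≠ 0) {n : ℕ}
    (a b : Fin n → K) (s : Fin n →₀ ℕ) (c : K) (hs : s.degree ≤ 2) :
    ∑ j, MvPolynomial.eval (fun l => (a l + b l) / 2)
      (MvPolynomial.pderiv j (MvPolynomial.monomial s c)) * (a j - b j)
      = MvPolynomial.eval a (MvPolynomial.monomial s c)
        - MvPolynomial.eval b (MvPolynomial.monomial s c) := by
  classical
  have hX : ∀ (t : Fin n →₀ ℕ) (i : Fin n), MvPolynomial.monomial (t + Finsupp.single i 1) c
      = MvPolynomial.monomial t c * MvPolynomial.X i := by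
    intro t i
    rw [MvPolynomial.X, MvPolynomial.monomial_mul, mul_one]
  have h0 : MvPolynomial.monomial (0 : Fin n →₀ ℕ) c = MvPolynomial.C c := rfl
  rcases finsupp_peel s with rfl | ⟨i, t, rfl, ht⟩
  · simp [h0]
  rcases finsupp_peel t with rfl | ⟨k, u, rfl, hu⟩
  · rw [hX, h0]
    simp [MvPolynomial.pderiv_mul, MvPolynomial.pderiv_X, Pi.single_apply, apply_ite]
    ring
  rcases finsupp_peel u with rfl | ⟨l, v, rfl, hv⟩
  · rw [hX, hX, h0]
    have hE : ∀ (m : Fin n → K) (i j : Fin n), MvPolynomial.eval m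
        (MvPolynomial.pderiv j (MvPolynomial.X i : MvPolynomial (Fin n) K))
        = if j = i then 1 else 0 := by
      intro m i j
      rw [MvPolynomial.pderiv_X, Pi.single_apply]
      split_ifs <;> simp_all
    simp only [MvPolynomial.pderiv_mul, map_add, map_mul, hE, MvPolynomial.pderiv_C,
      MvPolynomial.eval_X, MvPolynomial.eval_C, add_mul, Finset.sum_add_distrib, map_zero,
      zero_mul, zero_add, mul_ite, ite_mul, mul_one, mul_zero, Finset.sum_ite_eq',
      Finset.sum_ite_eq, Finset.mem_univ, if_true, Finset.sum_const_zero]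
    field_simp
    ring
  · omega

lemma quadratic_midpoint {K : Type*} [Field K] (h2 : (2 : K) ≠ 0) {n : ℕ}
    (a b : Fin n → K) (p : MvPolynomial (Fin n) K) (hp : p.totalDegree ≤ 2) :
    ∑ j, MvPolynomial.eval (fun l => (a l + b l) / 2) (MvPolynomial.pderiv j p) * (a j - b j)
      = MvPolynomial.eval a p - MvPolynomial.eval b p := by
  rw [p.as_sum]
  simp only [map_sum, Finset.sum_mul]
  rw [Finset.sum_comm, ← Finset.sum_sub_distrib]
  refine Finset.sum_congr rfl fun s hs => ?_
  exact monomial_midpoint h2 a b s _ ((MvPolynomial.le_totalDegree hs).trans hp)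

/-- **Midpoint degeneration for quadratic maps (Wang's argument).** Let `K` be a field
with `char K ≠ 2`, and let `f_1,…,f_n ∈ K[x_1,…,x_n]` have total degree at most `2`.
If `a ≠ b` are points of `K^n` with `f_i(a) = f_i(b)` for all `i`, then the Jacobian
determinant of `(f_1,…,f_n)` vanishes at the midpoint `(a+b)/2`. -/
theorem midpoint_jacobian_vanishes (K : Type*) [Field K] (h2 : (2 : K) ≠ 0)
    (n : ℕ) (hn : 1 ≤ n)
    (f : Fin n → MvPolynomial (Fin n) K) (hdeg : ∀ i, (f i).totalDegree ≤ 2)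
    (a b : Fin n → K) (hab : a ≠ b)
    (heq : ∀ i, MvPolynomial.eval a (f i) = MvPolynomial.eval b (f i)) :
    Matrix.det (Matrix.of fun i j =>
      MvPolynomial.eval (fun l => (a l + b l) / 2) (MvPolynomial.pderiv j (f i))) = 0 := by
  rw [← Matrix.exists_mulVec_eq_zero_iff]
  refine ⟨a - b, sub_ne_zero.mpr hab, ?_⟩
  ext i
  have h := quadratic_midpoint h2 a b (f i) (hdeg i)
  rw [heq i, sub_self] at h
  simpa [Matrix.mulVec, dotProduct] using h
end
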